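/- Let n ∈ ℕ, let ∅ ≠ S ⊆ ℕ^n, and for each j = 1,…,n let (λ_k^j)_{k∈ℕ} be a sequence of complex numbers with Re λ_k^j ≥ 1 for all k ∈ ℕ. Suppose that: (i) there exists ε > 0 such that for all distinct (k_1,…,k_n), (k_1',…,k_n') ∈ S one has |Re λ_{k_1}^1 − Re λ_{k_1'}^1| + ⋯ + |Re λ_{k_n}^n − Re λ_{k_n'}^n| ≥ ε; (ii) limsup_{t→+∞} card({(k_1,…,k_n) ∈ S : |Re λ_{k_1}^1 − 1| + ⋯ + |Re λ_{k_n}^n − 1| ≤ t}) / t^n > 0; (iii) for every j = 1,…,n there exists c_j ∈ ℝ such that Im λ_{k_j}^j = c_j for all (k_1,…,k_n) ∈ S. Then the family ((λ_{k_1}^1,…,λ_{k_n}^n)) indexed by (k_1,…,k_n) ∈ S is a uniqueness sequence for the n-dimensional Laplace transform. -/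

import Mathlib

open MeasureTheory Filter Set

noncomputable section

/-- Partial Laplace integral of `f : [0,∞) → ℂ` at `l` up to time `t`. -/
def lapPartial (f : ℝ → ℂ) (l : ℂ) (t : ℝ) : ℂ :=
  ∫ s in Set.Ioc (0:ℝ) t, Complex.exp (-(l * s)) * f s

/-- The Laplace transform of `f` at `l` exists and equals `F`. -/
def HasLaplace (f : ℝ → ℂ) (l : ℂ) (F : ℂ) : Prop :=
  Filter.Tendsto (lapPartial f l) Filter.atTop (nhds F)

/-- The abscissa of convergence of the Laplace transform of `f`, as an extended real. -/
def laplaceAbs (f : ℝ → ℂ) : EReal :=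
  sInf {x : EReal | ∃ ω : ℝ, x = (ω : EReal) ∧ ∀ l : ℂ, ω < l.re → ∃ F, HasLaplace f l F}

/-- `lam` is a uniqueness sequence for the one-dimensional Laplace transform. -/
def IsUniquenessSeq (lam : ℕ → ℂ) : Prop :=
  ∀ f : ℝ → ℂ, MeasureTheory.LocallyIntegrableOn f (Set.Ici 0) →
    (∀ k, laplaceAbs f < (((lam k).re : ℝ) : EReal)) →
    (∀ k, HasLaplace f (lam k) 0) →
    ∀ᵐ t : ℝ, 0 ≤ t → f t = 0

/-- Partial `n`-dimensional Laplace integral of `f : [0,∞)^n → ℂ` at `l` over the box `[0,t]`. -/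
def mLapPartial (n : ℕ) (f : (Fin n → ℝ) → ℂ) (l : Fin n → ℂ) (t : Fin n → ℝ) : ℂ :=
  ∫ s in Set.pi Set.univ (fun i => Set.Ioc (0:ℝ) (t i)),
    Complex.exp (-(∑ i, l i * (s i))) * f s

/-- The `n`-dimensional Laplace transform of `f` at `l` exists (as the iterated limit
`t₁ → ∞, …, tₙ → ∞` of the partial integrals) and equals `F`. -/
def HasMLaplace (n : ℕ) (f : (Fin n → ℝ) → ℂ) (l : Fin n → ℂ) (F : ℂ) : Prop :=
  Filter.Tendsto (mLapPartial n f l) Filter.atTop (nhds F)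

/-- `Ω(f)`: the region of convergence of the `n`-dimensional Laplace integral. -/
def mOmega (n : ℕ) (f : (Fin n → ℝ) → ℂ) : Set (Fin n → ℂ) :=
  {l | ∃ F, HasMLaplace n f l F}

/-- `Ω_b(f)`: the set of `l` for which the partial Laplace integrals are bounded. -/
def mOmegaB (n : ℕ) (f : (Fin n → ℝ) → ℂ) : Set (Fin n → ℂ) :=
  {l | Bornology.IsBounded (mLapPartial n f l '' {t | ∀ i, 0 ≤ t i})}

/-- A countable family `lam : K → ℂⁿ` is a uniqueness sequence for the `n`-dimensional
Laplace transform. -/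
def IsMUniquenessFamily (n : ℕ) {K : Type} [Countable K] (lam : K → Fin n → ℂ) : Prop :=
  ∀ f : (Fin n → ℝ) → ℂ,
    MeasureTheory.LocallyIntegrableOn f {t | ∀ i, 0 ≤ t i} →
    (∃ ω : Fin n → EReal, (∀ j, ω j ≠ ⊤) ∧
      {l : Fin n → ℂ | ∀ j, ω j < (((l j).re : ℝ) : EReal)} ⊆ mOmegaB n f ∩ mOmega n f ∧
      ∀ k j, ω j < ((((lam k j).re : ℝ)) : EReal)) →
    (∀ k, HasMLaplace n f (lam k) 0) →
    ∀ᵐ t : Fin n → ℝ, (∀ i, 0 ≤ t i) → f t = 0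

/-- The weight `-log ‖z‖` as an extended nonnegative number, infinite at zeros. -/
def logWeight (z : ℂ) : ENNReal := if z = 0 then ⊤ else ENNReal.ofReal (-Real.log ‖z‖)

lemma logWeight_zero : logWeight 0 = ⊤ := by simp [logWeight]

lemma logWeight_of_ne {z : ℂ} (hz : z ≠ 0) :
    logWeight z = ENNReal.ofReal (-Real.log ‖z‖) := by simp [logWeight, hz]

lemma measurable_logWeight : Measurable logWeight :=
  Measurable.ite (measurableSet_singleton 0) measurable_const
    (Real.measurable_log.comp measurable_norm).neg.ennreal_ofReal

lemma logWeight_mul {z w : ℂ} (hz : ‖z‖ ≤ 1) (hw : ‖w‖ ≤ 1) :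
    logWeight (z * w) = logWeight z + logWeight w := by
  by_cases h1 : z = 0
  · simp [h1, logWeight_zero]
  by_cases h2 : w = 0
  · simp [h2, logWeight_zero]
  rw [logWeight_of_ne h1, logWeight_of_ne h2, logWeight_of_ne (mul_ne_zero h1 h2), norm_mul,
    Real.log_mul (norm_ne_zero_iff.2 h1) (norm_ne_zero_iff.2 h2), neg_add,
    ENNReal.ofReal_add]
  · simpa using Real.log_nonpos (norm_nonneg _) hz
  · simpa using Real.log_nonpos (norm_nonneg _) hw

lemma logWeight_prod {ι : Type*} (s : Finset ι) (g : ι → ℂ) (hg : ∀ i ∈ s, ‖g i‖ ≤ 1) :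
    logWeight (∏ i ∈ s, g i) = ∑ i ∈ s, logWeight (g i) := by
  classical
  induction s using Finset.induction_on with
  | empty => simp [logWeight]
  | insert a s ha ih =>
    rw [Finset.prod_insert ha, Finset.sum_insert ha, logWeight_mul, ih]
    · exact fun i hi => hg i (Finset.mem_insert_of_mem hi)
    · exact hg a (Finset.mem_insert_self _ _)
    · rw [norm_prod]
      exact Finset.prod_le_one (fun _ _ => norm_nonneg _)
        fun i hi => hg i (Finset.mem_insert_of_mem hi)

lemma ofReal_le_logWeight {z : ℂ} {c : ℝ} (h : ‖z‖ ≤ Real.exp (-c)) :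
    ENNReal.ofReal c ≤ logWeight z := by
  by_cases h1 : z = 0
  · simp [h1, logWeight_zero]
  rw [logWeight_of_ne h1]
  apply ENNReal.ofReal_le_ofReal
  have := Real.log_le_log (norm_pos_iff.2 h1) h
  rw [Real.log_exp] at this
  linarith

lemma logWeight_le_ofReal {z : ℂ} {c : ℝ} (h : Real.exp (-c) ≤ ‖z‖) :
    logWeight z ≤ ENNReal.ofReal c := by
  have hz : 0 < ‖z‖ := (Real.exp_pos _).trans_le h
  rw [logWeight_of_ne (norm_pos_iff.1 hz)]
  apply ENNReal.ofReal_le_ofReal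
  have := Real.log_le_log (Real.exp_pos _) h
  rw [Real.log_exp] at this
  linarith

/-- The Blaschke factor of the disc of radius `9` vanishing at `a`. -/
def blaschke (a z : ℂ) : ℂ := 9 * (z - a) / (81 - (starRingEnd ℂ) a * z)

lemma blaschke_den_ne {a z : ℂ} (ha : ‖a‖ ≤ 6) (hz : ‖z‖ ≤ 10) :
    81 - (starRingEnd ℂ) a * z ≠ 0 := by
  intro h
  have h1 : ‖(81:ℂ)‖ = ‖a‖ * ‖z‖ := by
    rw [sub_eq_zero.1 h, norm_mul, RCLike.norm_conj]
  have h2 : ‖(81:ℂ)‖ = 81 := by norm_num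
  nlinarith [norm_nonneg a, norm_nonneg z]

lemma blaschke_normSq (a z : ℂ) :
    Complex.normSq (81 - (starRingEnd ℂ) a * z) - Complex.normSq (9 * (z - a)) =
      (81 - ‖z‖ ^ 2) * (81 - ‖a‖ ^ 2) := by
  rw [← Complex.normSq_eq_norm_sq, ← Complex.normSq_eq_norm_sq]
  simp only [Complex.normSq_apply, Complex.sub_re, Complex.sub_im, Complex.mul_re, Complex.mul_im,
    Complex.conj_re, Complex.conj_im]
  norm_num
  ring

lemma norm_blaschke_le_one {a z : ℂ} (ha : ‖a‖ ≤ 6) (hz : ‖z‖ ≤ 9) : ‖blaschke a z‖ ≤ 1 := by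
  have h0 := blaschke_den_ne ha (hz.trans (by norm_num))
  have h := blaschke_normSq a z
  rw [blaschke, norm_div, div_le_one (norm_pos_iff.2 h0)]
  rw [Complex.normSq_eq_norm_sq, Complex.normSq_eq_norm_sq] at h
  apply abs_le_of_sq_le_sq' _ (norm_nonneg _) |>.2
  have h1 : 0 ≤ (81 - ‖z‖ ^ 2) * (81 - ‖a‖ ^ 2) := by
    apply mul_nonneg <;> nlinarith [norm_nonneg a, norm_nonneg z]
  linarith

lemma norm_blaschke_eq_one {a z : ℂ} (ha : ‖a‖ ≤ 6) (hz : ‖z‖ = 9) : ‖blaschke a z‖ = 1 := by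
  have h0 := blaschke_den_ne ha (hz.le.trans (by norm_num))
  have h := blaschke_normSq a z
  rw [blaschke, norm_div, div_eq_one_iff_eq (norm_ne_zero_iff.2 h0)]
  rw [Complex.normSq_eq_norm_sq, Complex.normSq_eq_norm_sq, hz] at h
  rw [← sq_eq_sq₀ (norm_nonneg _) (norm_nonneg _)]
  linarith

lemma norm_blaschke_le {a b : ℂ} (ha : ‖a‖ ≤ 6) (hb : ‖b‖ ≤ 1) : ‖blaschke a b‖ ≤ 3 / 4 := by
  have h0 := blaschke_den_ne ha (hb.trans (by norm_num))
  have h := blaschke_normSq a b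
  rw [blaschke, norm_div, div_le_iff₀ (norm_pos_iff.2 h0)]
  rw [Complex.normSq_eq_norm_sq, Complex.normSq_eq_norm_sq] at h
  have h2 : ‖81 - (starRingEnd ℂ) a * b‖ ≤ 87 := by
    refine (norm_sub_le _ _).trans ?_
    rw [norm_mul, RCLike.norm_conj]
    have : ‖(81:ℂ)‖ = 81 := by norm_num
    nlinarith [norm_nonneg a, norm_nonneg b]
  apply abs_le_of_sq_le_sq' _ (by positivity) |>.2
  have h1 : 80 * 45 ≤ (81 - ‖b‖ ^ 2) * (81 - ‖a‖ ^ 2) := by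
    apply mul_le_mul <;> nlinarith [norm_nonneg a, norm_nonneg b]
  nlinarith [norm_nonneg (81 - (starRingEnd ℂ) a * b)]

lemma exists_blaschke_factor {φ : ℂ → ℂ} {b : ℂ} (hb : ‖b‖ ≤ 1) (m : ℕ)
    (hd : DifferentiableOn ℂ φ (Metric.ball 0 10)) (h1 : ∀ z, ‖z‖ ≤ 9 → ‖φ z‖ ≤ 1)
    (hm : (3 / 4 : ℝ) ^ m < ‖φ b‖) :
    ∃ (N : ℕ) (a : Fin N → ℂ) (h : ℂ → ℂ), (∀ i, ‖a i‖ ≤ 6) ∧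
      DifferentiableOn ℂ h (Metric.ball 0 10) ∧ (∀ z, ‖z‖ ≤ 9 → ‖h z‖ ≤ 1) ∧
      (∀ z, ‖z‖ ≤ 6 → h z ≠ 0) ∧ ∀ z, ‖z‖ < 10 → φ z = h z * ∏ i, blaschke (a i) z := by
  induction m generalizing φ with
  | zero => exact absurd (h1 b (hb.trans (by norm_num))) (by simpa using hm)
  | succ m ih =>
    by_cases hz : ∀ z, ‖z‖ ≤ 6 → φ z ≠ 0
    · exact ⟨0, fun i => i.elim0, φ, fun i => i.elim0, hd, h1, hz, by simp⟩
    push Not at hz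
    obtain ⟨a, ha, ha0⟩ := hz
    set ψ : ℂ → ℂ := fun z => dslope φ a z * ((81 - (starRingEnd ℂ) a * z) / 9) with hψ
    have hamem : Metric.ball (0:ℂ) 10 ∈ nhds a :=
      Metric.isOpen_ball.mem_nhds (by simp; linarith)
    have hdψ : DifferentiableOn ℂ ψ (Metric.ball 0 10) := by
      apply DifferentiableOn.mul
      · exact (Complex.differentiableOn_dslope hamem).2 hd
      · fun_prop
    have hfac : ∀ z, ‖z‖ ≤ 10 → φ z = ψ z * blaschke a z := by
      intro z hz
      have h2 := sub_smul_dslope φ a z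
      rw [ha0, sub_zero, smul_eq_mul] at h2
      have := blaschke_den_ne ha hz
      simp only [← h2, hψ, blaschke]
      generalize 81 - (starRingEnd ℂ) a * z = d at this ⊢
      field_simp
    have hψ1 : ∀ z, ‖z‖ ≤ 9 → ‖ψ z‖ ≤ 1 := by
      intro z hz
      refine Complex.norm_le_of_forall_mem_frontier_norm_le (U := Metric.ball 0 9)
        Metric.isBounded_ball ?_ ?_ ?_
      · apply DifferentiableOn.diffContOnCl
        rw [closure_ball _ (by norm_num)]
        exact hdψ.mono (Metric.closedBall_subset_ball (by norm_num))
      · intro w hw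
        rw [frontier_ball _ (by norm_num), mem_sphere_zero_iff_norm] at hw
        have := h1 w hw.le
        rw [hfac w (hw.le.trans (by norm_num)), norm_mul, norm_blaschke_eq_one ha hw,
          mul_one] at this
        exact this
      · rw [closure_ball _ (by norm_num)]; simpa using hz
    have hψb : (3 / 4 : ℝ) ^ m < ‖ψ b‖ := by
      rw [hfac b (hb.trans (by norm_num)), norm_mul, pow_succ] at hm
      have := norm_blaschke_le ha hb
      nlinarith [norm_nonneg (ψ b)]
    obtain ⟨N, a', h, h2, h3, h4, h5, h6⟩ := ih hdψ hψ1 hψb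
    refine ⟨N + 1, Fin.cons a a', h, ?_, h3, h4, h5, ?_⟩
    · intro i
      refine Fin.cases ?_ ?_ i
      · simpa using ha
      · simpa using h2
    · intro z hz
      rw [hfac z hz.le, h6 z hz, Fin.prod_univ_succ]
      simp only [Fin.cons_zero, Fin.cons_succ]
      ring

/-- A function bounded by one splits off its zeros near the origin as Blaschke factors. -/
lemma exists_logWeight_decomposition {φ : ℂ → ℂ} {b : ℂ} (hb : ‖b‖ ≤ 1)
    (hd : DifferentiableOn ℂ φ (Metric.ball 0 10)) (h1 : ∀ z, ‖z‖ ≤ 9 → ‖φ z‖ ≤ 1)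
    (hm : φ b ≠ 0) :
    ∃ (N : ℕ) (a : Fin N → ℂ) (h : ℂ → ℂ), (∀ i, ‖a i‖ ≤ 6) ∧
      DifferentiableOn ℂ h (Metric.ball 0 10) ∧ (∀ z, ‖z‖ ≤ 9 → ‖h z‖ ≤ 1) ∧
      (∀ z, ‖z‖ ≤ 6 → h z ≠ 0) ∧
      (∀ z, ‖z‖ < 10 → φ z = h z * ∏ i, blaschke (a i) z) ∧
      ∀ z, ‖z‖ ≤ 9 → logWeight (φ z) = logWeight (h z) + ∑ i, logWeight (blaschke (a i) z) := by
  obtain ⟨m, hm⟩ := exists_pow_lt_of_lt_one (norm_pos_iff.2 hm) (by norm_num : (3/4:ℝ) < 1)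
  obtain ⟨N, a, h, h2, h3, h4, h5, h6⟩ := exists_blaschke_factor hb m hd h1 hm
  refine ⟨N, a, h, h2, h3, h4, h5, h6, fun z hz => ?_⟩
  have h7 : ∀ i, ‖blaschke (a i) z‖ ≤ 1 := fun i => norm_blaschke_le_one (h2 i) hz
  rw [h6 z (hz.trans_lt (by norm_num)), logWeight_mul (h4 z hz), logWeight_prod]
  · exact fun i _ => h7 i
  · rw [norm_prod]
    exact Finset.prod_le_one (fun _ _ => norm_nonneg _) fun i _ => h7 i

lemma card_le_logWeight {N : ℕ} {a : Fin N → ℂ} (ha : ∀ i, ‖a i‖ ≤ 6) {b : ℂ} (hb : ‖b‖ ≤ 1) :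
    (N : ENNReal) * ENNReal.ofReal (Real.log (4 / 3)) ≤ ∑ i, logWeight (blaschke (a i) b) := by
  have : ∀ i ∈ Finset.univ, ENNReal.ofReal (Real.log (4 / 3)) ≤ logWeight (blaschke (a i) b) := by
    intro i _
    apply ofReal_le_logWeight
    rw [Real.exp_neg, Real.exp_log (by norm_num)]
    exact (norm_blaschke_le (ha i) hb).trans (by norm_num)
  simpa using Finset.card_nsmul_le_sum _ _ _ this

lemma lintegral_circle_logWeight {g : ℂ → ℂ} {u : ℂ → ℝ} (hu : CircleIntegrable u 0 1)
    (h1 : ∀ z, ‖z‖ = 1 → ‖g z‖ ≤ 1) {s : Set ℂ} (hs : s.Countable)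
    (h0 : ∀ z, ‖z‖ = 1 → z ∉ s → g z ≠ 0 ∧ Real.log ‖g z‖ = u z) :
    ∫⁻ t in Ioc 0 (2 * Real.pi), logWeight (g (circleMap 0 1 t)) =
      ENNReal.ofReal (2 * Real.pi * -Real.circleAverage u 0 1) := by
  have hpi : (0:ℝ) ≤ 2 * Real.pi := by positivity
  have hc : (circleMap 0 1 ⁻¹' s).Countable := hs.preimage_circleMap _ (by norm_num)
  have hae : ∀ᵐ t ∂(volume.restrict (Ioc 0 (2 * Real.pi))), t ∉ circleMap 0 1 ⁻¹' s :=
    ae_restrict_of_ae (measure_eq_zero_iff_ae_notMem.1 (hc.measure_zero volume))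
  rw [Real.circleAverage_def, intervalIntegral.integral_of_le hpi, smul_eq_mul,
    ← mul_neg, ← integral_neg, mul_inv_cancel_left₀ (by positivity),
    ofReal_integral_eq_lintegral_ofReal]
  · refine lintegral_congr_ae ?_
    filter_upwards [hae] with t ht
    obtain ⟨h2, h3⟩ := h0 (circleMap 0 1 t) (by simp) ht
    rw [logWeight_of_ne h2, h3]
  · exact ((intervalIntegrable_iff_integrableOn_Ioc_of_le hpi).1 hu).neg
  · filter_upwards [hae] with t ht
    rw [← (h0 (circleMap 0 1 t) (by simp) ht).2]
    simpa using Real.log_nonpos (norm_nonneg _) (h1 (circleMap 0 1 t) (by simp))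

lemma lintegral_circle_zeroFree {h : ℂ → ℂ} (hd : DifferentiableOn ℂ h (Metric.ball 0 10))
    (h1 : ∀ z, ‖z‖ ≤ 9 → ‖h z‖ ≤ 1) (h0 : ∀ z, ‖z‖ ≤ 6 → h z ≠ 0) {x z : ℂ}
    (hxz : ‖x‖ + ‖z‖ ≤ 6) :
    ∫⁻ t in Ioc 0 (2 * Real.pi), logWeight (h (x + circleMap 0 1 t * z)) =
      ENNReal.ofReal (2 * Real.pi) * logWeight (h x) := by
  have hle : ∀ w : ℂ, ‖w‖ ≤ 1 → ‖x + w * z‖ ≤ 6 := by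
    intro w hw
    refine (norm_add_le _ _).trans (le_trans ?_ hxz)
    rw [norm_mul]
    nlinarith [norm_nonneg z]
  have hana : AnalyticOnNhd ℂ (fun w => h (x + w * z)) (Metric.closedBall 0 1) := by
    intro w hw
    have hw' := hle w (by simpa using hw)
    have : AnalyticAt ℂ h (x + w * z) :=
      hd.analyticAt (Metric.isOpen_ball.mem_nhds (by simp; linarith))
    exact AnalyticAt.fun_comp this (by fun_prop)
  have hm : MeromorphicOn (fun w => h (x + w * z)) (Metric.sphere 0 |1|) := fun w hw =>
    (hana w (Metric.sphere_subset_closedBall (by simpa using hw))).meromorphicAt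
  have := lintegral_circle_logWeight (g := fun w => h (x + w * z)) (s := ∅)
    hm.circleIntegrable_log_norm
    (fun w hw => h1 _ ((hle w hw.le).trans (by norm_num))) countable_empty
    (fun w hw _ => ⟨h0 _ (hle w hw.le), rfl⟩)
  rw [this, AnalyticOnNhd.circleAverage_log_norm_of_ne_zero (by simpa using hana)]
  · rw [logWeight_of_ne (h0 x (by linarith [norm_nonneg z])), ENNReal.ofReal_mul (by positivity)]
    simp
  · intro w hw
    exact h0 _ (hle w (by simpa using hw))

lemma lintegral_circle_blaschke {a x z : ℂ} (ha : ‖a‖ ≤ 6) (hz : z ≠ 0)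
    (hxz : ‖x‖ + ‖z‖ ≤ 6) :
    ∫⁻ t in Ioc 0 (2 * Real.pi), logWeight (blaschke a (x + circleMap 0 1 t * z)) =
      ENNReal.ofReal (2 * Real.pi * (Real.log ‖81 - (starRingEnd ℂ) a * x‖ - Real.log 9
        - max (Real.log ‖z‖) (Real.log ‖z‖ + Real.log (‖a - x‖ / ‖z‖)))) := by
  have hle : ∀ w : ℂ, ‖w‖ ≤ 1 → ‖x + w * z‖ ≤ 6 := by
    intro w hw
    refine (norm_add_le _ _).trans (le_trans ?_ hxz)
    rw [norm_mul]
    nlinarith [norm_nonneg z]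
  have hden : ∀ w : ℂ, ‖w‖ ≤ 1 → 81 - (starRingEnd ℂ) a * (x + w * z) ≠ 0 := fun w hw =>
    blaschke_den_ne ha ((hle w hw).trans (by norm_num))
  have hana : AnalyticOnNhd ℂ (fun w => 81 - (starRingEnd ℂ) a * (x + w * z))
      (Metric.closedBall 0 1) := by
    intro w hw
    fun_prop
  have hm : CircleIntegrable (fun w => Real.log ‖81 - (starRingEnd ℂ) a * (x + w * z)‖) 0 1 :=
    MeromorphicOn.circleIntegrable_log_norm (fun w _ => by fun_prop)
  have hl : CircleIntegrable (fun w => Real.log ‖w - (a - x) / z‖) 0 1 :=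
    circleIntegrable_log_norm_sub_const _
  have hk : CircleIntegrable (fun _ : ℂ => Real.log 9 + Real.log ‖z‖) 0 1 :=
    circleIntegrable_const _ _ _
  have := lintegral_circle_logWeight (g := fun w => blaschke a (x + w * z)) (s := {(a - x) / z})
    ((hl.add hk).sub hm)
    (fun w hw => norm_blaschke_le_one ha ((hle w hw.le).trans (by norm_num)))
    (countable_singleton _)
    (fun w hw hne => by
      have h2 : w - (a - x) / z ≠ 0 := sub_ne_zero.2 hne
      have h3 : x + w * z - a = z * (w - (a - x) / z) := by field_simp; ring
      have h4 := hden w hw.le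
      refine ⟨div_ne_zero (mul_ne_zero (by norm_num) (h3 ▸ mul_ne_zero hz h2)) h4, ?_⟩
      rw [blaschke, h3, norm_div, norm_mul, norm_mul, Real.log_div, Real.log_mul, Real.log_mul]
      · simp only [Pi.add_apply, Pi.sub_apply]
        norm_num
        ring
      all_goals simp [hz, h2, h4])
  rw [this, Real.circleAverage_sub (hl.add hk) hm, Real.circleAverage_add hl hk,
    Real.circleAverage_const, circleAverage_log_norm_sub_const_eq_posLog,
    AnalyticOnNhd.circleAverage_log_norm_of_ne_zero (by simpa using hana), Real.posLog_apply,
    norm_div]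
  · congr 2
    have : max (Real.log ‖z‖) (Real.log ‖z‖ + Real.log (‖a - x‖ / ‖z‖)) =
      Real.log ‖z‖ + max 0 (Real.log (‖a - x‖ / ‖z‖)) := by rw [← max_add_add_left, add_zero]
    rw [this]
    simp only [zero_mul, add_zero]
    ring
  · intro w hw
    exact hden w (by simpa using hw)

lemma lintegral_circle_blaschke_le {a x z : ℂ} (ha : ‖a‖ ≤ 6) (hxz : ‖x‖ + 2 * ‖z‖ ≤ 6) :
    ∫⁻ t in Ioc 0 (2 * Real.pi), logWeight (blaschke a (x + circleMap 0 1 t * z)) ≤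
      (∫⁻ t in Ioc 0 (2 * Real.pi), logWeight (blaschke a (x + circleMap 0 1 t * (2 * z)))) +
        (if ‖a - x‖ < 2 * ‖z‖ then ENNReal.ofReal (2 * Real.pi * Real.log 2) else 0) := by
  by_cases hz : z = 0
  · simp [hz]
  have hz' : 0 < ‖z‖ := norm_pos_iff.2 hz
  have h2z : ‖2 * z‖ = 2 * ‖z‖ := by simp
  have hpi := Real.pi_pos
  rw [lintegral_circle_blaschke ha hz (by linarith),
    lintegral_circle_blaschke ha (by simpa using hz) (by rw [h2z]; linarith), h2z]
  have hlog : Real.log (2 * ‖z‖) = Real.log 2 + Real.log ‖z‖ :=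
    Real.log_mul (by norm_num) hz'.ne'
  have hl2 : 0 ≤ Real.log 2 := Real.log_nonneg (by norm_num)
  split_ifs with h
  · refine le_trans (ENNReal.ofReal_le_ofReal ?_) ENNReal.ofReal_add_le
    rw [← mul_add]
    refine mul_le_mul_of_nonneg_left ?_ (by positivity)
    have h1 : Real.log (‖a - x‖ / (2 * ‖z‖)) ≤ 0 :=
      Real.log_nonpos (by positivity) (by rw [div_le_one (by positivity)]; exact h.le)
    rw [max_eq_left (by linarith : Real.log (2 * ‖z‖) + Real.log (‖a - x‖ / (2 * ‖z‖)) ≤ _)]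
    have := le_max_left (Real.log ‖z‖) (Real.log ‖z‖ + Real.log (‖a - x‖ / ‖z‖))
    linarith
  · push Not at h
    have hax : 0 < ‖a - x‖ := by linarith
    rw [add_zero, Real.log_div hax.ne' hz'.ne', Real.log_div hax.ne' (by positivity)]
    apply ENNReal.ofReal_le_ofReal
    refine mul_le_mul_of_nonneg_left ?_ (by positivity)
    have := Real.log_le_log (by positivity) h
    rw [max_eq_right (by linarith), max_eq_right (by linarith)]
    linarith

lemma lintegral_circle_blaschke_ge {a x z : ℂ} (ha : ‖a‖ ≤ 6) (hz : z ≠ 0)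
    (hxz : ‖x‖ + 2 * ‖z‖ ≤ 6) :
    (∫⁻ t in Ioc 0 (2 * Real.pi), logWeight (blaschke a (x + circleMap 0 1 t * (2 * z)))) ≤
      ∫⁻ t in Ioc 0 (2 * Real.pi), logWeight (blaschke a (x + circleMap 0 1 t * z)) := by
  have hz' : 0 < ‖z‖ := norm_pos_iff.2 hz
  have h2z : ‖2 * z‖ = 2 * ‖z‖ := by simp
  have hpi := Real.pi_pos
  rw [lintegral_circle_blaschke ha hz (by linarith),
    lintegral_circle_blaschke ha (by simpa using hz) (by rw [h2z]; linarith), h2z]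
  have hlog : Real.log (2 * ‖z‖) = Real.log 2 + Real.log ‖z‖ :=
    Real.log_mul (by norm_num) hz'.ne'
  have hl2 : 0 ≤ Real.log 2 := Real.log_nonneg (by norm_num)
  apply ENNReal.ofReal_le_ofReal
  refine mul_le_mul_of_nonneg_left ?_ (by positivity)
  have : max (Real.log ‖z‖) (Real.log ‖z‖ + Real.log (‖a - x‖ / ‖z‖)) ≤
      max (Real.log (2 * ‖z‖)) (Real.log (2 * ‖z‖) + Real.log (‖a - x‖ / (2 * ‖z‖))) := by
    rcases (norm_nonneg (a - x)).eq_or_lt with h | hax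
    · rw [← h]; simp; linarith
    · rw [Real.log_div hax.ne' hz'.ne', Real.log_div hax.ne' (by positivity)]
      apply max_le_max <;> linarith
  linarith

lemma lintegral_circle_blaschke_self {x z : ℂ} (hx : ‖x‖ ≤ 6) (hz : z ≠ 0)
    (hxz : ‖x‖ + 2 * ‖z‖ ≤ 6) :
    (∫⁻ t in Ioc 0 (2 * Real.pi), logWeight (blaschke x (x + circleMap 0 1 t * (2 * z)))) +
        ENNReal.ofReal (2 * Real.pi * Real.log 2) ≤
      ∫⁻ t in Ioc 0 (2 * Real.pi), logWeight (blaschke x (x + circleMap 0 1 t * z)) := by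
  have hz' : 0 < ‖z‖ := norm_pos_iff.2 hz
  have h2z : ‖2 * z‖ = 2 * ‖z‖ := by simp
  have hpi := Real.pi_pos
  have hlog : Real.log (2 * ‖z‖) = Real.log 2 + Real.log ‖z‖ :=
    Real.log_mul (by norm_num) hz'.ne'
  have hl2 : 0 ≤ Real.log 2 := Real.log_nonneg (by norm_num)
  rw [lintegral_circle_blaschke hx hz (by linarith),
    lintegral_circle_blaschke hx (by simpa using hz) (by rw [h2z]; linarith), h2z]
  simp only [sub_self, norm_zero, zero_div, Real.log_zero, add_zero, max_self]
  rw [← ENNReal.ofReal_add]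
  · apply ENNReal.ofReal_le_ofReal
    rw [hlog]
    linarith
  · refine mul_nonneg (by positivity) ?_
    rw [sub_sub, ← Real.log_mul (by norm_num) (by positivity)]
    have h1 : ‖81 - (starRingEnd ℂ) x * x‖ = 81 - ‖x‖ ^ 2 := by
      rw [mul_comm, Complex.mul_conj, Complex.normSq_eq_norm_sq, ← Complex.ofReal_ofNat,
        ← Complex.ofReal_sub, Complex.norm_real, Real.norm_of_nonneg]
      nlinarith [norm_nonneg x]
    rw [h1, sub_nonneg]
    apply Real.log_le_log (by positivity)
    nlinarith [norm_nonneg x]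
  · positivity

lemma measurable_blaschke (a : ℂ) : Measurable (blaschke a) := by
  unfold blaschke; fun_prop

lemma lintegral_circle_split {φ h : ℂ → ℂ} {N : ℕ} {a : Fin N → ℂ}
    (hφ : ∀ z, ‖z‖ ≤ 9 → logWeight (φ z) = logWeight (h z) + ∑ i, logWeight (blaschke (a i) z))
    {x z : ℂ} (hxz : ‖x‖ + ‖z‖ ≤ 6) :
    ∫⁻ t in Ioc 0 (2 * Real.pi), logWeight (φ (x + circleMap 0 1 t * z)) =
      (∫⁻ t in Ioc 0 (2 * Real.pi), logWeight (h (x + circleMap 0 1 t * z))) +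
      ∑ i, ∫⁻ t in Ioc 0 (2 * Real.pi), logWeight (blaschke (a i) (x + circleMap 0 1 t * z)) := by
  have hm : ∀ i, Measurable fun t => logWeight (blaschke (a i) (x + circleMap 0 1 t * z)) := by
    intro i
    have : Measurable (fun t => x + circleMap 0 1 t * z) := by fun_prop
    exact measurable_logWeight.comp ((measurable_blaschke _).comp this)
  rw [← lintegral_finsetSum _ fun i _ => hm i, ← lintegral_add_right]
  · refine lintegral_congr fun t => hφ _ ?_
    refine (norm_add_le _ _).trans ?_
    simp only [norm_mul, norm_circleMap_zero, abs_one, one_mul]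
    linarith
  · exact Finset.measurable_sum _ fun i _ => hm i

lemma lintegral_circle_le {φ h : ℂ → ℂ} {N : ℕ} {a : Fin N → ℂ} (ha : ∀ i, ‖a i‖ ≤ 6)
    (hd : DifferentiableOn ℂ h (Metric.ball 0 10))
    (h1 : ∀ z, ‖z‖ ≤ 9 → ‖h z‖ ≤ 1) (h0 : ∀ z, ‖z‖ ≤ 6 → h z ≠ 0)
    (hφ : ∀ z, ‖z‖ ≤ 9 → logWeight (φ z) = logWeight (h z) + ∑ i, logWeight (blaschke (a i) z))
    {x z : ℂ} {s : ℝ} (hxz : ‖x‖ + 2 * ‖z‖ ≤ 6) (hs : ‖z‖ ≤ s) :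
    ∫⁻ t in Ioc 0 (2 * Real.pi), logWeight (φ (x + circleMap 0 1 t * z)) ≤
      (∫⁻ t in Ioc 0 (2 * Real.pi), logWeight (φ (x + circleMap 0 1 t * (2 * z)))) +
      ∑ i, (if ‖a i - x‖ < 2 * s then ENNReal.ofReal (2 * Real.pi * Real.log 2) else 0) := by
  have h2z : ‖2 * z‖ = 2 * ‖z‖ := by simp
  have hz := norm_nonneg z
  rw [lintegral_circle_split hφ (by linarith), lintegral_circle_split hφ (by rw [h2z]; linarith),
    lintegral_circle_zeroFree hd h1 h0 (by linarith),
    lintegral_circle_zeroFree hd h1 h0 (by rw [h2z]; linarith), add_assoc,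
    ← Finset.sum_add_distrib]
  refine add_le_add le_rfl (Finset.sum_le_sum fun i _ => ?_)
  refine (lintegral_circle_blaschke_le (ha i) hxz).trans (add_le_add le_rfl ?_)
  split_ifs with h2 h3 h3
  · exact le_rfl
  · exact absurd (h2.trans_le (by linarith)) h3
  · exact zero_le
  · exact le_rfl

lemma lintegral_circle_gain {φ : ℂ → ℂ} (hd : DifferentiableOn ℂ φ (Metric.ball 0 10))
    (h1 : ∀ z, ‖z‖ ≤ 9 → ‖φ z‖ ≤ 1) (h0 : φ 0 = 0) :
    (∫⁻ t in Ioc 0 (2 * Real.pi), logWeight (φ (circleMap 0 1 t * 2))) +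
        ENNReal.ofReal (2 * Real.pi * Real.log 2) ≤
      ∫⁻ t in Ioc 0 (2 * Real.pi), logWeight (φ (circleMap 0 1 t)) := by
  by_cases hb : ∀ b, ‖b‖ ≤ 1 → φ b = 0
  · have : ∀ t, logWeight (φ (circleMap 0 1 t)) = ⊤ := fun t => by
      rw [hb _ (by simp), logWeight_zero]
    simp only [this, lintegral_const, MeasurableSet.univ, Measure.restrict_apply, univ_inter,
      Real.volume_Ioc, sub_zero]
    rw [ENNReal.top_mul]
    · exact le_top
    · simpa using Real.pi_pos
  push Not at hb
  obtain ⟨b, hb, hb0⟩ := hb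
  obtain ⟨N, a, h, ha, h2, h3, h4, h5, h6⟩ := exists_logWeight_decomposition hb hd h1 hb0
  have h7 : ∃ i, a i = 0 := by
    have := h5 0 (by simp)
    rw [h0, eq_comm, mul_eq_zero, Finset.prod_eq_zero_iff] at this
    obtain ⟨i, -, hi⟩ := this.resolve_left (h4 0 (by simp))
    exact ⟨i, by simpa [blaschke] using hi⟩
  obtain ⟨i, hi⟩ := h7
  have e1 := lintegral_circle_split (x := 0) (z := 1) h6 (by norm_num)
  have e2 := lintegral_circle_split (x := 0) (z := 2 * 1) h6 (by simp; norm_num)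
  rw [lintegral_circle_zeroFree h2 h3 h4 (by norm_num)] at e1 e2
  simp only [zero_add, mul_one] at e1 e2
  rw [e1, e2, ← Finset.add_sum_erase _ _ (Finset.mem_univ i),
    ← Finset.add_sum_erase _ _ (Finset.mem_univ i)]
  have g1 := lintegral_circle_blaschke_self (x := 0) (z := 1) (by simp) (by simp)
    (by simp; norm_num)
  have g2 : ∀ j ∈ Finset.univ.erase i, _ := fun j _ =>
    lintegral_circle_blaschke_ge (a := a j) (x := 0) (z := 1) (ha j) (by simp) (by simp; norm_num)
  simp only [zero_add, mul_one] at g1 g2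
  rw [hi]
  have := Finset.sum_le_sum g2
  calc _ = ENNReal.ofReal (2 * Real.pi) * logWeight (h 0) +
      (((∫⁻ t in Ioc 0 (2 * Real.pi), logWeight (blaschke 0 (circleMap 0 1 t * 2))) +
        ENNReal.ofReal (2 * Real.pi * Real.log 2)) +
        ∑ j ∈ Finset.univ.erase i,
          ∫⁻ t in Ioc 0 (2 * Real.pi), logWeight (blaschke (a j) (circleMap 0 1 t * 2))) := by ring
    _ ≤ _ := by gcongr

lemma lintegral_ball_rotation {E : Type*} [NormedAddCommGroup E] [NormedSpace ℂ E]
    [MeasurableSpace E] [BorelSpace E] [SecondCountableTopology E] {μ : Measure E} [SFinite μ]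
    (hrot : ∀ c : ℂ, ‖c‖ = 1 → MeasurePreserving (fun z : E => c • z) μ μ) (r : ℝ)
    {u : E → ENNReal} (hu : Measurable u) :
    ENNReal.ofReal (2 * Real.pi) * ∫⁻ z in Metric.ball 0 r, u z ∂μ =
      ∫⁻ z in Metric.ball 0 r, (∫⁻ t in Ioc 0 (2 * Real.pi), u (circleMap 0 1 t • z)) ∂μ := by
  rw [lintegral_lintegral_swap]
  · have : ∀ t, ∫⁻ z in Metric.ball 0 r, u (circleMap 0 1 t • z) ∂μ =
        ∫⁻ z in Metric.ball 0 r, u z ∂μ := by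
      intro t
      have h := (hrot (circleMap 0 1 t) (by simp)).setLIntegral_comp_preimage
        (Metric.isOpen_ball (x := (0:E)) (ε := r)).measurableSet hu
      rw [← h]
      congr 2
      ext z
      simp [norm_smul]
    simp only [this, lintegral_const]
    rw [mul_comm]
    simp
  · apply Measurable.aemeasurable
    apply hu.comp
    have : Continuous fun p : E × ℝ => circleMap 0 1 p.2 • p.1 := by fun_prop
    exact this.measurable

lemma lintegral_ball_two_mul {E : Type*} [NormedAddCommGroup E] [NormedSpace ℝ E]
    [MeasurableSpace E] [BorelSpace E] [FiniteDimensional ℝ E] (μ : Measure E)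
    [μ.IsAddHaarMeasure] (x : E) (s : ℝ) {u : E → ENNReal} (hu : Measurable u) :
    ∫⁻ z in Metric.ball x (2 * s), u z ∂μ =
      2 ^ Module.finrank ℝ E * ∫⁻ z in Metric.ball 0 s, u (x + (2:ℝ) • z) ∂μ := by
  have h1 : ∫⁻ z in Metric.ball x (2 * s), u z ∂μ =
      ∫⁻ z, (Metric.ball 0 (2 * s)).indicator (fun z => u (x + z)) z ∂μ := by
    rw [← lintegral_indicator Metric.isOpen_ball.measurableSet, ← lintegral_add_left_eq_self _ x]
    refine lintegral_congr fun z => ?_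
    simp [indicator]
  have h2 : ∫⁻ z in Metric.ball 0 s, u (x + (2:ℝ) • z) ∂μ =
      ∫⁻ z, (Metric.ball 0 (2 * s)).indicator (fun z => u (x + z)) ((2:ℝ) • z) ∂μ := by
    rw [← lintegral_indicator Metric.isOpen_ball.measurableSet]
    refine lintegral_congr fun z => ?_
    simp [indicator, norm_smul]
  have hm : Measurable ((Metric.ball 0 (2 * s)).indicator (fun z => u (x + z))) :=
    (hu.comp (measurable_const_add x)).indicator Metric.isOpen_ball.measurableSet
  rw [h1, h2, ← lintegral_map (f := (Metric.ball 0 (2 * s)).indicator (fun z => u (x + z))) hm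
    (measurable_const_smul (2:ℝ)), Measure.map_addHaar_smul _ (by norm_num),
    lintegral_smul_measure, smul_eq_mul, ← mul_assoc]
  rw [abs_of_pos (by positivity), ENNReal.ofReal_inv_of_pos (by positivity),
    ENNReal.ofReal_pow (by norm_num), ENNReal.ofReal_ofNat, ENNReal.mul_inv_cancel, one_mul]
  · simp
  · exact ENNReal.pow_ne_top (by simp)

lemma lintegral_ball_translate {E : Type*} [NormedAddCommGroup E]
    [MeasurableSpace E] [BorelSpace E] (μ : Measure E)
    [μ.IsAddLeftInvariant] (x : E) (s : ℝ) (u : E → ENNReal) :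
    ∫⁻ z in Metric.ball x s, u z ∂μ = ∫⁻ z in Metric.ball 0 s, u (x + z) ∂μ := by
  rw [← lintegral_indicator Metric.isOpen_ball.measurableSet, ← lintegral_add_left_eq_self _ x,
    ← lintegral_indicator Metric.isOpen_ball.measurableSet]
  refine lintegral_congr fun z => ?_
  simp [indicator]

lemma measurePreserving_unit_smul (c : ℂ) (hc : ‖c‖ = 1) :
    MeasurePreserving (fun z : ℂ => c • z) := by
  obtain ⟨c, rfl⟩ : ∃ d : Circle, (d : ℂ) = c := ⟨⟨c, mem_sphere_zero_iff_norm.2 hc⟩, rfl⟩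
  exact (rotation c).measurePreserving

lemma measurePreserving_unit_smul_pi (n : ℕ) (c : ℂ) (hc : ‖c‖ = 1) :
    MeasurePreserving (fun z : Fin n → ℂ => c • z) :=
  volume_preserving_pi fun _ => measurePreserving_unit_smul c hc

lemma measurable_indicator_of_continuousOn {E : Type*} [TopologicalSpace E] [MeasurableSpace E]
    [BorelSpace E] {f : E → ℂ} {s : Set E} (hs : MeasurableSet s) (hf : ContinuousOn f s) :
    Measurable (s.indicator f) := by
  classical
  rw [← piecewise_eq_indicator]
  exact hf.measurable_piecewise continuousOn_const hs

lemma exists_measurable_decomposition {φ : ℂ → ℂ} {b : ℂ} (hb : ‖b‖ ≤ 1)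
    (hd : DifferentiableOn ℂ φ (Metric.ball 0 10)) (h1 : ∀ z, ‖z‖ ≤ 9 → ‖φ z‖ ≤ 1)
    (hm : φ b ≠ 0) :
    ∃ (N : ℕ) (a : Fin N → ℂ) (h : ℂ → ℂ), (∀ i, ‖a i‖ ≤ 6) ∧ Measurable h ∧
      DifferentiableOn ℂ h (Metric.ball 0 10) ∧ (∀ z, ‖z‖ ≤ 9 → ‖h z‖ ≤ 1) ∧
      (∀ z, ‖z‖ ≤ 6 → h z ≠ 0) ∧
      ∀ z, ‖z‖ ≤ 9 → logWeight (φ z) = logWeight (h z) + ∑ i, logWeight (blaschke (a i) z) := by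
  obtain ⟨N, a, h, ha, h2, h3, h4, -, h6⟩ := exists_logWeight_decomposition hb hd h1 hm
  have e : ∀ z, ‖z‖ ≤ 9 → (Metric.ball 0 10).indicator h z = h z := fun z hz =>
    indicator_of_mem (by simp; linarith) _
  refine ⟨N, a, (Metric.ball 0 10).indicator h, ha,
    measurable_indicator_of_continuousOn Metric.isOpen_ball.measurableSet h2.continuousOn,
    h2.congr fun z hz => indicator_of_mem hz _, fun z hz => by rw [e z hz]; exact h3 z hz,
    fun z hz => by rw [e z (hz.trans (by norm_num))]; exact h4 z hz,
    fun z hz => by rw [e z hz]; exact h6 z hz⟩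

lemma lintegral_ball_zeroFree {h : ℂ → ℂ} (hm : Measurable h)
    (hd : DifferentiableOn ℂ h (Metric.ball 0 10))
    (h1 : ∀ z, ‖z‖ ≤ 9 → ‖h z‖ ≤ 1) (h0 : ∀ z, ‖z‖ ≤ 6 → h z ≠ 0) {x : ℂ} {r : ℝ}
    (hxr : ‖x‖ + r ≤ 6) :
    ∫⁻ z in Metric.ball x r, logWeight (h z) =
      volume (Metric.ball (0:ℂ) r) * logWeight (h x) := by
  have hpi : ENNReal.ofReal (2 * Real.pi) ≠ 0 := by simpa using Real.pi_pos
  rw [← ENNReal.mul_right_inj hpi ENNReal.ofReal_ne_top, lintegral_ball_translate,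
    lintegral_ball_rotation measurePreserving_unit_smul r
    (u := fun z => logWeight (h (x + z)))
    (measurable_logWeight.comp (hm.comp (measurable_const_add x)))]
  rw [setLIntegral_congr_fun (g := fun _ => ENNReal.ofReal (2 * Real.pi) * logWeight (h x))
    Metric.isOpen_ball.measurableSet, setLIntegral_const]
  · ring
  · intro z hz
    rw [mem_ball_zero_iff] at hz
    exact lintegral_circle_zeroFree hd h1 h0 (by linarith)

lemma logWeight_harnack {h : ℂ → ℂ} (hm : Measurable h)
    (hd : DifferentiableOn ℂ h (Metric.ball 0 10))
    (h1 : ∀ z, ‖z‖ ≤ 9 → ‖h z‖ ≤ 1) (h0 : ∀ z, ‖z‖ ≤ 6 → h z ≠ 0) {b z : ℂ}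
    (hb : ‖b‖ ≤ 1) (hz : ‖z‖ ≤ 3) : logWeight (h z) ≤ 25 * logWeight (h b) := by
  have h2 := lintegral_ball_zeroFree hm hd h1 h0 (x := z) (r := 1) (by linarith)
  have h3 := lintegral_ball_zeroFree hm hd h1 h0 (x := b) (r := 5) (by linarith)
  have h4 : Metric.ball z 1 ⊆ Metric.ball b 5 := by
    apply Metric.ball_subset_ball'
    rw [dist_eq_norm]
    linarith [norm_sub_le z b]
  have h5 := lintegral_mono_set (μ := volume) (f := fun z => logWeight (h z)) h4
  rw [h2, h3, Complex.volume_ball, Complex.volume_ball] at h5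
  have hpi : (NNReal.pi : ENNReal) ≠ 0 := by simp [NNReal.pi_ne_zero]
  rw [← ENNReal.mul_le_mul_iff_right hpi ENNReal.coe_ne_top]
  calc _ = ENNReal.ofReal 1 ^ 2 * NNReal.pi * logWeight (h z) := by simp
    _ ≤ _ := h5
    _ = _ := by norm_num; ring

lemma exists_lintegral_blaschke_le : ∃ D : NNReal, ∀ a : ℂ, ‖a‖ ≤ 6 → ∀ y : ℝ, |y| ≤ 1 →
    ∫⁻ x in Icc (-2:ℝ) 2, logWeight (blaschke a (x + y * Complex.I)) ≤ D := by
  set g : ℝ → ENNReal := (Icc (-8:ℝ) 8).indicator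
    fun u => ENNReal.ofReal (Real.log 11 - Real.log u) with hg
  have hfin : ∫⁻ u, g u ≠ ⊤ := by
    rw [hg, lintegral_indicator measurableSet_Icc]
    have : IntegrableOn (fun u => Real.log 11 - Real.log u) (Icc (-8:ℝ) 8) := by
      rw [integrableOn_Icc_iff_integrableOn_Ioc,
        ← intervalIntegrable_iff_integrableOn_Ioc_of_le (by norm_num)]
      exact intervalIntegrable_const.sub intervalIntegral.intervalIntegrable_log'
    exact (this.lintegral_lt_top).ne
  refine ⟨(∫⁻ u, g u).toNNReal, fun a ha y hy => ?_⟩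
  rw [ENNReal.coe_toNNReal hfin, ← lintegral_sub_right_eq_self g a.re,
    ← lintegral_indicator measurableSet_Icc]
  have hc : ({a.re} : Set ℝ).Countable := countable_singleton _
  refine lintegral_mono_ae ?_
  filter_upwards [measure_eq_zero_iff_ae_notMem.1 (hc.measure_zero volume)] with x hx
  rw [mem_singleton_iff, ← sub_eq_zero] at hx
  by_cases hx2 : x ∈ Icc (-2:ℝ) 2
  swap
  · simp [hx2]
  rw [indicator_of_mem hx2, hg, indicator_of_mem]
  swap
  · have := abs_le.1 ((Complex.abs_re_le_norm a).trans ha)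
    constructor <;> linarith [hx2.1, hx2.2]
  apply logWeight_le_ofReal
  have hpos : 0 < |x - a.re| := abs_pos.2 hx
  rw [neg_sub, Real.exp_sub, Real.exp_log_eq_abs hx, Real.exp_log (by norm_num), blaschke,
    norm_div]
  have hxy : ‖(x + y * Complex.I : ℂ)‖ ≤ 3 := by
    refine (norm_add_le _ _).trans ?_
    have := abs_le.2 hx2
    simp only [Complex.norm_real, norm_mul, Complex.norm_I, mul_one, Real.norm_eq_abs]
    linarith
  have hden := blaschke_den_ne ha (hxy.trans (by norm_num))
  have h1 : ‖81 - (starRingEnd ℂ) a * (x + y * Complex.I)‖ ≤ 99 := by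
    refine (norm_sub_le _ _).trans ?_
    rw [norm_mul, RCLike.norm_conj]
    have : ‖(81:ℂ)‖ = 81 := by norm_num
    nlinarith [norm_nonneg a, norm_nonneg (x + y * Complex.I : ℂ)]
  have h2 : |x - a.re| ≤ ‖x + y * Complex.I - a‖ := by
    have := Complex.abs_re_le_norm (x + y * Complex.I - a)
    simpa using this
  rw [norm_mul, div_le_div_iff₀ (by norm_num) (norm_pos_iff.2 hden)]
  have : ‖(9:ℂ)‖ = 9 := by norm_num
  rw [this]
  nlinarith

lemma exists_lintegral_segment_le : ∃ C : NNReal, ∀ (φ : ℂ → ℂ) (b : ℂ), ‖b‖ ≤ 1 →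
    DifferentiableOn ℂ φ (Metric.ball 0 10) → (∀ z, ‖z‖ ≤ 9 → ‖φ z‖ ≤ 1) →
    ∀ y : ℝ, |y| ≤ 1 →
    ∫⁻ x in Icc (-2:ℝ) 2, logWeight (φ (x + y * Complex.I)) ≤ C * logWeight (φ b) := by
  obtain ⟨D, hD⟩ := exists_lintegral_blaschke_le
  have hl : 0 < Real.log (4 / 3) := Real.log_pos (by norm_num)
  set c : NNReal := ⟨Real.log (4 / 3), hl.le⟩ with hcdef
  have hc : ENNReal.ofReal (Real.log (4 / 3)) = c := by
    rw [ENNReal.ofReal, hcdef]; congr; exact Real.toNNReal_of_nonneg hl.le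
  have hc0 : c ≠ 0 := fun h => hl.ne' (congrArg NNReal.toReal h)
  refine ⟨100 + D / c, fun φ b hb hd h1 y hy => ?_⟩
  by_cases hb0 : φ b = 0
  · rw [hb0, logWeight_zero, ENNReal.mul_top]
    · exact le_top
    · simp
  obtain ⟨N, a, h, ha, hm, h2, h3, h4, h5⟩ := exists_measurable_decomposition hb hd h1 hb0
  have hxy : ∀ x ∈ Icc (-2:ℝ) 2, ‖(x + y * Complex.I : ℂ)‖ ≤ 3 := by
    intro x hx
    refine (norm_add_le _ _).trans ?_
    have := abs_le.2 hx
    simp only [Complex.norm_real, norm_mul, Complex.norm_I, mul_one, Real.norm_eq_abs]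
    linarith
  have hmi : ∀ i, Measurable fun x : ℝ => logWeight (blaschke (a i) (x + y * Complex.I)) := by
    intro i
    have : Measurable (fun x : ℝ => (x + y * Complex.I : ℂ)) := by fun_prop
    exact measurable_logWeight.comp ((measurable_blaschke _).comp this)
  rw [setLIntegral_congr_fun measurableSet_Icc fun x hx => h5 _ ((hxy x hx).trans (by norm_num)),
    lintegral_add_right _ (Finset.measurable_sum _ fun i _ => hmi i),
    lintegral_finsetSum _ fun i _ => hmi i, h5 b (hb.trans (by norm_num)), mul_add]
  apply add_le_add
  · calc ∫⁻ x in Icc (-2:ℝ) 2, logWeight (h (x + y * Complex.I))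
        ≤ ∫⁻ x in Icc (-2:ℝ) 2, 25 * logWeight (h b) :=
          setLIntegral_mono' measurableSet_Icc fun x hx =>
            logWeight_harnack hm h2 h3 h4 hb (hxy x hx)
      _ = 100 * logWeight (h b) := by
          rw [setLIntegral_const, Real.volume_Icc]; norm_num; ring
      _ ≤ _ := by gcongr; simp
  · rw [Finset.mul_sum]
    refine Finset.sum_le_sum fun i _ => (hD _ (ha i) y hy).trans ?_
    have hw := ofReal_le_logWeight (z := blaschke (a i) b) (c := Real.log (4 / 3)) (by
      rw [Real.exp_neg, Real.exp_log (by norm_num)]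
      exact (norm_blaschke_le (ha i) hb).trans (by norm_num))
    rw [hc] at hw
    calc (D : ENNReal) = ((D / c : NNReal) : ENNReal) * c := by
          rw [← ENNReal.coe_mul, div_mul_cancel₀ _ hc0]
      _ ≤ _ := by gcongr; simp

lemma four_mul_lintegral_ball_le {φ h : ℂ → ℂ} (hφm : Measurable φ) {N : ℕ} {a : Fin N → ℂ}
    (ha : ∀ i, ‖a i‖ ≤ 6)
    (hd : DifferentiableOn ℂ h (Metric.ball 0 10))
    (h1 : ∀ z, ‖z‖ ≤ 9 → ‖h z‖ ≤ 1) (h0 : ∀ z, ‖z‖ ≤ 6 → h z ≠ 0)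
    (hφ : ∀ z, ‖z‖ ≤ 9 → logWeight (φ z) = logWeight (h z) + ∑ i, logWeight (blaschke (a i) z))
    {x : ℂ} {s : ℝ} (hxs : ‖x‖ + 2 * s ≤ 6) :
    4 * ∫⁻ z in Metric.ball x s, logWeight (φ z) ≤
      (∫⁻ z in Metric.ball x (2 * s), logWeight (φ z)) +
        ∑ i, (if ‖a i - x‖ < 2 * s then
          4 * ENNReal.ofReal (Real.log 2) * volume (Metric.ball (0:ℂ) s) else 0) := by
  have hpi : ENNReal.ofReal (2 * Real.pi) ≠ 0 := by simpa using Real.pi_pos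
  have hmu : Measurable fun z => logWeight (φ z) := measurable_logWeight.comp hφm
  rw [← ENNReal.mul_le_mul_iff_right hpi ENNReal.ofReal_ne_top, lintegral_ball_translate,
    lintegral_ball_two_mul _ _ _ hmu, Complex.finrank_real_complex, mul_left_comm,
    lintegral_ball_rotation measurePreserving_unit_smul s
      (u := fun z => logWeight (φ (x + z)))
      (hmu.comp (by fun_prop : Measurable fun z => x + z)), mul_add, mul_left_comm,
    lintegral_ball_rotation measurePreserving_unit_smul s
      (u := fun z => logWeight (φ (x + (2:ℝ) • z)))
      (hmu.comp (by fun_prop : Measurable fun z => x + (2:ℝ) • z))]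
  have key : ∀ z ∈ Metric.ball (0:ℂ) s,
      ∫⁻ t in Ioc 0 (2 * Real.pi), logWeight (φ (x + circleMap 0 1 t • z)) ≤
      (∫⁻ t in Ioc 0 (2 * Real.pi), logWeight (φ (x + (2:ℝ) • circleMap 0 1 t • z))) +
      ∑ i, (if ‖a i - x‖ < 2 * s then ENNReal.ofReal (2 * Real.pi * Real.log 2) else 0) := by
    intro z hz
    rw [mem_ball_zero_iff] at hz
    refine (lintegral_circle_le ha hd h1 h0 hφ (by linarith) hz.le).trans (le_of_eq ?_)
    congr 2
    ext t
    congr 3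
    simp only [Complex.real_smul, smul_eq_mul]
    push_cast
    ring
  refine (mul_le_mul_right (setLIntegral_mono' Metric.isOpen_ball.measurableSet key) 4).trans ?_
  rw [lintegral_add_right _ measurable_const, setLIntegral_const, mul_add]
  refine add_le_add (by norm_num) (le_of_eq ?_)
  rw [Finset.sum_mul, Finset.mul_sum, Finset.mul_sum]
  refine Finset.sum_congr rfl fun i _ => ?_
  split_ifs
  · rw [ENNReal.ofReal_mul (by positivity)]; ring
  · simp

/-- The defect of the submean value property of `-log ‖φ‖` between two concentric discs. -/
def discDefect (φ : ℂ → ℂ) (s : ℝ) (x : ℂ) : ENNReal :=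
  4 * (∫⁻ z in Metric.ball x s, logWeight (φ z)) -
    ∫⁻ z in Metric.ball x (2 * s), logWeight (φ z)

/-- The constant bounding the total defect over separated discs. -/
def defectConst : ENNReal :=
  4 * ENNReal.ofReal (Real.log 2) / ENNReal.ofReal (Real.log (4 / 3))

lemma defectConst_ne_top : defectConst ≠ ⊤ := by
  have : 0 < Real.log (4 / 3) := Real.log_pos (by norm_num)
  exact ENNReal.div_ne_top (ENNReal.mul_ne_top (by simp) ENNReal.ofReal_ne_top) (by simpa)

lemma defectConst_ne_zero : defectConst ≠ 0 := by
  have : 0 < Real.log 2 := Real.log_pos (by norm_num)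
  exact ENNReal.div_ne_zero.2 ⟨mul_ne_zero (by simp) (by simpa), ENNReal.ofReal_ne_top⟩

lemma sum_discDefect_le {φ : ℂ → ℂ} {b : ℂ} (hφm : Measurable φ) (hb : ‖b‖ ≤ 1)
    (hd : DifferentiableOn ℂ φ (Metric.ball 0 10)) (h1 : ∀ z, ‖z‖ ≤ 9 → ‖φ z‖ ≤ 1)
    {ι : Type*} (E : Finset ι) (p : ι → ℂ) {s : ℝ} (hs0 : 0 < s) (hs : s ≤ 1 / 2)
    (hp : ∀ x ∈ E, ‖p x‖ ≤ 1)
    (hsep : ∀ x ∈ E, ∀ y ∈ E, x ≠ y → 4 * s ≤ ‖p x - p y‖) :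
    ∑ x ∈ E, discDefect φ s (p x) ≤
      defectConst * volume (Metric.ball (0:ℂ) s) * logWeight (φ b) := by
  classical
  by_cases hb0 : φ b = 0
  · rw [hb0, logWeight_zero, ENNReal.mul_top]
    · exact le_top
    · refine mul_ne_zero defectConst_ne_zero ?_
      exact (Metric.measure_ball_pos volume _ hs0).ne'
  obtain ⟨N, a, h, ha, h2, h3, h4, h5, h6⟩ := exists_logWeight_decomposition hb hd h1 hb0
  set K := 4 * ENNReal.ofReal (Real.log 2) * volume (Metric.ball (0:ℂ) s) with hK
  have hlog : ENNReal.ofReal (Real.log (4 / 3)) ≠ 0 := by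
    have : 0 < Real.log (4 / 3) := Real.log_pos (by norm_num)
    simpa
  calc ∑ x ∈ E, discDefect φ s (p x)
      ≤ ∑ x ∈ E, ∑ i, (if ‖a i - p x‖ < 2 * s then K else 0) := by
        refine Finset.sum_le_sum fun x hx => ?_
        rw [discDefect, tsub_le_iff_left]
        exact four_mul_lintegral_ball_le hφm ha h2 h3 h4 h6 (by linarith [hp x hx])
    _ = ∑ i, ∑ x ∈ E, (if ‖a i - p x‖ < 2 * s then K else 0) := Finset.sum_comm
    _ ≤ ∑ i : Fin N, K := by
        refine Finset.sum_le_sum fun i _ => ?_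
        rw [← Finset.sum_filter, Finset.sum_const]
        have : (E.filter fun x => ‖a i - p x‖ < 2 * s).card ≤ 1 := by
          rw [Finset.card_le_one]
          intro x hx y hy
          rw [Finset.mem_filter] at hx hy
          by_contra hne
          have e1 := hsep x hx.1 y hy.1 hne
          have e2 : ‖p x - p y‖ ≤ ‖a i - p x‖ + ‖a i - p y‖ := by
            rw [← norm_neg (a i - p x)]
            refine le_trans (le_of_eq ?_) (norm_add_le _ _)
            congr 1; ring
          linarith [hx.2, hy.2]
        calc _ ≤ 1 • K := nsmul_le_nsmul_left zero_le this
          _ = K := one_smul _ _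
    _ = (defectConst * volume (Metric.ball (0:ℂ) s)) *
          (N * ENNReal.ofReal (Real.log (4 / 3))) := by
        rw [defectConst, hK, div_eq_mul_inv]
        simp only [Finset.sum_const, Finset.card_univ, Fintype.card_fin, nsmul_eq_mul]
        calc _ = (4 * ENNReal.ofReal (Real.log 2) * volume (Metric.ball (0:ℂ) s)) * N * 1 := by ring
          _ = _ := by
            rw [← ENNReal.inv_mul_cancel hlog ENNReal.ofReal_ne_top]; ring
    _ ≤ _ := by
        gcongr
        rw [h6 b (hb.trans (by norm_num))]
        exact (card_le_logWeight ha hb).trans le_add_self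

lemma lintegral_ball_gain {n : ℕ} {f : (Fin n → ℂ) → ℂ} (hfm : Measurable f)
    (hd : DifferentiableOn ℂ f (Metric.ball 0 10)) (h1 : ∀ z, ‖z‖ < 10 → ‖f z‖ ≤ 1)
    {x : Fin n → ℂ} {s : ℝ} (hx : ‖x‖ ≤ 1) (hs : s ≤ 1 / 2) (hfx : f x = 0) :
    (∫⁻ z in Metric.ball x (2 * s), logWeight (f z)) +
      4 ^ n * (ENNReal.ofReal (Real.log 2) * volume (Metric.ball (0 : Fin n → ℂ) s)) ≤
    4 ^ n * ∫⁻ z in Metric.ball x s, logWeight (f z) := by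
  have hpi : ENNReal.ofReal (2 * Real.pi) ≠ 0 := by simpa using Real.pi_pos
  have hmu : Measurable fun z => logWeight (f z) := measurable_logWeight.comp hfm
  have hfr : Module.finrank ℝ (Fin n → ℂ) = 2 * n := by
    rw [Module.finrank_pi_fintype]; simp [mul_comm]
  have h4 : (2:ENNReal) ^ (2 * n) = 4 ^ n := by rw [pow_mul]; norm_num
  rw [← ENNReal.mul_le_mul_iff_right hpi ENNReal.ofReal_ne_top, lintegral_ball_translate _ x s,
    lintegral_ball_two_mul _ _ _ hmu, hfr, h4, mul_add, mul_left_comm,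
    lintegral_ball_rotation (measurePreserving_unit_smul_pi n) s
      (u := fun z => logWeight (f (x + (2:ℝ) • z)))
      (hmu.comp (by fun_prop : Measurable fun z => x + (2:ℝ) • z)), mul_left_comm,
      mul_left_comm _ (4 ^ n),
    lintegral_ball_rotation (measurePreserving_unit_smul_pi n) s
      (u := fun z => logWeight (f (x + z)))
      (hmu.comp (by fun_prop : Measurable fun z => x + z)), ← mul_add]
  refine mul_le_mul_right ?_ _
  rw [← mul_assoc, ← ENNReal.ofReal_mul (by positivity), ← setLIntegral_const,
    ← lintegral_add_right _ measurable_const]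
  refine setLIntegral_mono' Metric.isOpen_ball.measurableSet fun z hz => ?_
  rw [mem_ball_zero_iff] at hz
  have hlt : ∀ w : ℂ, ‖w‖ < 10 → ‖x + w • z‖ < 10 := by
    intro w hw
    refine (norm_add_le _ _).trans_lt ?_
    rw [norm_smul]
    nlinarith [norm_nonneg z, norm_nonneg w]
  have := lintegral_circle_gain (φ := fun w => f (x + w • z)) ?_
    (fun w hw => h1 _ (hlt w (hw.trans_lt (by norm_num)))) (by simpa using hfx)
  · refine le_trans (le_of_eq ?_) this
    congr 2
    ext t
    congr 3
    ext i
    simp only [Pi.smul_apply, Complex.real_smul, smul_eq_mul]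
    push_cast
    ring
  · refine hd.comp (by fun_prop) fun w hw => ?_
    rw [mem_ball_zero_iff] at hw ⊢
    exact hlt w hw

lemma setLIntegral_pi_insertNth {m : ℕ} (j : Fin (m + 1)) (A : Fin (m + 1) → Set ℂ)
    (hA : ∀ i, MeasurableSet (A i)) {W : (Fin (m + 1) → ℂ) → ENNReal} (hW : Measurable W) :
    ∫⁻ z in Set.pi univ A, W z = ∫⁻ w in Set.pi univ (fun i => A (j.succAbove i)),
      ∫⁻ ζ in A j, W (j.insertNth ζ w) := by
  have hmp := (volume_preserving_piFinSuccAbove (fun _ : Fin (m + 1) => ℂ) j).symm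
  have hpre : (MeasurableEquiv.piFinSuccAbove (fun _ : Fin (m + 1) => ℂ) j).symm ⁻¹'
      (Set.pi univ A) = A j ×ˢ Set.pi univ (fun i => A (j.succAbove i)) := by
    ext ⟨ζ, w⟩
    simp only [mem_preimage, Set.mem_pi, mem_univ, forall_const, mem_prod,
      MeasurableEquiv.piFinSuccAbove_symm_apply, Fin.forall_iff_succAbove j,
      Fin.insertNthEquiv, Equiv.coe_fn_mk, Fin.insertNth_apply_same,
      Fin.insertNth_apply_succAbove]
  rw [← hmp.setLIntegral_comp_preimage (MeasurableSet.univ_pi hA) hW, hpre, Measure.volume_eq_prod,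
    setLIntegral_prod_symm]
  · rfl
  · exact (hW.comp (MeasurableEquiv.measurable _)).aemeasurable

lemma measurable_insertNth {m : ℕ} (j : Fin (m + 1)) :
    Measurable fun p : (Fin m → ℂ) × ℂ => (j.insertNth p.2 p.1 : Fin (m + 1) → ℂ) := by
  rw [measurable_pi_iff, Fin.forall_iff_succAbove j]
  simp only [Fin.insertNth_apply_same, Fin.insertNth_apply_succAbove]
  exact ⟨measurable_snd, fun i => (measurable_pi_apply i).comp measurable_fst⟩

lemma norm_insertNth_lt {m : ℕ} (j : Fin (m + 1)) {ζ : ℂ} {w : Fin m → ℂ} {r : ℝ}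
    (hζ : ‖ζ‖ < r) (hw : ‖w‖ < r) : ‖(j.insertNth ζ w : Fin (m + 1) → ℂ)‖ < r := by
  have hr : 0 < r := (norm_nonneg _).trans_lt hζ
  rw [pi_norm_lt_iff hr, Fin.forall_iff_succAbove j]
  simp only [Fin.insertNth_apply_same, Fin.insertNth_apply_succAbove]
  exact ⟨hζ, (pi_norm_lt_iff hr).1 hw⟩

lemma differentiable_insertNth {m : ℕ} (j : Fin (m + 1)) :
    Differentiable ℂ fun p : (Fin m → ℂ) × ℂ => (j.insertNth p.2 p.1 : Fin (m + 1) → ℂ) := by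
  rw [differentiable_pi, Fin.forall_iff_succAbove j]
  simp only [Fin.insertNth_apply_same, Fin.insertNth_apply_succAbove]
  exact ⟨differentiable_snd, fun i => by fun_prop⟩

lemma differentiableOn_slice {m : ℕ} (j : Fin (m + 1)) {f : (Fin (m + 1) → ℂ) → ℂ} {r : ℝ}
    (hd : DifferentiableOn ℂ f (Metric.ball 0 r)) {w : Fin m → ℂ} (hw : ‖w‖ < r) :
    DifferentiableOn ℂ (fun ζ => f (j.insertNth ζ w)) (Metric.ball 0 r) := by
  refine hd.comp (f := fun ζ => (j.insertNth ζ w : Fin (m + 1) → ℂ)) ?_ fun ζ hζ => ?_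
  · have h : Differentiable ℂ fun ζ : ℂ => ((w, ζ) : (Fin m → ℂ) × ℂ) := by fun_prop
    exact ((differentiable_insertNth j).comp h).differentiableOn
  · rw [mem_ball_zero_iff] at hζ ⊢
    exact norm_insertNth_lt j hζ hw

lemma differentiableOn_slice' {m : ℕ} (j : Fin (m + 1)) {f : (Fin (m + 1) → ℂ) → ℂ} {r : ℝ}
    (hd : DifferentiableOn ℂ f (Metric.ball 0 r)) {ζ : ℂ} (hζ : ‖ζ‖ < r) :
    DifferentiableOn ℂ (fun w => f (j.insertNth ζ w)) (Metric.ball 0 r) := by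
  refine hd.comp (f := fun w => (j.insertNth ζ w : Fin (m + 1) → ℂ)) ?_ fun w hw => ?_
  · have h : Differentiable ℂ fun w : Fin m → ℂ => ((w, ζ) : (Fin m → ℂ) × ℂ) := by fun_prop
    exact ((differentiable_insertNth j).comp h).differentiableOn
  · rw [mem_ball_zero_iff] at hw ⊢
    exact norm_insertNth_lt j hζ hw

/-- A thin rectangular neighbourhood of the real interval `[-2, 2]`. -/
def realTube (s : ℝ) : Set ℂ := Icc (-2) 2 ×ℂ Icc (-(2 * s)) (2 * s)

lemma measurableSet_realTube (s : ℝ) : MeasurableSet (realTube s) :=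
  (Complex.measurable_re measurableSet_Icc).inter (Complex.measurable_im measurableSet_Icc)

lemma norm_lt_of_mem_realTube {s : ℝ} (hs : s ≤ 1 / 2) {z : ℂ} (hz : z ∈ realTube s) :
    ‖z‖ < 10 := by
  have h1 := abs_le.2 hz.1
  have h2 := abs_le.2 hz.2
  linarith [Complex.norm_le_abs_re_add_abs_im z]

lemma ball_subset_realTube {s x : ℝ} (hs : s ≤ 1 / 2) (hx : |x| ≤ 1) :
    Metric.ball (x : ℂ) (2 * s) ⊆ realTube s := by
  intro z hz
  rw [mem_ball_iff_norm] at hz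
  have h1 := (Complex.abs_re_le_norm _).trans hz.le
  have h2 := (Complex.abs_im_le_norm _).trans hz.le
  simp only [Complex.sub_re, Complex.ofReal_re, Complex.sub_im, Complex.ofReal_im,
    sub_zero] at h1 h2
  rw [abs_le] at h1 h2 hx
  refine ⟨⟨?_, ?_⟩, h2⟩ <;> linarith

lemma lintegral_realTube_le {C : NNReal} (hC : ∀ (φ : ℂ → ℂ) (b : ℂ), ‖b‖ ≤ 1 →
    DifferentiableOn ℂ φ (Metric.ball 0 10) → (∀ z, ‖z‖ ≤ 9 → ‖φ z‖ ≤ 1) →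
    ∀ y : ℝ, |y| ≤ 1 →
    ∫⁻ x in Icc (-2:ℝ) 2, logWeight (φ (x + y * Complex.I)) ≤ C * logWeight (φ b))
    {φ : ℂ → ℂ} {b : ℂ} (hm : Measurable φ) (hb : ‖b‖ ≤ 1)
    (hd : DifferentiableOn ℂ φ (Metric.ball 0 10)) (h1 : ∀ z, ‖z‖ ≤ 9 → ‖φ z‖ ≤ 1)
    {s : ℝ} (hs : s ≤ 1 / 2) :
    ∫⁻ z in realTube s, logWeight (φ z) ≤ C * ENNReal.ofReal (4 * s) * logWeight (φ b) := by
  have hmp := Complex.volume_preserving_equiv_real_prod.symm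
  have hpre : Complex.measurableEquivRealProd.symm ⁻¹' (realTube s) =
      Icc (-2:ℝ) 2 ×ˢ Icc (-(2 * s)) (2 * s) := by
    ext ⟨x, y⟩
    simp [realTube, Complex.mem_reProdIm]
    tauto
  have hmw : Measurable fun z => logWeight (φ z) := measurable_logWeight.comp hm
  rw [← hmp.setLIntegral_comp_preimage (measurableSet_realTube s) hmw, hpre,
    Measure.volume_eq_prod, setLIntegral_prod_symm]
  swap
  · exact (hmw.comp (MeasurableEquiv.measurable _)).aemeasurable
  calc _ ≤ ∫⁻ y in Icc (-(2 * s)) (2 * s), C * logWeight (φ b) := by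
        refine setLIntegral_mono' measurableSet_Icc fun y hy => ?_
        refine le_trans (le_of_eq ?_) (hC φ b hb hd h1 y ((abs_le.2 hy).trans (by linarith)))
        refine lintegral_congr fun x => ?_
        congr 2
        apply Complex.ext <;> simp
    _ = _ := by
        rw [setLIntegral_const, Real.volume_Icc]
        have : 2 * s - -(2 * s) = 4 * s := by ring
        rw [this]; ring

lemma lintegral_tube_le {C : NNReal} (hC : ∀ (φ : ℂ → ℂ) (b : ℂ), ‖b‖ ≤ 1 →
    DifferentiableOn ℂ φ (Metric.ball 0 10) → (∀ z, ‖z‖ ≤ 9 → ‖φ z‖ ≤ 1) →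
    ∀ y : ℝ, |y| ≤ 1 →
    ∫⁻ x in Icc (-2:ℝ) 2, logWeight (φ (x + y * Complex.I)) ≤ C * logWeight (φ b))
    {s : ℝ} (hs : s ≤ 1 / 2) (m : ℕ) {f : (Fin m → ℂ) → ℂ} {b : Fin m → ℂ} (hm : Measurable f)
    (hb : ∀ i, ‖b i‖ ≤ 1)
    (hd : DifferentiableOn ℂ f (Metric.ball 0 10)) (h1 : ∀ z, ‖z‖ < 10 → ‖f z‖ ≤ 1) :
    ∫⁻ w in Set.pi univ (fun _ => realTube s), logWeight (f w) ≤
      (C * ENNReal.ofReal (4 * s)) ^ m * logWeight (f b) := by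
  induction m with
  | zero =>
    have : ∀ w, f w = f b := fun w => congrArg f (Subsingleton.elim _ _)
    simp only [this, setLIntegral_const]
    rw [volume_pi_pi]
    simp
  | succ m ih =>
    have hmw : Measurable fun z => logWeight (f z) := measurable_logWeight.comp hm
    have hlt : ∀ w ∈ Set.pi univ (fun _ : Fin m => realTube s), ‖w‖ < 10 := fun w hw =>
      (pi_norm_lt_iff (by norm_num)).2 fun i => norm_lt_of_mem_realTube hs (hw i (mem_univ i))
    rw [setLIntegral_pi_insertNth 0 _ (fun _ => measurableSet_realTube s) hmw]
    have hb0 : ‖b 0‖ < 10 := (hb 0).trans_lt (by norm_num)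
    calc _ ≤ ∫⁻ w in Set.pi univ (fun _ : Fin m => realTube s),
          C * ENNReal.ofReal (4 * s) * logWeight (f (Fin.insertNth 0 (b 0) w)) := by
          refine setLIntegral_mono' (MeasurableSet.univ_pi fun _ => measurableSet_realTube s)
            fun w hw => ?_
          refine lintegral_realTube_le hC (φ := fun ζ => f (Fin.insertNth 0 ζ w)) ?_ (hb 0)
            (differentiableOn_slice 0 hd (hlt w hw)) (fun z hz => h1 _ ?_) hs
          · exact hm.comp ((measurable_insertNth 0).comp measurable_prodMk_left)
          · exact norm_insertNth_lt 0 (hz.trans_lt (by norm_num)) (hlt w hw)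
      _ = C * ENNReal.ofReal (4 * s) * ∫⁻ w in Set.pi univ (fun _ : Fin m => realTube s),
          logWeight (f (Fin.insertNth 0 (b 0) w)) :=
          lintegral_const_mul _ (measurable_logWeight.comp (hm.comp
            ((measurable_insertNth 0).comp measurable_prodMk_right)))
      _ ≤ C * ENNReal.ofReal (4 * s) * ((C * ENNReal.ofReal (4 * s)) ^ m *
          logWeight (f (Fin.insertNth 0 (b 0) (fun i => b i.succ)))) := by
          gcongr
          exact ih (f := fun w => f (Fin.insertNth 0 (b 0) w))
            (hm.comp ((measurable_insertNth 0).comp measurable_prodMk_right))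
            (fun i => hb i.succ) (differentiableOn_slice' 0 hd hb0)
            (fun w hw => h1 _ (norm_insertNth_lt 0 hb0 hw))
      _ = _ := by
          have : (Fin.insertNth 0 (b 0) (fun i => b i.succ) : Fin (m + 1) → ℂ) = b := by
            ext i; refine Fin.cases ?_ (fun i => ?_) i <;> simp
          rw [this, pow_succ]; ring

lemma measurable_lintegral_slice {m : ℕ} (j : Fin (m + 1)) {W : (Fin (m + 1) → ℂ) → ENNReal}
    (hW : Measurable W) (A : Set ℂ) :
    Measurable fun w : Fin m → ℂ => ∫⁻ ζ in A, W (j.insertNth ζ w) :=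
  Measurable.lintegral_prod_right' (ν := volume.restrict A)
    (f := fun p : (Fin m → ℂ) × ℂ => W (j.insertNth p.2 p.1)) (hW.comp (measurable_insertNth j))

lemma measurable_discDefect_slice {m : ℕ} (j : Fin (m + 1)) {f : (Fin (m + 1) → ℂ) → ℂ}
    (hf : Measurable f) (s : ℝ) (x : ℂ) :
    Measurable fun w : Fin m → ℂ => discDefect (fun ζ => f (j.insertNth ζ w)) s x :=
  ((measurable_lintegral_slice j (measurable_logWeight.comp hf) _).const_mul 4).sub
    (measurable_lintegral_slice j (measurable_logWeight.comp hf) _)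

/-- The integral over the remaining coordinates of the defect in the `j`-th coordinate. -/
def sliceDefect {m : ℕ} (f : (Fin (m + 1) → ℂ) → ℂ) (s : ℝ) (x : Fin (m + 1) → ℂ)
    (j : Fin (m + 1)) : ENNReal :=
  ∫⁻ w in Set.pi univ (fun i => Metric.ball (x (j.succAbove i)) (2 * s)),
    discDefect (fun ζ => f (j.insertNth ζ w)) s (x j)

lemma four_mul_lintegral_pi_le {m : ℕ} {f : (Fin (m + 1) → ℂ) → ℂ} (hf : Measurable f)
    {s : ℝ} (x : Fin (m + 1) → ℂ) (j : Fin (m + 1)) {r r' : Fin (m + 1) → ℝ}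
    (hrj : r j = s) (hrj' : r' j = 2 * s) (hr : ∀ i, r (j.succAbove i) = r' (j.succAbove i))
    (hr2 : ∀ i, r i ≤ 2 * s) :
    4 * ∫⁻ z in Set.pi univ (fun i => Metric.ball (x i) (r i)), logWeight (f z) ≤
      (∫⁻ z in Set.pi univ (fun i => Metric.ball (x i) (r' i)), logWeight (f z)) +
        sliceDefect f s x j := by
  have hW : Measurable fun z => logWeight (f z) := measurable_logWeight.comp hf
  have hball : ∀ (r : Fin (m + 1) → ℝ) i, MeasurableSet (Metric.ball (x i) (r i)) :=
    fun _ _ => Metric.isOpen_ball.measurableSet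
  rw [setLIntegral_pi_insertNth j _ (hball r) hW, setLIntegral_pi_insertNth j _ (hball r') hW,
    ← lintegral_const_mul _ (measurable_lintegral_slice j hW _), hrj, hrj']
  simp only [hr]
  set T := Set.pi univ (fun i => Metric.ball (x (j.succAbove i)) (r' (j.succAbove i)))
  have hsub : T ⊆ Set.pi univ (fun i => Metric.ball (x (j.succAbove i)) (2 * s)) :=
    Set.pi_mono fun i _ => Metric.ball_subset_ball (by rw [← hr]; exact hr2 _)
  calc _ ≤ ∫⁻ w in T, ((∫⁻ ζ in Metric.ball (x j) (2 * s), logWeight (f (j.insertNth ζ w))) +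
        discDefect (fun ζ => f (j.insertNth ζ w)) s (x j)) :=
        lintegral_mono fun w => le_add_tsub
    _ = (∫⁻ w in T, ∫⁻ ζ in Metric.ball (x j) (2 * s), logWeight (f (j.insertNth ζ w))) +
        ∫⁻ w in T, discDefect (fun ζ => f (j.insertNth ζ w)) s (x j) :=
        lintegral_add_left (measurable_lintegral_slice j hW _) _
    _ ≤ _ := add_le_add le_rfl (lintegral_mono_set hsub)

lemma four_pow_mul_lintegral_pi_le {m : ℕ} {f : (Fin (m + 1) → ℂ) → ℂ} (hf : Measurable f)
    {s : ℝ} (hs : 0 ≤ s) (x : Fin (m + 1) → ℂ) (k : ℕ) (hk : k ≤ m + 1) :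
    4 ^ k * ∫⁻ z in Set.pi univ (fun i => Metric.ball (x i) s), logWeight (f z) ≤
      (∫⁻ z in Set.pi univ (fun i : Fin (m + 1) =>
        Metric.ball (x i) (if i.val < k then 2 * s else s)), logWeight (f z)) +
        4 ^ k * ∑ j with j.val < k, sliceDefect f s x j := by
  induction k with
  | zero => simp
  | succ k ih =>
    have hfil : (Finset.univ.filter fun j : Fin (m + 1) => j.val < k + 1) =
        insert ⟨k, hk⟩ (Finset.univ.filter fun j : Fin (m + 1) => j.val < k) := by
      ext j
      simp only [Finset.mem_filter, Finset.mem_univ, true_and, Finset.mem_insert, Fin.ext_iff]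
      omega
    have hne : ∀ i, ((⟨k, hk⟩ : Fin (m + 1)).succAbove i).val ≠ k := fun i h =>
      Fin.succAbove_ne _ i (Fin.ext h)
    have hstep := four_mul_lintegral_pi_le hf (s := s) x ⟨k, hk⟩
      (r := fun i => if i.val < k then 2 * s else s)
      (r' := fun i => if i.val < k + 1 then 2 * s else s) (by simp) (by simp)
      (fun i => by
        have := hne i
        by_cases h : ((⟨k, hk⟩ : Fin (m + 1)).succAbove i).val < k
        · simp only [h, h.trans (Nat.lt_succ_self k), if_true]
        · rw [if_neg h, if_neg (by omega)])
      (fun i => by split_ifs <;> linarith)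
    rw [hfil, Finset.sum_insert (by simp), mul_add]
    calc _ = 4 * (4 ^ k * ∫⁻ z in Set.pi univ (fun i => Metric.ball (x i) s), logWeight (f z)) := by
          rw [pow_succ]; ring
      _ ≤ 4 * _ := mul_le_mul_right (ih (by omega)) 4
      _ ≤ _ := by
          rw [mul_add, pow_succ, ← add_assoc]
          refine add_le_add (hstep.trans (add_le_add le_rfl ?_)) (le_of_eq (by ring))
          have h1 : (1 : ENNReal) ≤ 4 ^ k * 4 := by
            rw [← pow_succ]; exact one_le_pow₀ (by norm_num)
          simpa using mul_le_mul_left h1 (sliceDefect f s x ⟨k, hk⟩)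

lemma log_two_mul_le_sum_sliceDefect {m : ℕ} {f : (Fin (m + 1) → ℂ) → ℂ} (hf : Measurable f)
    (hd : DifferentiableOn ℂ f (Metric.ball 0 10)) (h1 : ∀ z, ‖z‖ < 10 → ‖f z‖ ≤ 1)
    {b : Fin (m + 1) → ℂ} (hb : ∀ i, ‖b i‖ ≤ 1) (hfb : f b ≠ 0)
    {s : ℝ} (hs0 : 0 < s) (hs : s ≤ 1 / 2) {x : Fin (m + 1) → ℝ} (hx : ∀ i, |x i| ≤ 1)
    (hfx : f (fun i => x i) = 0) :
    ENNReal.ofReal (Real.log 2) * volume (Metric.ball (0:ℂ) s) ^ (m + 1) ≤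
      ∑ j, sliceDefect f s (fun i => x i) j := by
  obtain ⟨C, hC⟩ := exists_lintegral_segment_le
  have hx' : ‖(fun i => (x i : ℂ))‖ ≤ 1 := by
    rw [pi_norm_le_iff_of_nonneg zero_le_one]
    intro i; simpa using hx i
  have hgain := lintegral_ball_gain hf hd h1 hx' hs hfx
  have hchain := four_pow_mul_lintegral_pi_le hf hs0.le (fun i => (x i : ℂ)) (m + 1) le_rfl
  simp only [Fin.is_lt, if_true, Finset.filter_true] at hchain
  rw [← ball_pi _ hs0, ← ball_pi _ (by positivity)] at hchain
  have hvol : volume (Metric.ball (0 : Fin (m + 1) → ℂ) s) =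
      volume (Metric.ball (0:ℂ) s) ^ (m + 1) := by
    rw [ball_pi _ hs0, volume_pi_pi]; simp
  have hfin : ∫⁻ z in Metric.ball (fun i => (x i : ℂ)) (2 * s), logWeight (f z) ≠ ⊤ := by
    refine ne_top_of_le_ne_top ?_ ((lintegral_mono_set ?_).trans
      (lintegral_tube_le hC hs (m + 1) hf hb hd h1))
    · refine ENNReal.mul_ne_top (ENNReal.pow_ne_top
        (ENNReal.mul_ne_top ENNReal.coe_ne_top ENNReal.ofReal_ne_top)) ?_
      rw [logWeight_of_ne hfb]; exact ENNReal.ofReal_ne_top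
    · rw [ball_pi _ (by positivity)]
      exact Set.pi_mono fun i _ => ball_subset_realTube hs (hx i)
  have h4 : (4 : ENNReal) ^ (m + 1) ≠ 0 := by simp
  have h4' : (4 : ENNReal) ^ (m + 1) ≠ ⊤ := ENNReal.pow_ne_top (by simp)
  rw [← hvol, ← ENNReal.mul_le_mul_iff_right h4 h4']
  exact (ENNReal.add_le_add_iff_left hfin).1 (hgain.trans hchain)

lemma sum_sliceDefect_le {C : NNReal} (hC : ∀ (φ : ℂ → ℂ) (b : ℂ), ‖b‖ ≤ 1 →
    DifferentiableOn ℂ φ (Metric.ball 0 10) → (∀ z, ‖z‖ ≤ 9 → ‖φ z‖ ≤ 1) →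
    ∀ y : ℝ, |y| ≤ 1 →
    ∫⁻ x in Icc (-2:ℝ) 2, logWeight (φ (x + y * Complex.I)) ≤ C * logWeight (φ b))
    {m : ℕ} {f : (Fin (m + 1) → ℂ) → ℂ} (hf : Measurable f)
    (hd : DifferentiableOn ℂ f (Metric.ball 0 10)) (h1 : ∀ z, ‖z‖ < 10 → ‖f z‖ ≤ 1)
    {b : Fin (m + 1) → ℂ} (hb : ∀ i, ‖b i‖ ≤ 1)
    {s : ℝ} (hs0 : 0 < s) (hs : s ≤ 1 / 2) (E : Finset (Fin (m + 1) → ℝ))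
    (hE : ∀ x ∈ E, ∀ i, |x i| ≤ 1)
    (hsep : ∀ x ∈ E, ∀ y ∈ E, x ≠ y → ∃ i, 4 * s ≤ |x i - y i|) (j : Fin (m + 1)) :
    ∑ x ∈ E, sliceDefect f s (fun i => x i) j ≤
      defectConst * volume (Metric.ball (0:ℂ) s) *
        ((C * ENNReal.ofReal (4 * s)) ^ m * logWeight (f b)) := by
  classical
  set B : (Fin (m + 1) → ℝ) → Set (Fin m → ℂ) := fun x =>
    Set.pi univ (fun i => Metric.ball ((x (j.succAbove i) : ℝ) : ℂ) (2 * s)) with hBdef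
  set T : Set (Fin m → ℂ) := Set.pi univ (fun _ => realTube s) with hTdef
  set D : (Fin (m + 1) → ℝ) → (Fin m → ℂ) → ENNReal := fun x w =>
    discDefect (fun ζ => f (j.insertNth ζ w)) s (x j) with hDdef
  have hBm : ∀ x, MeasurableSet (B x) := fun x =>
    MeasurableSet.univ_pi fun _ => Metric.isOpen_ball.measurableSet
  have hDm : ∀ x, Measurable (D x) := fun x => measurable_discDefect_slice j hf s (x j)
  have hTm : MeasurableSet T := MeasurableSet.univ_pi fun _ => measurableSet_realTube s
  have hlt : ∀ w ∈ T, ‖w‖ < 10 := fun w hw =>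
    (pi_norm_lt_iff (by norm_num)).2 fun i => norm_lt_of_mem_realTube hs (hw i (mem_univ i))
  have hbj : ‖b j‖ < 10 := (hb j).trans_lt (by norm_num)
  have hfs : Measurable fun w => f (j.insertNth (b j) w) :=
    hf.comp ((measurable_insertNth j).comp measurable_prodMk_right)
  have hpt : ∀ w ∈ T, ∑ x ∈ E, (B x).indicator (D x) w ≤
      defectConst * volume (Metric.ball (0:ℂ) s) * logWeight (f (j.insertNth (b j) w)) := by
    intro w hw
    have hsum : ∑ x ∈ E, (B x).indicator (D x) w = ∑ x ∈ E with w ∈ B x, D x w := by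
      rw [Finset.sum_filter]
      exact Finset.sum_congr rfl fun x _ => by simp [Set.indicator_apply]
    rw [hsum]
    refine sum_discDefect_le (φ := fun ζ => f (j.insertNth ζ w))
      (hf.comp ((measurable_insertNth j).comp measurable_prodMk_left)) (hb j)
      (differentiableOn_slice j hd (hlt w hw))
      (fun z hz => h1 _ (norm_insertNth_lt j (hz.trans_lt (by norm_num)) (hlt w hw)))
      (E.filter fun x => w ∈ B x) (fun x => ((x j : ℝ) : ℂ)) hs0 hs (fun x hx => ?_) ?_
    · simpa using hE x (Finset.mem_filter.1 hx).1 j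
    · intro x hx y hy hxy
      rw [Finset.mem_filter] at hx hy
      obtain ⟨i, hi⟩ := hsep x hx.1 y hy.1 hxy
      rcases Fin.eq_self_or_eq_succAbove j i with rfl | ⟨i, rfl⟩
      · rw [← Complex.ofReal_sub, Complex.norm_real]; exact hi
      · have hx2 := hx.2 i (mem_univ i)
        have hy2 := hy.2 i (mem_univ i)
        rw [Metric.mem_ball] at hx2 hy2
        have h3 := dist_triangle_left ((x (j.succAbove i) : ℝ) : ℂ)
          ((y (j.succAbove i) : ℝ) : ℂ) (w i)
        rw [dist_eq_norm ((x (j.succAbove i) : ℝ) : ℂ), ← Complex.ofReal_sub,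
          Complex.norm_real, Real.norm_eq_abs] at h3
        linarith
  calc ∑ x ∈ E, sliceDefect f s (fun i => x i) j
      ≤ ∑ x ∈ E, ∫⁻ w in T, (B x).indicator (D x) w := by
        refine Finset.sum_le_sum fun x hx => ?_
        rw [lintegral_indicator (hBm x), Measure.restrict_restrict (hBm x),
          inter_eq_self_of_subset_left
            (Set.pi_mono fun i _ => ball_subset_realTube hs (hE x hx _))]
        exact le_rfl
    _ = ∫⁻ w in T, ∑ x ∈ E, (B x).indicator (D x) w :=
        (lintegral_finsetSum _ fun x _ => (hDm x).indicator (hBm x)).symm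
    _ ≤ ∫⁻ w in T, defectConst * volume (Metric.ball (0:ℂ) s) *
          logWeight (f (j.insertNth (b j) w)) := setLIntegral_mono' hTm hpt
    _ = defectConst * volume (Metric.ball (0:ℂ) s) *
          ∫⁻ w in T, logWeight (f (j.insertNth (b j) w)) :=
        lintegral_const_mul _ (measurable_logWeight.comp hfs)
    _ ≤ _ := by
        gcongr
        have := lintegral_tube_le hC hs m (f := fun w => f (j.insertNth (b j) w))
          (b := fun i => b (j.succAbove i)) hfs (fun i => hb _) (differentiableOn_slice' j hd hbj)
          (fun w hw => h1 _ (norm_insertNth_lt j hbj hw))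
        have hself : (j.insertNth (b j) fun i => b (j.succAbove i) : Fin (m + 1) → ℂ) = b :=
          Fin.insertNth_self_removeNth j b
        rwa [hself] at this

lemma exists_card_zeros_le_of_measurable (m : ℕ) : ∃ K : ℝ, 0 < K ∧
    ∀ (f : (Fin (m + 1) → ℂ) → ℂ) (b : Fin (m + 1) → ℂ) (s : ℝ) (E : Finset (Fin (m + 1) → ℝ)),
    Measurable f → DifferentiableOn ℂ f (Metric.ball 0 10) → (∀ z, ‖z‖ < 10 → ‖f z‖ ≤ 1) →
    (∀ i, ‖b i‖ ≤ 1) → f b ≠ 0 → 0 < s → s ≤ 1 / 2 → (∀ x ∈ E, ∀ i, |x i| ≤ 1) →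
    (∀ x ∈ E, ∀ y ∈ E, x ≠ y → ∃ i, 4 * s ≤ |x i - y i|) →
    (∀ x ∈ E, f (fun i => x i) = 0) →
    (E.card : ℝ) * s ^ m ≤ K * -Real.log ‖f b‖ := by
  obtain ⟨C, hC⟩ := exists_lintegral_segment_le
  have hlog2 : 0 < Real.log 2 := Real.log_pos (by norm_num)
  set K0 : ℝ := (m + 1) * defectConst.toReal * (4 * C) ^ m / (Real.log 2 * Real.pi ^ m) with hK0
  have hK0n : 0 ≤ K0 := by positivity
  refine ⟨K0 + 1, by positivity, ?_⟩
  intro f b s E hf hd h1 hb hfb hs0 hs hE hsep hfE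
  have hL : 0 ≤ -Real.log ‖f b‖ := by
    have : ‖b‖ < 10 := (pi_norm_lt_iff (by norm_num)).2 fun i => (hb i).trans_lt (by norm_num)
    have := Real.log_nonpos (norm_nonneg _) (h1 b this)
    linarith
  suffices h : (E.card : ℝ) * s ^ m ≤ K0 * -Real.log ‖f b‖ by nlinarith
  have hsum : (E.card : ENNReal) * (ENNReal.ofReal (Real.log 2) *
      volume (Metric.ball (0:ℂ) s) ^ (m + 1)) ≤ (m + 1) * (defectConst *
      volume (Metric.ball (0:ℂ) s) * ((C * ENNReal.ofReal (4 * s)) ^ m * logWeight (f b))) := by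
    calc _ = ∑ x ∈ E, (ENNReal.ofReal (Real.log 2) *
          volume (Metric.ball (0:ℂ) s) ^ (m + 1)) := by simp
      _ ≤ ∑ x ∈ E, ∑ j, sliceDefect f s (fun i => x i) j := Finset.sum_le_sum fun x hx =>
          log_two_mul_le_sum_sliceDefect hf hd h1 hb hfb hs0 hs (hE x hx) (hfE x hx)
      _ = ∑ j, ∑ x ∈ E, sliceDefect f s (fun i => x i) j := Finset.sum_comm
      _ ≤ ∑ j : Fin (m + 1), _ := Finset.sum_le_sum fun j _ =>
          sum_sliceDefect_le hC hf hd h1 hb hs0 hs E hE hsep j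
      _ = _ := by simp
  have hv : volume (Metric.ball (0:ℂ) s) = ENNReal.ofReal (Real.pi * s ^ 2) := by
    rw [Complex.volume_ball, ENNReal.ofReal_mul Real.pi_pos.le, ENNReal.ofReal_pow hs0.le, mul_comm]
    congr 1
    rw [ENNReal.ofReal, Real.toNNReal_of_nonneg Real.pi_pos.le]; rfl
  rw [hv, logWeight_of_ne hfb, ← ENNReal.ofReal_toReal defectConst_ne_top,
    ← ENNReal.ofReal_coe_nnreal (p := C)] at hsum
  have hm1 : ((m : ENNReal) + 1) = ENNReal.ofReal (m + 1) := by
    rw [ENNReal.ofReal_add (by positivity) zero_le_one]; simp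
  rw [hm1, ← ENNReal.ofReal_natCast, ← ENNReal.ofReal_pow (by positivity),
    ← ENNReal.ofReal_mul hlog2.le, ← ENNReal.ofReal_mul (by positivity),
    ← ENNReal.ofReal_mul (by positivity), ← ENNReal.ofReal_mul (by positivity),
    ← ENNReal.ofReal_pow (by positivity), ← ENNReal.ofReal_mul (by positivity),
    ← ENNReal.ofReal_mul (by positivity), ← ENNReal.ofReal_mul (by positivity),
    ENNReal.ofReal_le_ofReal_iff (by positivity)] at hsum
  have hden : 0 < Real.log 2 * Real.pi ^ m := by positivity
  rw [hK0, div_mul_eq_mul_div, le_div_iff₀ hden]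
  have hfac : 0 < Real.pi * s ^ 2 * s ^ m := by positivity
  refine le_of_mul_le_mul_right ?_ hfac
  calc _ = (E.card : ℝ) * (Real.log 2 * (Real.pi * s ^ 2) ^ (m + 1)) := by
        ring
    _ ≤ _ := hsum
    _ = _ := by
        simp only [mul_pow]; ring

/-- A bounded holomorphic function on a polydisc has few zeros on a separated set of real points,
unless it is small everywhere. -/
lemma exists_card_zeros_le (m : ℕ) : ∃ K : ℝ, 0 < K ∧
    ∀ (f : (Fin (m + 1) → ℂ) → ℂ) (b : Fin (m + 1) → ℂ) (s : ℝ) (E : Finset (Fin (m + 1) → ℝ)),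
    DifferentiableOn ℂ f (Metric.ball 0 10) → (∀ z, ‖z‖ < 10 → ‖f z‖ ≤ 1) →
    (∀ i, ‖b i‖ ≤ 1) → f b ≠ 0 → 0 < s → s ≤ 1 / 2 → (∀ x ∈ E, ∀ i, |x i| ≤ 1) →
    (∀ x ∈ E, ∀ y ∈ E, x ≠ y → ∃ i, 4 * s ≤ |x i - y i|) →
    (∀ x ∈ E, f (fun i => x i) = 0) →
    (E.card : ℝ) * s ^ m ≤ K * -Real.log ‖f b‖ := by
  obtain ⟨K, hK, h⟩ := exists_card_zeros_le_of_measurable m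
  refine ⟨K, hK, fun f b s E hd h1 hb hfb hs0 hs hE hsep hfE => ?_⟩
  have heq : EqOn ((Metric.ball 0 10).indicator f) f (Metric.ball 0 10) :=
    fun z hz => indicator_of_mem hz f
  have hbb : b ∈ Metric.ball (0 : Fin (m + 1) → ℂ) 10 := mem_ball_zero_iff.2 <|
    (pi_norm_lt_iff (by norm_num)).2 fun i => (hb i).trans_lt (by norm_num)
  have hxb : ∀ x ∈ E, (fun i => (x i : ℂ)) ∈ Metric.ball (0 : Fin (m + 1) → ℂ) 10 :=
    fun x hx => mem_ball_zero_iff.2 <| (pi_norm_lt_iff (by norm_num)).2 fun i => by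
      simpa using (hE x hx i).trans_lt (by norm_num)
  have := h ((Metric.ball 0 10).indicator f) b s E
    (measurable_indicator_of_continuousOn Metric.isOpen_ball.measurableSet hd.continuousOn)
    (hd.congr heq) (fun z hz => by rw [heq (mem_ball_zero_iff.2 hz)]; exact h1 z hz) hb
    (by rwa [heq hbb]) hs0 hs hE hsep (fun x hx => by rw [heq (hxb x hx)]; exact hfE x hx)
  rwa [heq hbb] at this

/-- The function `exp (-β (s₁ + ⋯ + sₙ))` on the closed orthant, extended by zero. -/
def orthantExp {n : ℕ} (β : ℝ) (s : Fin n → ℝ) : ℝ :=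
  ∏ i, (Ici (0:ℝ)).indicator (fun u => Real.exp (-β * u)) (s i)

lemma orthantExp_nonneg {n : ℕ} (β : ℝ) (s : Fin n → ℝ) : 0 ≤ orthantExp β s :=
  Finset.prod_nonneg fun _ _ => indicator_nonneg (fun _ _ => (Real.exp_pos _).le) _

lemma orthantExp_eq {n : ℕ} (β : ℝ) {s : Fin n → ℝ} (hs : ∀ i, 0 ≤ s i) :
    orthantExp β s = Real.exp (-β * ∑ i, s i) := by
  rw [orthantExp, Finset.mul_sum, Real.exp_sum]
  exact Finset.prod_congr rfl fun i _ => indicator_of_mem (hs i) _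

lemma integrable_orthantExp {n : ℕ} {β : ℝ} (hβ : 0 < β) :
    Integrable (orthantExp (n := n) β) := by
  refine Integrable.fintype_prod (f := fun _ : Fin n => (Ici (0:ℝ)).indicator
    (fun u => Real.exp (-β * u))) fun i => ?_
  rw [integrable_indicator_iff measurableSet_Ici, integrableOn_Ici_iff_integrableOn_Ioi]
  exact integrableOn_exp_mul_Ioi (neg_lt_zero.2 hβ) 0

/-- The exponent `z₁ s₁ + ⋯ + zₙ sₙ` as a continuous linear form in `z`. -/
def pairing {n : ℕ} (s : Fin n → ℝ) : (Fin n → ℂ) →L[ℂ] ℂ :=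
  ∑ i, (s i : ℂ) • ContinuousLinearMap.proj i

lemma pairing_apply {n : ℕ} (s : Fin n → ℝ) (z : Fin n → ℂ) :
    pairing s z = ∑ i, z i * s i := by
  simp [pairing, mul_comm]

lemma pairing_re {n : ℕ} (s : Fin n → ℝ) (z : Fin n → ℂ) :
    (pairing s z).re = ∑ i, (z i).re * s i := by
  simp [pairing_apply]

lemma norm_pairing_le {n : ℕ} {s : Fin n → ℝ} (hs : ∀ i, 0 ≤ s i) :
    ‖pairing s‖ ≤ ∑ i, s i := by
  refine ContinuousLinearMap.opNorm_le_bound _ (Finset.sum_nonneg fun i _ => hs i) fun z => ?_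
  rw [pairing_apply, Finset.sum_mul]
  refine (norm_sum_le _ _).trans (Finset.sum_le_sum fun i _ => ?_)
  rw [norm_mul, Complex.norm_real, Real.norm_of_nonneg (hs i), mul_comm]
  exact mul_le_mul_of_nonneg_left (norm_le_pi_norm z i) (hs i)

lemma measurable_pairing {n : ℕ} (z : Fin n → ℂ) :
    Measurable fun s : Fin n → ℝ => pairing s z := by
  simp only [pairing_apply]
  fun_prop

lemma continuous_pairing {n : ℕ} : Continuous (pairing (n := n)) := by
  unfold pairing
  fun_prop

/-- The Laplace integral of a function on `ℝⁿ`. -/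
def laplaceInt {n : ℕ} (G : (Fin n → ℝ) → ℂ) (z : Fin n → ℂ) : ℂ :=
  ∫ s, Complex.exp (-pairing s z) * G s

/-- Bounded measurable functions supported in the closed orthant. -/
structure OrthantBounded {n : ℕ} (G : (Fin n → ℝ) → ℂ) (M : ℝ) : Prop where
  meas : Measurable G
  bound : ∀ s, ‖G s‖ ≤ M
  nonneg : ∀ s, G s ≠ 0 → ∀ i, 0 ≤ s i

namespace OrthantBounded

variable {n : ℕ} {G : (Fin n → ℝ) → ℂ} {M : ℝ}

lemma M_nonneg (hG : OrthantBounded G M) : 0 ≤ M := (norm_nonneg _).trans (hG.bound 0)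

lemma norm_integrand_le (hG : OrthantBounded G M) {β : ℝ} {z : Fin n → ℂ}
    (hz : ∀ i, β ≤ (z i).re) (s : Fin n → ℝ) :
    ‖Complex.exp (-pairing s z) * G s‖ ≤ M * orthantExp β s := by
  by_cases h : G s = 0
  · simpa [h] using mul_nonneg hG.M_nonneg (orthantExp_nonneg β s)
  · have hs := hG.nonneg s h
    rw [norm_mul, Complex.norm_exp, orthantExp_eq β hs, mul_comm, Complex.neg_re, pairing_re]
    refine mul_le_mul (hG.bound s) (Real.exp_le_exp.2 ?_) (Real.exp_pos _).le hG.M_nonneg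
    rw [neg_mul, neg_le_neg_iff, Finset.mul_sum]
    exact Finset.sum_le_sum fun i _ => mul_le_mul_of_nonneg_right (hz i) (hs i)

lemma measurable_integrand (hG : OrthantBounded G M) (z : Fin n → ℂ) :
    Measurable fun s => Complex.exp (-pairing s z) * G s :=
  (Complex.measurable_exp.comp (measurable_pairing z).neg).mul hG.meas

lemma exists_lt_re {z : Fin n → ℂ} (hz : ∀ i, 0 < (z i).re) :
    ∃ β, 0 < β ∧ ∀ i, β ≤ (z i).re := by
  have h1 : ∀ᶠ β in nhdsWithin (0:ℝ) (Ioi 0), ∀ i, β ≤ (z i).re :=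
    eventually_all.2 fun i => mem_of_superset (Ioo_mem_nhdsGT (hz i)) fun _ hβ => hβ.2.le
  obtain ⟨β, h2, h3⟩ := (h1.and self_mem_nhdsWithin).exists
  exact ⟨β, h3, h2⟩

lemma integrable_integrand (hG : OrthantBounded G M) {z : Fin n → ℂ} (hz : ∀ i, 0 < (z i).re) :
    Integrable fun s => Complex.exp (-pairing s z) * G s := by
  obtain ⟨β, hβ, hzβ⟩ := exists_lt_re hz
  exact ((integrable_orthantExp hβ).const_mul M).mono'
    (hG.measurable_integrand z).aestronglyMeasurable (ae_of_all _ (hG.norm_integrand_le hzβ))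

lemma differentiableAt_laplaceInt (hG : OrthantBounded G M) {z : Fin n → ℂ}
    (hz : ∀ i, 0 < (z i).re) : DifferentiableAt ℂ (laplaceInt G) z := by
  obtain ⟨β, hβ, hzβ⟩ := exists_lt_re hz
  have hball : ∀ w ∈ Metric.ball z (β / 2), ∀ i, β / 2 ≤ (w i).re := by
    intro w hw i
    rw [mem_ball_iff_norm] at hw
    have h1 := (Complex.abs_re_le_norm _).trans ((norm_le_pi_norm (w - z) i).trans hw.le)
    rw [Pi.sub_apply, Complex.sub_re, abs_le] at h1
    linarith [hzβ i]
  let F' : (Fin n → ℂ) → (Fin n → ℝ) → ((Fin n → ℂ) →L[ℂ] ℂ) :=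
    fun w s => (-(Complex.exp (-pairing s w) * G s)) • pairing s
  refine (hasFDerivAt_integral_of_dominated_of_fderiv_le (𝕜 := ℂ)
    (F := fun w s => Complex.exp (-pairing s w) * G s)
    (F' := F')
    (bound := fun s => M * (4 / β * orthantExp (β / 4) s))
    (Metric.ball_mem_nhds z (half_pos hβ)) ?_ (hG.integrable_integrand hz)
    ?_ ?_ ?_ ?_).differentiableAt
  · exact Eventually.of_forall fun w => (hG.measurable_integrand w).aestronglyMeasurable
  · exact (hG.measurable_integrand z).neg.aestronglyMeasurable.smul
      continuous_pairing.aestronglyMeasurable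
  · refine ae_of_all _ fun s w hw => ?_
    by_cases h : G s = 0
    · simp only [F', h, mul_zero, neg_zero, norm_smul, norm_zero, zero_mul]
      exact mul_nonneg hG.M_nonneg (mul_nonneg (div_pos four_pos hβ).le (orthantExp_nonneg _ s))
    · have hs := hG.nonneg s h
      have hS : 0 ≤ ∑ i, s i := Finset.sum_nonneg fun i _ => hs i
      simp only [F', norm_smul, norm_neg]
      refine (mul_le_mul (hG.norm_integrand_le (hball w hw) s) (norm_pairing_le hs)
        (norm_nonneg _) (mul_nonneg hG.M_nonneg (orthantExp_nonneg _ s))).trans ?_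
      rw [mul_assoc]
      refine mul_le_mul_of_nonneg_left ?_ hG.M_nonneg
      rw [orthantExp_eq _ hs, orthantExp_eq _ hs]
      have h2 : ∑ i, s i ≤ 4 / β * Real.exp (β / 4 * ∑ i, s i) := by
        have := Real.add_one_le_exp (β / 4 * ∑ i, s i)
        rw [div_mul_eq_mul_div, le_div_iff₀ hβ]
        linarith
      calc _ ≤ Real.exp (-(β / 2) * ∑ i, s i) * (4 / β * Real.exp (β / 4 * ∑ i, s i)) := by gcongr
        _ = 4 / β * (Real.exp (-(β / 2) * ∑ i, s i) * Real.exp (β / 4 * ∑ i, s i)) := by ring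
        _ = _ := by rw [← Real.exp_add]; ring_nf
  · exact ((integrable_orthantExp (by positivity)).const_mul _).const_mul _
  · refine ae_of_all _ fun s w _ => ?_
    have h1 : HasFDerivAt (fun w => -pairing s w) (-pairing s) w := (pairing s).hasFDerivAt.neg
    refine (h1.cexp.mul_const (G s)).congr_fderiv ?_
    ext v
    simp [F']
    ring

end OrthantBounded

/-- The closed essential support of `G`. -/
def essSupp {n : ℕ} (G : (Fin n → ℝ) → ℂ) : Set (Fin n → ℝ) :=
  (volume.restrict {s | G s ≠ 0}).support

/-- The (lower) support function of the essential support of `G`. -/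
def suppFun {n : ℕ} (G : (Fin n → ℝ) → ℂ) (x : Fin n → ℝ) : ℝ :=
  sInf ((fun s => ∑ i, x i * s i) '' essSupp G)

namespace OrthantBounded

variable {n : ℕ} {G : (Fin n → ℝ) → ℂ} {M : ℝ}

lemma measurableSet_ne_zero (hG : OrthantBounded G M) : MeasurableSet {s | G s ≠ 0} :=
  (hG.meas (measurableSet_singleton 0)).compl

lemma essSupp_subset (hG : OrthantBounded G M) : essSupp G ⊆ {s | ∀ i, 0 ≤ s i} := by
  refine Measure.support_subset_of_isClosed ?_ ?_
  · simp only [ofPred_forall]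
    exact isClosed_iInter fun i => isClosed_le continuous_const (continuous_apply i)
  · exact (ae_restrict_iff' hG.measurableSet_ne_zero).2 (ae_of_all _ hG.nonneg)

lemma ae_mem_essSupp (hG : OrthantBounded G M) : ∀ᵐ s, G s ≠ 0 → s ∈ essSupp G :=
  (ae_restrict_iff' hG.measurableSet_ne_zero).1 Measure.support_mem_ae

lemma essSupp_nonempty (hG : OrthantBounded G M) (hne : ¬ ∀ᵐ s, G s = 0) :
    (essSupp G).Nonempty := by
  by_contra h
  rw [not_nonempty_iff_eq_empty] at h
  refine hne (hG.ae_mem_essSupp.mono fun s hs => ?_)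
  by_contra h'
  simpa [h] using hs h'

lemma bddBelow_pairing (hG : OrthantBounded G M) {x : Fin n → ℝ} (hx : ∀ i, 0 ≤ x i) :
    BddBelow ((fun s => ∑ i, x i * s i) '' essSupp G) := by
  refine ⟨0, ?_⟩
  rintro _ ⟨s, hs, rfl⟩
  exact Finset.sum_nonneg fun i _ => mul_nonneg (hx i) (hG.essSupp_subset hs i)

lemma suppFun_le (hG : OrthantBounded G M) {x s : Fin n → ℝ} (hx : ∀ i, 0 ≤ x i)
    (hs : s ∈ essSupp G) : suppFun G x ≤ ∑ i, x i * s i :=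
  csInf_le (hG.bddBelow_pairing hx) ⟨s, hs, rfl⟩

lemma exists_lt_of_suppFun_lt (hG : OrthantBounded G M) (hne : ¬ ∀ᵐ s, G s = 0)
    {x : Fin n → ℝ} {b : ℝ} (hb : suppFun G x < b) : ∃ s ∈ essSupp G, ∑ i, x i * s i < b := by
  obtain ⟨_, ⟨s, hs, rfl⟩, h⟩ := exists_lt_of_csInf_lt ((hG.essSupp_nonempty hne).image _) hb
  exact ⟨s, hs, h⟩

lemma suppFun_nonneg (hG : OrthantBounded G M) {x : Fin n → ℝ} (hx : ∀ i, 0 ≤ x i) :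
    0 ≤ suppFun G x := by
  refine Real.sInf_nonneg ?_
  rintro _ ⟨s, hs, rfl⟩
  exact Finset.sum_nonneg fun i _ => mul_nonneg (hx i) (hG.essSupp_subset hs i)

lemma suppFun_smul (t : ℝ) (ht : 0 ≤ t) (x : Fin n → ℝ) :
    suppFun G (fun i => t * x i) = t * suppFun G x := by
  unfold suppFun
  rw [← smul_eq_mul t (sInf _), ← Real.sInf_smul_of_nonneg ht, ← image_smul, image_image]
  simp only [smul_eq_mul, Finset.mul_sum, mul_assoc]

lemma ae_suppFun_le (hG : OrthantBounded G M) {x : Fin n → ℝ} (hx : ∀ i, 0 ≤ x i) :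
    ∀ᵐ s, G s ≠ 0 → suppFun G x ≤ ∑ i, x i * s i :=
  hG.ae_mem_essSupp.mono fun _ hs h => hG.suppFun_le hx (hs h)

lemma not_ae_zero_of_suppFun_lt (hG : OrthantBounded G M) (hne : ¬ ∀ᵐ s, G s = 0)
    {x : Fin n → ℝ} {b : ℝ} (hb : suppFun G x < b) :
    ¬ ∀ᵐ s : Fin n → ℝ, ∑ i, x i * s i < b → G s = 0 := by
  intro h
  obtain ⟨s, hs, hsb⟩ := hG.exists_lt_of_suppFun_lt hne hb
  have hopen : IsOpen {s : Fin n → ℝ | ∑ i, x i * s i < b} :=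
    isOpen_lt (by fun_prop) continuous_const
  have hpos := (Measure.mem_support_iff_forall s).1 hs _ (hopen.mem_nhds hsb)
  rw [Measure.restrict_apply hopen.measurableSet] at hpos
  refine hpos.ne' ?_
  refine measure_mono_null (fun s hs => ?_) h
  simp only [mem_compl_iff, mem_ofPred_eq]
  exact fun h' => hs.2 (h' hs.1)

lemma exists_suppFun_bound (hG : OrthantBounded G M) (hne : ¬ ∀ᵐ s, G s = 0) :
    ∃ A : ℝ, 0 ≤ A ∧ ∀ (x : Fin n → ℝ) (B : ℝ), (∀ i, 0 ≤ x i) → (∀ i, x i ≤ B) →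
      suppFun G x ≤ B * A := by
  obtain ⟨s, hs⟩ := hG.essSupp_nonempty hne
  have hs0 := hG.essSupp_subset hs
  refine ⟨∑ i, s i, Finset.sum_nonneg fun i _ => hs0 i, fun x B hx hxB =>
    (hG.suppFun_le hx hs).trans ?_⟩
  rw [Finset.mul_sum]
  exact Finset.sum_le_sum fun i _ => mul_le_mul_of_nonneg_right (hxB i) (hs0 i)

lemma exists_lipschitzOnWith_suppFun (hG : OrthantBounded G M) (hne : ¬ ∀ᵐ s, G s = 0)
    {β B : ℝ} (hβ : 0 < β) : ∃ K : NNReal, LipschitzOnWith K (suppFun G)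
      {x | ∀ i, β ≤ x i ∧ x i ≤ B} := by
  obtain ⟨A, hA, hAb⟩ := hG.exists_suppFun_bound hne
  refine ⟨Real.toNNReal (B * A / β), LipschitzOnWith.of_le_add_mul _ fun x hx y hy => ?_⟩
  have hx0 : ∀ i, 0 ≤ x i := fun i => hβ.le.trans (hx i).1
  have hy0 : ∀ i, 0 ≤ y i := fun i => hβ.le.trans (hy i).1
  have hBA : 0 ≤ B * A / β :=
    div_nonneg ((hG.suppFun_nonneg hy0).trans (hAb y B hy0 fun i => (hy i).2)) hβ.le
  rw [Real.coe_toNNReal _ hBA]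
  have key : ∀ ε > 0, suppFun G x ≤ (suppFun G y + ε) + (B * A + ε) / β * dist x y := by
    intro ε hε
    obtain ⟨s, hs, hsb⟩ := hG.exists_lt_of_suppFun_lt hne (lt_add_of_pos_right (suppFun G y) hε)
    have hs0 := hG.essSupp_subset hs
    have h1 : ∑ i, s i ≤ (B * A + ε) / β := by
      rw [le_div_iff₀ hβ, Finset.sum_mul]
      refine (Finset.sum_le_sum fun i _ => ?_).trans
        (hsb.le.trans (add_le_add (hAb y B hy0 fun i => (hy i).2) le_rfl))
      rw [mul_comm]
      exact mul_le_mul_of_nonneg_right (hy i).1 (hs0 i)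
    calc suppFun G x ≤ ∑ i, x i * s i := hG.suppFun_le hx0 hs
      _ = ∑ i, y i * s i + ∑ i, (x i - y i) * s i := by
          rw [← Finset.sum_add_distrib]; exact Finset.sum_congr rfl fun i _ => by ring
      _ ≤ (suppFun G y + ε) + (∑ i, s i) * dist x y := by
          refine add_le_add hsb.le ?_
          rw [Finset.sum_mul]
          refine Finset.sum_le_sum fun i _ => ?_
          rw [mul_comm]
          refine mul_le_mul_of_nonneg_left ((le_abs_self _).trans ?_) (hs0 i)
          exact (Real.dist_eq _ _ ▸ dist_le_pi_dist x y i)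
      _ ≤ _ := by gcongr
  have hlim : Tendsto (fun ε : ℝ => (suppFun G y + ε) + (B * A + ε) / β * dist x y)
      (nhdsWithin 0 (Ioi 0)) (nhds ((suppFun G y + 0) + (B * A + 0) / β * dist x y)) := by
    refine Tendsto.mono_left (Continuous.tendsto ?_ 0) nhdsWithin_le_nhds
    fun_prop
  have := ge_of_tendsto hlim (eventually_nhdsWithin_of_forall key)
  simpa using this

lemma ae_differentiableAt_suppFun (hG : OrthantBounded G M) (hne : ¬ ∀ᵐ s, G s = 0) :
    ∀ᵐ x : Fin n → ℝ, (∀ i, 0 < x i) → DifferentiableAt ℝ (suppFun G) x := by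
  have h1 : ∀ m : ℕ, ∀ᵐ x : Fin n → ℝ,
      x ∈ {x : Fin n → ℝ | ∀ i, 1 / ((m : ℝ) + 1) ≤ x i ∧ x i ≤ m} →
      DifferentiableWithinAt ℝ (suppFun G)
        {x : Fin n → ℝ | ∀ i, 1 / ((m : ℝ) + 1) ≤ x i ∧ x i ≤ m} x := by
    intro m
    obtain ⟨K, hK⟩ := hG.exists_lipschitzOnWith_suppFun hne (β := 1 / ((m : ℝ) + 1)) (B := m)
      (by positivity)
    exact hK.ae_differentiableWithinAt_of_mem
  filter_upwards [ae_all_iff.2 h1] with x hx hpos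
  have h2 : ∀ᶠ m : ℕ in atTop, ∀ i, 1 / ((m : ℝ) + 1) < x i ∧ x i < m := by
    refine eventually_all.2 fun i => ?_
    exact ((tendsto_one_div_add_atTop_nhds_zero_nat.eventually_lt_const (hpos i))).and
      (tendsto_natCast_atTop_atTop.eventually_gt_atTop (x i))
  obtain ⟨m, hm⟩ := h2.exists
  refine (hx m fun i => ⟨(hm i).1.le, (hm i).2.le⟩).differentiableAt ?_
  have : Set.pi univ (fun _ : Fin n => Icc (1 / ((m : ℝ) + 1)) m) ∈ nhds x :=
    set_pi_mem_nhds finite_univ fun i _ => Icc_mem_nhds (hm i).1 (hm i).2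
  exact mem_of_superset this fun y hy i => hy i (mem_univ i)

lemma exists_norm_laplaceInt_le (hG : OrthantBounded G M) (hne : ¬ ∀ᵐ s, G s = 0)
    {β : ℝ} (B : ℝ) (hβ : 0 < β) : ∃ C : ℝ, 0 < C ∧ ∀ t : ℝ, 1 ≤ t → ∀ z : Fin n → ℂ,
      (∀ i, t * β ≤ (z i).re ∧ (z i).re ≤ t * B) →
      ‖laplaceInt G z‖ ≤ C * Real.exp (-suppFun G (fun i => (z i).re)) := by
  obtain ⟨A, hA, hAb⟩ := hG.exists_suppFun_bound hne
  set I := ∫ s, M * orthantExp (n := n) β s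
  have hI : 0 ≤ I := integral_nonneg fun s => mul_nonneg hG.M_nonneg (orthantExp_nonneg _ _)
  refine ⟨Real.exp (B * A) * (I + 1), by positivity, fun t ht z hz => ?_⟩
  have ht0 : 0 < t := zero_lt_one.trans_le ht
  set x : Fin n → ℝ := fun i => (z i).re with hxdef
  have hx0 : ∀ i, 0 ≤ x i := fun i => (mul_nonneg ht0.le hβ.le).trans (hz i).1
  have hc0 := hG.suppFun_nonneg hx0
  have hcB : suppFun G x ≤ t * B * A := hAb x _ hx0 fun i => (hz i).2
  have hpt : ∀ᵐ s, ‖Complex.exp (-pairing s z) * G s‖ ≤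
      Real.exp (-(1 - 1 / t) * suppFun G x) * (M * orthantExp β s) := by
    filter_upwards [hG.ae_suppFun_le hx0] with s hs
    by_cases h : G s = 0
    · simpa [h] using mul_nonneg (Real.exp_pos _).le
        (mul_nonneg hG.M_nonneg (orthantExp_nonneg β s))
    · have hs0 := hG.nonneg s h
      have hxs := hs h
      rw [norm_mul, Complex.norm_exp, orthantExp_eq β hs0, Complex.neg_re, pairing_re]
      have h1 : β * ∑ i, s i ≤ 1 / t * ∑ i, x i * s i := by
        rw [Finset.mul_sum, Finset.mul_sum]
        refine Finset.sum_le_sum fun i _ => ?_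
        rw [← mul_assoc]
        refine mul_le_mul_of_nonneg_right ?_ (hs0 i)
        rw [one_div, ← div_eq_inv_mul, le_div_iff₀ ht0, mul_comm]
        exact (hz i).1
      have ht1 : 0 ≤ 1 - 1 / t := by
        rw [sub_nonneg, div_le_one ht0]; exact ht
      have h2 : Real.exp (-∑ i, x i * s i) ≤
          Real.exp (-(1 - 1 / t) * suppFun G x) * Real.exp (-β * ∑ i, s i) := by
        rw [← Real.exp_add, Real.exp_le_exp]
        nlinarith [mul_le_mul_of_nonneg_left hxs ht1]
      calc _ ≤ (Real.exp (-(1 - 1 / t) * suppFun G x) * Real.exp (-β * ∑ i, s i)) * M :=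
            mul_le_mul h2 (hG.bound s) (norm_nonneg _) (by positivity)
        _ = _ := by ring
  have hint := norm_integral_le_of_norm_le
    (((integrable_orthantExp (n := n) hβ).const_mul M).const_mul _) hpt
  rw [integral_const_mul] at hint
  refine hint.trans ?_
  have h3 : Real.exp (-(1 - 1 / t) * suppFun G x) ≤
      Real.exp (B * A) * Real.exp (-suppFun G x) := by
    rw [← Real.exp_add, Real.exp_le_exp]
    have : 1 / t * suppFun G x ≤ B * A := by
      rw [one_div, ← div_eq_inv_mul, div_le_iff₀ ht0]; linarith
    linarith
  calc _ ≤ (Real.exp (B * A) * Real.exp (-suppFun G x)) * (I + 1) := by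
        refine mul_le_mul h3 (by linarith) hI (by positivity)
    _ = _ := by ring

end OrthantBounded

/-- The probability that a Poisson variable of parameter `v` is less than `N`. -/
def poissonCdf (N : ℕ) (v : ℝ) : ℝ :=
  Real.exp (-v) * ∑ m ∈ Finset.range N, v ^ m / m.factorial

lemma poissonCdf_nonneg (N : ℕ) {v : ℝ} (hv : 0 ≤ v) : 0 ≤ poissonCdf N v :=
  mul_nonneg (Real.exp_pos _).le (Finset.sum_nonneg fun m _ => by positivity)

lemma poissonCdf_le_one (N : ℕ) {v : ℝ} (hv : 0 ≤ v) : poissonCdf N v ≤ 1 := by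
  rw [poissonCdf, Real.exp_neg, inv_mul_le_iff₀ (Real.exp_pos v), mul_one]
  exact Real.sum_le_exp_of_nonneg hv N

lemma poissonCdf_le (N : ℕ) {v q : ℝ} (hv : 0 ≤ v) (hq : 0 < q) (hq1 : q ≤ 1) :
    poissonCdf N v ≤ Real.exp (-(N * Real.log q) - v * (1 - q)) := by
  have hqN : Real.exp (-(N * Real.log q)) * q ^ N = 1 := by
    rw [← Real.rpow_natCast, Real.rpow_def_of_pos hq, ← Real.exp_add]; simp [mul_comm]
  have h1 : q ^ N * ∑ m ∈ Finset.range N, v ^ m / m.factorial ≤ Real.exp (q * v) := by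
    refine le_trans ?_ (Real.sum_le_exp_of_nonneg (mul_nonneg hq.le hv) N)
    rw [Finset.mul_sum]
    refine Finset.sum_le_sum fun m hm => ?_
    rw [mul_pow, mul_div_assoc]
    exact mul_le_mul_of_nonneg_right
      (pow_le_pow_of_le_one hq.le hq1 (Finset.mem_range.1 hm).le) (by positivity)
  calc poissonCdf N v = Real.exp (-(N * Real.log q)) * Real.exp (-v) *
        (q ^ N * ∑ m ∈ Finset.range N, v ^ m / m.factorial) := by
        rw [poissonCdf]
        linear_combination (-Real.exp (-v) * ∑ m ∈ Finset.range N, v ^ m / m.factorial) * hqN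
    _ ≤ Real.exp (-(N * Real.log q)) * Real.exp (-v) * Real.exp (q * v) := by gcongr
    _ = _ := by rw [← Real.exp_add, ← Real.exp_add]; ring_nf

lemma one_sub_poissonCdf_le (N : ℕ) {v q : ℝ} (hv : 0 ≤ v) (hq : 1 ≤ q) :
    1 - poissonCdf N v ≤ Real.exp (-(N * Real.log q) + v * (q - 1)) := by
  have hq0 : 0 < q := zero_lt_one.trans_le hq
  have hqN : Real.exp (-(N * Real.log q)) * q ^ N = 1 := by
    rw [← Real.rpow_natCast, Real.rpow_def_of_pos hq0, ← Real.exp_add]; simp [mul_comm]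
  have hs : ∀ x : ℝ, HasSum (fun m : ℕ => x ^ m / m.factorial) (Real.exp x) := fun x => by
    rw [Real.exp_eq_exp_ℝ]; exact NormedSpace.expSeries_div_hasSum_exp x
  have h1 : q ^ N * (Real.exp v - ∑ m ∈ Finset.range N, v ^ m / m.factorial) ≤
      Real.exp (q * v) := by
    have h2 := sum_le_hasSum (Finset.range N) (fun m hm => ?_)
      ((hs (q * v)).sub ((hs v).mul_left (q ^ N)))
    · rw [Finset.sum_sub_distrib, ← Finset.mul_sum] at h2
      have h3 : 0 ≤ ∑ m ∈ Finset.range N, (q * v) ^ m / m.factorial :=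
        Finset.sum_nonneg fun m _ => by positivity
      linarith
    · rw [mul_pow, mul_div_assoc, sub_nonneg]
      exact mul_le_mul_of_nonneg_right
        (pow_le_pow_right₀ hq (by simpa using hm)) (by positivity)
  have hv1 : Real.exp (-v) * Real.exp v = 1 := by rw [← Real.exp_add]; simp
  calc 1 - poissonCdf N v = Real.exp (-(N * Real.log q)) * Real.exp (-v) *
        (q ^ N * (Real.exp v - ∑ m ∈ Finset.range N, v ^ m / m.factorial)) := by
        rw [poissonCdf]
        linear_combination (-(Real.exp (-v) * (Real.exp v -
          ∑ m ∈ Finset.range N, v ^ m / m.factorial))) * hqN - hv1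
    _ ≤ Real.exp (-(N * Real.log q)) * Real.exp (-v) * Real.exp (q * v) := by gcongr
    _ = _ := by rw [← Real.exp_add, ← Real.exp_add]; ring_nf

lemma tendsto_exp_mul_atTop_zero {a : ℝ} (ha : a < 0) (b : ℝ) :
    Tendsto (fun t : ℝ => Real.exp (b + t * a)) atTop (nhds 0) :=
  Real.tendsto_exp_atBot.comp
    (tendsto_atBot_add_const_left _ b (tendsto_id.atTop_mul_const_of_neg ha))

lemma tendsto_poissonCdf_of_gt {κ u : ℝ} (hκ : 0 < κ) (hu : κ < u) :
    Tendsto (fun t : ℝ => poissonCdf ⌈κ * t⌉₊ (t * u)) atTop (nhds 0) := by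
  have hu0 : 0 < u := hκ.trans hu
  set l := Real.log (u / κ) with hl
  have hl0 : 0 ≤ l := Real.log_nonneg (by rw [le_div_iff₀ hκ]; linarith)
  have hlq : Real.log (κ / u) = -l := by rw [hl, ← Real.log_inv, inv_div]
  have hneg : κ * l - u + κ < 0 := by
    have h1 := Real.log_lt_sub_one_of_pos (div_pos hu0 hκ) (by
      intro h; rw [div_eq_one_iff_eq hκ.ne'] at h; linarith)
    have h2 := mul_lt_mul_of_pos_left h1 hκ
    rw [mul_sub, mul_div_cancel₀ _ hκ.ne'] at h2
    linarith
  refine tendsto_of_tendsto_of_tendsto_of_le_of_le' tendsto_const_nhds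
    (tendsto_exp_mul_atTop_zero hneg l) ?_ ?_
  · filter_upwards [eventually_ge_atTop 0] with t ht
    exact poissonCdf_nonneg _ (mul_nonneg ht hu0.le)
  · filter_upwards [eventually_ge_atTop 0] with t ht
    refine (poissonCdf_le _ (mul_nonneg ht hu0.le) (div_pos hκ hu0)
      (div_le_one_of_le₀ hu.le hu0.le)).trans (Real.exp_le_exp.2 ?_)
    rw [hlq]
    have h3 := mul_le_mul_of_nonneg_right
      (Nat.ceil_lt_add_one (mul_nonneg hκ.le ht)).le hl0
    have h4 : t * u * (1 - κ / u) = t * (u - κ) := by field_simp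
    rw [h4]; linarith

lemma tendsto_poissonCdf_of_lt {κ u : ℝ} (hu0 : 0 ≤ u) (hu : u < κ) :
    Tendsto (fun t : ℝ => poissonCdf ⌈κ * t⌉₊ (t * u)) atTop (nhds 1) := by
  have hκ : 0 < κ := hu0.trans_lt hu
  rcases hu0.eq_or_lt with rfl | hu0
  · refine tendsto_const_nhds.congr' ?_
    filter_upwards [eventually_gt_atTop 0] with t ht
    have hN : 0 < ⌈κ * t⌉₊ := Nat.ceil_pos.2 (mul_pos hκ ht)
    obtain ⟨N, hN⟩ := Nat.exists_eq_succ_of_ne_zero hN.ne'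
    rw [hN, poissonCdf, Finset.sum_range_succ']
    simp
  set l := Real.log (κ / u) with hl
  have hl0 : 0 ≤ l := Real.log_nonneg (by rw [le_div_iff₀ hu0]; linarith)
  have hneg : -(κ * l) + κ - u < 0 := by
    have h1 := Real.log_lt_sub_one_of_pos (div_pos hu0 hκ) (by
      intro h; rw [div_eq_one_iff_eq hκ.ne'] at h; linarith)
    have h2 := mul_lt_mul_of_pos_left h1 hκ
    rw [mul_sub, mul_div_cancel₀ _ hκ.ne', ← inv_div, Real.log_inv] at h2
    linarith
  have h0 : Tendsto (fun t : ℝ => 1 - poissonCdf ⌈κ * t⌉₊ (t * u)) atTop (nhds 0) := by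
    refine tendsto_of_tendsto_of_tendsto_of_le_of_le' tendsto_const_nhds
      (tendsto_exp_mul_atTop_zero hneg 0) ?_ ?_
    · filter_upwards [eventually_ge_atTop 0] with t ht
      exact sub_nonneg.2 (poissonCdf_le_one _ (mul_nonneg ht hu0.le))
    · filter_upwards [eventually_ge_atTop 0] with t ht
      refine (one_sub_poissonCdf_le _ (mul_nonneg ht hu0.le)
        ((one_le_div hu0).2 hu.le)).trans (Real.exp_le_exp.2 ?_)
      have h3 := mul_le_mul_of_nonneg_right (Nat.le_ceil (κ * t)) hl0
      have h4 : t * u * (κ / u - 1) = t * (κ - u) := by field_simp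
      rw [h4, ← hl]; linarith
  simpa using h0.const_sub 1

lemma poissonCdf_dominated {κ t u : ℝ} (hκ : 0 < κ) (ht : 1 ≤ t) (hu : 0 ≤ u) :
    poissonCdf ⌈κ * t⌉₊ (t * u) ≤ 2 * Real.exp (κ * Real.log 2) * Real.exp (-u / 2) := by
  have ht0 : 0 ≤ t := zero_le_one.trans ht
  have hlog : 0 < Real.log 2 := Real.log_pos (by norm_num)
  rw [mul_assoc, ← Real.exp_add]
  rcases le_total 0 (κ * Real.log 2 + -u / 2) with h | h
  · have := poissonCdf_le_one ⌈κ * t⌉₊ (mul_nonneg ht0 hu)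
    have := Real.one_le_exp h
    linarith
  · refine (poissonCdf_le _ (mul_nonneg ht0 hu) (q := 1 / 2) (by norm_num) (by norm_num)).trans ?_
    rw [← Real.exp_log (show (0:ℝ) < 2 by norm_num), ← Real.exp_add, Real.exp_le_exp,
      Real.exp_log (by norm_num), one_div, Real.log_inv]
    have h3 := mul_le_mul_of_nonneg_right
      (Nat.ceil_lt_add_one (mul_nonneg hκ.le ht0)).le hlog.le
    nlinarith

lemma ae_eq_zero_of_fourier_real {n : ℕ} {h : (Fin n → ℝ) → ℝ} (hi : Integrable h)
    (hm : Measurable h)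
    (h0 : ∀ L : StrongDual ℝ (Fin n → ℝ), ∫ v, Complex.exp (L v * Complex.I) * h v = 0) :
    ∀ᵐ v, h v = 0 := by
  have hfin : ∀ {g : (Fin n → ℝ) → ℝ}, Integrable g → IsFiniteMeasure
      (volume.withDensity fun v => ((g v).toNNReal : ENNReal)) := fun hg =>
    isFiniteMeasure_withDensity hg.lintegral_lt_top.ne
  have hin : Integrable fun v => -h v := hi.neg
  have hfin1 := hfin hi
  have hfin2 := hfin hin
  have hm1 : Measurable fun v => (h v).toNNReal := hm.real_toNNReal
  have hm2 : Measurable fun v => (-h v).toNNReal := hm.neg.real_toNNReal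
  have heq : (volume.withDensity fun v => ((h v).toNNReal : ENNReal)) =
      volume.withDensity fun v => ((-h v).toNNReal : ENNReal) := by
    refine Measure.ext_of_charFunDual (funext fun L => ?_)
    have hexp : ∀ {g : (Fin n → ℝ) → ℝ}, Integrable g →
        Integrable fun v => (g v).toNNReal • Complex.exp (L v * Complex.I) := by
      intro g hg
      refine hg.norm.mono' ?_ (ae_of_all _ fun v => ?_)
      · exact hg.aestronglyMeasurable.aemeasurable.real_toNNReal.aestronglyMeasurable.smul
          (by fun_prop : Continuous fun v => Complex.exp (L v * Complex.I)).aestronglyMeasurable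
      · rw [NNReal.smul_def, norm_smul, Complex.norm_exp_ofReal_mul_I, mul_one,
          Real.coe_toNNReal', Real.norm_eq_abs, Real.norm_eq_abs, abs_of_nonneg (le_max_right _ _)]
        exact max_le (le_abs_self _) (abs_nonneg _)
    rw [charFunDual_apply, charFunDual_apply, integral_withDensity_eq_integral_smul hm1,
      integral_withDensity_eq_integral_smul hm2, ← sub_eq_zero,
      ← integral_sub (hexp hi) (hexp hin), ← h0 L]
    refine integral_congr_ae (ae_of_all _ fun v => ?_)
    have h3 : (((h v).toNNReal : ℝ) : ℂ) - (((-h v).toNNReal : ℝ) : ℂ) = h v := by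
      rw [← Complex.ofReal_sub, Real.coe_toNNReal', Real.coe_toNNReal',
        max_zero_sub_max_neg_zero_eq_self]
    simp only [NNReal.smul_def, Complex.real_smul]
    rw [← sub_mul, h3, mul_comm]
  have := (withDensity_eq_iff_of_sigmaFinite hm1.coe_nnreal_ennreal.aemeasurable
    hm2.coe_nnreal_ennreal.aemeasurable).1 heq
  filter_upwards [this] with v hv
  have h3 := max_zero_sub_max_neg_zero_eq_self (h v)
  rw [← Real.coe_toNNReal', ← Real.coe_toNNReal', ENNReal.coe_inj.1 hv, sub_self] at h3
  exact h3.symm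

lemma ae_eq_zero_of_fourier {n : ℕ} {g : (Fin n → ℝ) → ℂ} (hi : Integrable g)
    (hm : Measurable g)
    (h0 : ∀ L : StrongDual ℝ (Fin n → ℝ), ∫ v, Complex.exp (L v * Complex.I) * g v = 0) :
    ∀ᵐ v, g v = 0 := by
  have hexp : ∀ (L : StrongDual ℝ (Fin n → ℝ)) {k : (Fin n → ℝ) → ℂ}, Integrable k →
      Integrable fun v => Complex.exp (L v * Complex.I) * k v := fun L k hk =>
    hk.norm.mono' ((by fun_prop : Continuous fun v =>
      Complex.exp (L v * Complex.I)).aestronglyMeasurable.mul hk.aestronglyMeasurable)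
      (ae_of_all _ fun v => by rw [norm_mul, Complex.norm_exp_ofReal_mul_I, one_mul])
  have hc : ∀ L : StrongDual ℝ (Fin n → ℝ),
      ∫ v, Complex.exp (L v * Complex.I) * (starRingEnd ℂ) (g v) = 0 := by
    intro L
    have h1 := congrArg (starRingEnd ℂ) (h0 (-L))
    rw [← integral_conj, map_zero] at h1
    rw [← h1]
    refine integral_congr_ae (ae_of_all _ fun v => ?_)
    simp [← Complex.exp_conj]
  have hci : Integrable fun v => (starRingEnd ℂ) (g v) :=
    (Complex.conjCLE.toContinuousLinearMap.integrable_comp hi)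
  have hre : ∀ᵐ v, (g v).re = 0 := by
    refine ae_eq_zero_of_fourier_real hi.re (Complex.measurable_re.comp hm) fun L => ?_
    have h2 := integral_add (hexp L hi) (hexp L hci)
    rw [h0, hc, add_zero] at h2
    have h3 : ∀ v, Complex.exp (L v * Complex.I) * ((g v).re : ℂ) =
        (1 / 2) * (Complex.exp (L v * Complex.I) * g v +
          Complex.exp (L v * Complex.I) * (starRingEnd ℂ) (g v)) := fun v => by
      rw [← mul_add, Complex.add_conj]; push_cast; ring
    simp only [h3, integral_const_mul]
    simpa using h2
  have him : ∀ᵐ v, (g v).im = 0 := by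
    refine ae_eq_zero_of_fourier_real hi.im (Complex.measurable_im.comp hm) fun L => ?_
    have h2 := integral_sub (hexp L hi) (hexp L hci)
    rw [h0, hc, sub_zero] at h2
    have h3 : ∀ v, Complex.exp (L v * Complex.I) * ((g v).im : ℂ) =
        (-Complex.I / 2) * (Complex.exp (L v * Complex.I) * g v -
          Complex.exp (L v * Complex.I) * (starRingEnd ℂ) (g v)) := fun v => by
      rw [← mul_sub, Complex.sub_conj]
      push_cast
      linear_combination (Complex.exp (L v * Complex.I) * ((g v).im : ℂ)) * Complex.I_sq
    simp only [h3, integral_const_mul, h2, mul_zero]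
  filter_upwards [hre, him] with v h1 h2
  exact Complex.ext h1 h2

lemma norm_expMoment_integrand_le {α : Type*} {u : α → ℝ} {g : α → ℂ}
    (hu : ∀ s, 0 ≤ u s) (m : ℕ) {ζ : ℂ} {δ : ℝ} (hζ : δ ≤ ζ.re)
    (s : α) : ‖(u s : ℂ) ^ m * Complex.exp (-(ζ * u s)) * g s‖ ≤
      u s ^ m * Real.exp (-(δ * u s)) * ‖g s‖ := by
  have hs := hu s
  rw [norm_mul, norm_mul, norm_pow, Complex.norm_real, Real.norm_of_nonneg hs, Complex.norm_exp,
    Complex.neg_re, Complex.re_mul_ofReal]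
  gcongr

section Moments

variable {α : Type*} [MeasurableSpace α] {μ : Measure α} {u : α → ℝ} {g : α → ℂ}

/-- The moments of `g` with respect to the exponential kernel `exp (-ζ u)`. -/
def expMoment (μ : Measure α) (u : α → ℝ) (g : α → ℂ) (m : ℕ) (ζ : ℂ) : ℂ :=
  ∫ s, (u s : ℂ) ^ m * Complex.exp (-(ζ * u s)) * g s ∂μ

lemma measurable_expMoment (hum : Measurable u) (hgm : Measurable g) (m : ℕ) (ζ : ℂ) :
    Measurable fun s => (u s : ℂ) ^ m * Complex.exp (-(ζ * u s)) * g s := by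
  fun_prop

lemma integrable_pow_mul_exp (hum : Measurable u) (hgm : Measurable g) (hu : ∀ s, 0 ≤ u s)
    (hint : ∀ δ > 0, Integrable (fun s => Real.exp (-(δ * u s)) * ‖g s‖) μ) (m : ℕ) {δ : ℝ}
    (hδ : 0 < δ) : Integrable (fun s => u s ^ m * Real.exp (-(δ * u s)) * ‖g s‖) μ := by
  refine ((hint (δ / 2) (half_pos hδ)).const_mul (m.factorial * (2 / δ) ^ m)).mono'
    (by fun_prop) (ae_of_all _ fun s => ?_)
  rw [Real.norm_of_nonneg (by have := hu s; positivity), ← mul_assoc]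
  refine mul_le_mul_of_nonneg_right ?_ (norm_nonneg _)
  have h1 : (δ / 2 * u s) ^ m / m.factorial ≤ Real.exp (δ / 2 * u s) :=
    Real.pow_div_factorial_le_exp _ (mul_nonneg (half_pos hδ).le (hu s)) m
  have h2 : u s ^ m ≤ m.factorial * (2 / δ) ^ m * Real.exp (δ / 2 * u s) := by
    rw [div_le_iff₀ (by positivity)] at h1
    calc u s ^ m = (2 / δ) ^ m * (δ / 2 * u s) ^ m := by
          rw [← mul_pow]; congr 1; field_simp
      _ ≤ (2 / δ) ^ m * (Real.exp (δ / 2 * u s) * m.factorial) := by gcongr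
      _ = _ := by ring
  calc _ ≤ m.factorial * (2 / δ) ^ m * Real.exp (δ / 2 * u s) * Real.exp (-(δ * u s)) := by gcongr
    _ = _ := by rw [mul_assoc, ← Real.exp_add]; ring_nf

lemma integrable_expMoment (hum : Measurable u) (hgm : Measurable g) (hu : ∀ s, 0 ≤ u s)
    (hint : ∀ δ > 0, Integrable (fun s => Real.exp (-(δ * u s)) * ‖g s‖) μ) (m : ℕ) {ζ : ℂ}
    (hζ : 0 < ζ.re) :
    Integrable (fun s => (u s : ℂ) ^ m * Complex.exp (-(ζ * u s)) * g s) μ :=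
  (integrable_pow_mul_exp hum hgm hu hint m hζ).mono'
    (measurable_expMoment hum hgm m ζ).aestronglyMeasurable
    (ae_of_all _ (norm_expMoment_integrand_le hu m le_rfl))

lemma hasDerivAt_expMoment (hum : Measurable u) (hgm : Measurable g) (hu : ∀ s, 0 ≤ u s)
    (hint : ∀ δ > 0, Integrable (fun s => Real.exp (-(δ * u s)) * ‖g s‖) μ) (m : ℕ) {ζ : ℂ}
    (hζ : 0 < ζ.re) :
    HasDerivAt (expMoment μ u g m) (-expMoment μ u g (m + 1) ζ) ζ := by
  have hball : ∀ w ∈ Metric.ball ζ (ζ.re / 2), ζ.re / 2 ≤ w.re := by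
    intro w hw
    rw [mem_ball_iff_norm] at hw
    have h1 := (Complex.abs_re_le_norm _).trans hw.le
    rw [Complex.sub_re, abs_le] at h1
    linarith
  have h := hasDerivAt_integral_of_dominated_loc_of_deriv_le (μ := μ)
    (F := fun w s => (u s : ℂ) ^ m * Complex.exp (-(w * u s)) * g s)
    (F' := fun w s => -((u s : ℂ) ^ (m + 1) * Complex.exp (-(w * u s)) * g s))
    (bound := fun s => u s ^ (m + 1) * Real.exp (-(ζ.re / 2 * u s)) * ‖g s‖)
    (Metric.ball_mem_nhds ζ (half_pos hζ))
    (Eventually.of_forall fun w => (measurable_expMoment hum hgm m w).aestronglyMeasurable)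
    (integrable_expMoment hum hgm hu hint m hζ)
    (measurable_expMoment hum hgm (m + 1) ζ).neg.aestronglyMeasurable
    (ae_of_all _ fun s w hw => by
      rw [norm_neg]; exact norm_expMoment_integrand_le hu (m + 1) (hball w hw) s)
    (integrable_pow_mul_exp hum hgm hu hint (m + 1) (half_pos hζ))
    (ae_of_all _ fun s w _ => ?_)
  · have h2 := h.2
    rw [integral_neg] at h2
    exact h2
  · have h1 : HasDerivAt (fun w : ℂ => -(w * u s)) (-(1 * u s)) w :=
      ((hasDerivAt_id w).mul_const _).neg
    refine ((h1.cexp.const_mul ((u s : ℂ) ^ m)).mul_const (g s)).congr_deriv ?_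
    ring

lemma iteratedDeriv_expMoment (hum : Measurable u) (hgm : Measurable g) (hu : ∀ s, 0 ≤ u s)
    (hint : ∀ δ > 0, Integrable (fun s => Real.exp (-(δ * u s)) * ‖g s‖) μ) (m : ℕ) {ζ : ℂ}
    (hζ : 0 < ζ.re) :
    iteratedDeriv m (expMoment μ u g 0) ζ = (-1) ^ m * expMoment μ u g m ζ := by
  induction m generalizing ζ with
  | zero => simp
  | succ m ih =>
    have hev : iteratedDeriv m (expMoment μ u g 0) =ᶠ[nhds ζ]
        fun w => (-1) ^ m * expMoment μ u g m w := by
      filter_upwards [(isOpen_lt continuous_const Complex.continuous_re).mem_nhds hζ] with w hw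
      exact ih hw
    rw [iteratedDeriv_succ, hev.deriv_eq,
      ((hasDerivAt_expMoment hum hgm hu hint m hζ).const_mul _).deriv]
    ring

lemma norm_expMoment_le (hum : Measurable u) (hgm : Measurable g) (hu : ∀ s, 0 ≤ u s)
    (hint : ∀ δ > 0, Integrable (fun s => Real.exp (-(δ * u s)) * ‖g s‖) μ) (m : ℕ)
    {τ ρ C : ℝ} (hτ : 0 < τ) (hρ : 0 < ρ) (hρ1 : ρ < 1)
    (hC : ∀ ζ : ℂ, ‖ζ - τ‖ ≤ ρ * τ → ‖expMoment μ u g 0 ζ‖ ≤ C) :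
    ‖expMoment μ u g m τ‖ ≤ m.factorial * C / (ρ * τ) ^ m := by
  have hdiff : DiffContOnCl ℂ (expMoment μ u g 0) (Metric.ball (τ : ℂ) (ρ * τ)) := by
    refine DifferentiableOn.diffContOnCl fun ζ hζ => ?_
    have hζ' := Metric.closure_ball_subset_closedBall hζ
    rw [mem_closedBall_iff_norm] at hζ'
    have h1 := (Complex.abs_re_le_norm _).trans hζ'
    rw [Complex.sub_re, Complex.ofReal_re, abs_le] at h1
    exact (hasDerivAt_expMoment hum hgm hu hint 0
      (by nlinarith)).differentiableAt.differentiableWithinAt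
  have h := Complex.norm_iteratedDeriv_le_of_forall_mem_sphere_norm_le m (mul_pos hρ hτ) hdiff
    (fun z hz => hC z (by rw [mem_sphere_iff_norm] at hz; exact hz.le))
  rw [iteratedDeriv_expMoment hum hgm hu hint m (by simpa using hτ)] at h
  simpa using h

lemma norm_integral_poissonCdf_le (hum : Measurable u) (hgm : Measurable g) (hu : ∀ s, 0 ≤ u s)
    (hint : ∀ δ > 0, Integrable (fun s => Real.exp (-(δ * u s)) * ‖g s‖) μ) (N : ℕ)
    {τ ρ C : ℝ} (hτ : 0 < τ) (hρ : 0 < ρ) (hρ1 : ρ < 1) (hC0 : 0 ≤ C)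
    (hC : ∀ ζ : ℂ, ‖ζ - τ‖ ≤ ρ * τ → ‖expMoment μ u g 0 ζ‖ ≤ C) :
    ‖∫ s, (poissonCdf N (τ * u s) : ℂ) * g s ∂μ‖ ≤ N * C * (ρ ^ N)⁻¹ := by
  have hre : (0:ℝ) < ((τ : ℂ)).re := by simpa using hτ
  have h1 : ∫ s, (poissonCdf N (τ * u s) : ℂ) * g s ∂μ =
      ∑ m ∈ Finset.range N, ((τ : ℂ) ^ m / m.factorial) * expMoment μ u g m τ := by
    simp only [expMoment, ← integral_const_mul]
    rw [← integral_finsetSum]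
    · refine integral_congr_ae (ae_of_all _ fun s => ?_)
      simp only [poissonCdf]
      push_cast
      rw [Finset.mul_sum, Finset.sum_mul]
      refine Finset.sum_congr rfl fun m _ => ?_
      rw [mul_pow]; ring
    · exact fun m _ => (integrable_expMoment hum hgm hu hint m hre).const_mul _
  rw [h1]
  calc _ ≤ ∑ m ∈ Finset.range N, C * (ρ ^ N)⁻¹ := by
        refine norm_sum_le_of_le _ fun m hm => ?_
        rw [norm_mul, norm_div, norm_pow, Complex.norm_real, Real.norm_of_nonneg hτ.le,
          Complex.norm_natCast]
        refine (mul_le_mul_of_nonneg_left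
          (norm_expMoment_le hum hgm hu hint m hτ hρ hρ1 hC) (by positivity)).trans ?_
        have h2 : τ ^ m / m.factorial * (m.factorial * C / (ρ * τ) ^ m) = C * (ρ ^ m)⁻¹ := by
          rw [mul_pow]; field_simp
        rw [h2]
        refine mul_le_mul_of_nonneg_left ?_ hC0
        exact inv_anti₀ (pow_pos hρ N)
          (pow_le_pow_of_le_one hρ.le hρ1.le (Finset.mem_range.1 hm).le)
    _ = _ := by simp [mul_assoc]

lemma integral_indicator_eq_zero_of_small (hum : Measurable u) (hgm : Measurable g)
    (hu : ∀ s, 0 ≤ u s)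
    (hint : ∀ δ > 0, Integrable (fun s => Real.exp (-(δ * u s)) * ‖g s‖) μ)
    {ρ η κ : ℝ} (hρ : 0 < ρ) (hρ1 : ρ < 1) (hκ : 0 < κ) (hκη : κ * (1 - Real.log ρ) < η)
    (hnull : ∀ᵐ s ∂μ, u s ≠ κ)
    (hsmall : ∃ᶠ τ : ℝ in atTop, ∀ ζ : ℂ, ‖ζ - τ‖ ≤ ρ * τ →
      ‖expMoment μ u g 0 ζ‖ ≤ Real.exp (-(η * τ))) :
    ∫ s, {s | u s < κ}.indicator g s ∂μ = 0 := by
  set l : Filter ℝ := atTop ⊓ 𝓟 {τ : ℝ | ∀ ζ : ℂ, ‖ζ - τ‖ ≤ ρ * τ →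
      ‖expMoment μ u g 0 ζ‖ ≤ Real.exp (-(η * τ))} with hl
  have hne : l.NeBot := frequently_mem_iff_neBot.1 hsmall
  have hlt : l ≤ atTop := inf_le_left
  have hlog : Real.log ρ < 0 := Real.log_neg hρ hρ1
  have hlim1 : Tendsto (fun τ : ℝ => ∫ s, (poissonCdf ⌈κ * τ⌉₊ (τ * u s) : ℂ) * g s ∂μ) l
      (nhds (∫ s, {s | u s < κ}.indicator g s ∂μ)) := by
    refine tendsto_integral_filter_of_dominated_convergence
      (fun s => 2 * Real.exp (κ * Real.log 2) * (Real.exp (-(1 / 2 * u s)) * ‖g s‖)) ?_ ?_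
      ((hint (1 / 2) (by norm_num)).const_mul _) ?_
    · refine Eventually.of_forall fun τ => Measurable.aestronglyMeasurable ?_
      unfold poissonCdf
      fun_prop
    · filter_upwards [hlt (eventually_ge_atTop 1)] with τ hτ
      refine ae_of_all _ fun s => ?_
      have hτu : 0 ≤ τ * u s := mul_nonneg (zero_le_one.trans hτ) (hu s)
      rw [norm_mul, Complex.norm_real, Real.norm_of_nonneg (poissonCdf_nonneg _ hτu), ← mul_assoc]
      refine mul_le_mul_of_nonneg_right ((poissonCdf_dominated hκ hτ (hu s)).trans_eq ?_)
        (norm_nonneg _)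
      ring_nf
    · filter_upwards [hnull] with s hs
      rcases lt_or_gt_of_ne hs with h | h
      · rw [indicator_of_mem (show s ∈ {s | u s < κ} from h)]
        have := ((tendsto_poissonCdf_of_lt (hu s) h).mono_left hlt).ofReal
        simpa using this.mul_const (g s)
      · rw [indicator_of_notMem (show s ∉ {s | u s < κ} from not_lt.2 h.le)]
        have := ((tendsto_poissonCdf_of_gt hκ h).mono_left hlt).ofReal
        simpa using this.mul_const (g s)
  refine tendsto_nhds_unique hlim1 ?_
  have hneg : κ * (1 - Real.log ρ) - η < 0 := by linarith
  refine squeeze_zero_norm' ?_ ((tendsto_exp_mul_atTop_zero hneg (-Real.log ρ)).mono_left hlt)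
  filter_upwards [hlt (eventually_gt_atTop 0), mem_inf_of_right (mem_principal_self _)]
    with τ hτ hτs
  refine (norm_integral_poissonCdf_le hum hgm hu hint _ hτ hρ hρ1 (Real.exp_pos _).le hτs).trans ?_
  have hN := (Nat.ceil_lt_add_one (mul_nonneg hκ.le hτ.le)).le
  have h1 : ((⌈κ * τ⌉₊ : ℕ) : ℝ) ≤ Real.exp (κ * τ) := hN.trans (Real.add_one_le_exp _)
  have h2 : (ρ ^ ⌈κ * τ⌉₊)⁻¹ ≤ Real.exp (-((κ * τ + 1) * Real.log ρ)) := by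
    rw [← Real.rpow_natCast, Real.rpow_def_of_pos hρ, ← Real.exp_neg, Real.exp_le_exp]
    nlinarith
  calc _ ≤ Real.exp (κ * τ) * Real.exp (-(η * τ)) * Real.exp (-((κ * τ + 1) * Real.log ρ)) := by
        gcongr
    _ = _ := by rw [← Real.exp_add, ← Real.exp_add]; ring_nf

end Moments

lemma ae_sum_mul_ne {n : ℕ} {x : Fin n → ℝ} {i : Fin n} (hi : x i ≠ 0) (b : ℝ) :
    ∀ᵐ s : Fin n → ℝ, ∑ j, x j * s j ≠ b := by
  let φ : (Fin n → ℝ) →ₗ[ℝ] ℝ := ∑ j, x j • LinearMap.proj j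
  have hφ : ∀ s, φ s = ∑ j, x j * s j := fun s => by simp [φ]
  have hsingle : ∀ r : ℝ, φ (Pi.single i r) = x i * r := fun r => by
    rw [hφ, Finset.sum_eq_single i] <;> simp +contextual
  let A : AffineSubspace ℝ (Fin n → ℝ) :=
    AffineSubspace.mk' (Pi.single i (b / x i)) (LinearMap.ker φ)
  have hA : A ≠ ⊤ := by
    intro h
    have h1 : Pi.single i (b / x i + 1) ∈ A := h ▸ AffineSubspace.mem_top _ _ _
    rw [AffineSubspace.mem_mk', vsub_eq_sub, LinearMap.mem_ker, map_sub, hsingle, hsingle] at h1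
    exact hi (by linarith)
  refine measure_mono_null (fun s hs => ?_) (Measure.addHaar_affineSubspace volume A hA)
  simp only [mem_compl_iff, mem_ofPred_eq, not_not] at hs
  change s ∈ A
  rw [AffineSubspace.mem_mk', vsub_eq_sub, LinearMap.mem_ker, map_sub, hsingle, hφ, hs]
  field_simp
  simp

namespace OrthantBounded

variable {n : ℕ} {G : (Fin n → ℝ) → ℂ} {M : ℝ}

/-- The height of `s` above the supporting hyperplane of the essential support of `G`
with normal `x`. -/
def supportHeight (G : (Fin n → ℝ) → ℂ) (x s : Fin n → ℝ) : ℝ :=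
  max (∑ i, x i * s i - suppFun G x) 0

lemma measurable_supportHeight (G : (Fin n → ℝ) → ℂ) (x : Fin n → ℝ) :
    Measurable (supportHeight G x) := by
  unfold supportHeight
  fun_prop

lemma integrable_exp_supportHeight (hG : OrthantBounded G M) {x : Fin n → ℝ}
    (hx : ∀ i, 0 < x i) {δ : ℝ} (hδ : 0 < δ) :
    Integrable fun s => Real.exp (-(δ * supportHeight G x s)) * ‖G s‖ := by
  have hm := measurable_supportHeight G x
  have hGm := hG.meas
  have h1 := ((hG.integrable_integrand (z := fun i => ((δ * x i : ℝ) : ℂ))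
    (fun i => by simpa using mul_pos hδ (hx i))).norm).const_mul (Real.exp (δ * suppFun G x))
  refine h1.mono' (by fun_prop) (ae_of_all _ fun s => ?_)
  rw [Real.norm_of_nonneg (by positivity), norm_mul, Complex.norm_exp, Complex.neg_re, pairing_re,
    ← mul_assoc, ← Real.exp_add]
  refine mul_le_mul_of_nonneg_right (Real.exp_le_exp.2 ?_) (norm_nonneg _)
  have h2 : ∑ i, x i * s i - suppFun G x ≤ supportHeight G x s := le_max_left _ _
  have h3 : ∑ i, (((δ * x i : ℝ) : ℂ)).re * s i = δ * ∑ i, x i * s i := by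
    rw [Finset.mul_sum]
    exact Finset.sum_congr rfl fun i _ => by rw [Complex.ofReal_re, mul_assoc]
  rw [h3]
  nlinarith [mul_le_mul_of_nonneg_left h2 hδ.le]

lemma expMoment_supportHeight (hG : OrthantBounded G M) {x : Fin n → ℝ} (hx : ∀ i, 0 < x i)
    (L : StrongDual ℝ (Fin n → ℝ)) (ζ : ℂ) :
    expMoment volume (supportHeight G x) (fun s => Complex.exp (L s * Complex.I) * G s) 0 ζ =
      Complex.exp (ζ * suppFun G x) *
        laplaceInt G (fun i => ζ * x i - L (Pi.single i 1) * Complex.I) := by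
  rw [expMoment, laplaceInt, ← integral_const_mul]
  refine integral_congr_ae ?_
  filter_upwards [hG.ae_suppFun_le fun i => (hx i).le] with s hs
  by_cases h : G s = 0
  · simp [h]
  · have hL : L s = ∑ i, s i * L (Pi.single i 1) := by
      conv_lhs => rw [← Finset.univ_sum_single s, map_sum]
      refine Finset.sum_congr rfl fun i _ => ?_
      rw [← smul_eq_mul, ← map_smul, ← Pi.single_smul, smul_eq_mul, mul_one]
    have h1 : supportHeight G x s = ∑ i, x i * s i - suppFun G x :=
      max_eq_left (sub_nonneg.2 (hs h))
    rw [pow_zero, one_mul, ← mul_assoc, ← mul_assoc, ← Complex.exp_add, ← Complex.exp_add, h1,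
      pairing_apply, hL]
    congr 2
    push_cast
    simp only [sub_mul, Finset.sum_sub_distrib, mul_sub, Finset.mul_sum, Finset.sum_mul]
    have e1 : ∑ i, ζ * (x i * s i : ℂ) = ∑ i, ζ * x i * (s i : ℂ) :=
      Finset.sum_congr rfl fun i _ => by ring
    have e2 : ∑ i, (s i : ℂ) * (L (Pi.single i 1) : ℂ) * Complex.I =
        ∑ i, (L (Pi.single i 1) : ℂ) * Complex.I * s i :=
      Finset.sum_congr rfl fun i _ => by ring
    rw [e1, e2]
    ring

/-- The Laplace transform attains its expected exponential size near every point of a ray. -/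
lemma eventually_exists_le_norm_laplaceInt [Nonempty (Fin n)] (hG : OrthantBounded G M)
    (hne : ¬ ∀ᵐ s, G s = 0) {x : Fin n → ℝ} (hx : ∀ i, 0 < x i) {η ρ : ℝ} (hη : 0 < η)
    (hρ : 0 < ρ) :
    ∀ᶠ τ : ℝ in atTop, ∃ z : Fin n → ℂ, (∀ i, ‖z i - (τ * x i : ℝ)‖ ≤ ρ * τ) ∧
      Real.exp (-((suppFun G x + η) * τ)) ≤ ‖laplaceInt G z‖ := by
  by_contra hcon
  rw [not_eventually] at hcon
  set c := suppFun G x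
  have hc : 0 ≤ c := hG.suppFun_nonneg fun i => (hx i).le
  set u := supportHeight G x
  have hum : Measurable u := measurable_supportHeight G x
  have hu : ∀ s, 0 ≤ u s := fun s => le_max_right _ _
  have hGm := hG.meas
  set X := ∑ i, x i
  have hX : 0 ≤ X := Finset.sum_nonneg fun i _ => (hx i).le
  have hxX : ∀ i, x i ≤ X := fun i =>
    Finset.single_le_sum (f := x) (fun j _ => (hx j).le) (Finset.mem_univ i)
  obtain ⟨r, hr, hr1, hrX, hrc⟩ : ∃ r : ℝ, 0 < r ∧ r < 1 ∧ r * X ≤ ρ / 2 ∧ r * c ≤ η / 2 := by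
    refine ⟨min (1 / 2) (min (ρ / 2 / (X + 1)) (η / 2 / (c + 1))), by positivity, ?_, ?_, ?_⟩
    · exact (min_le_left _ _).trans_lt (by norm_num)
    · calc _ ≤ (ρ / 2 / (X + 1)) * (X + 1) := by
            gcongr
            · exact (min_le_right _ _).trans (min_le_left _ _)
            · linarith
        _ = _ := by field_simp
    · calc _ ≤ (η / 2 / (c + 1)) * (c + 1) := by
            gcongr
            · exact (min_le_right _ _).trans (min_le_right _ _)
            · linarith
        _ = _ := by field_simp
  have hlog : Real.log r < 0 := Real.log_neg hr hr1
  obtain ⟨κ, hκ, hκη⟩ : ∃ κ : ℝ, 0 < κ ∧ κ * (1 - Real.log r) < η / 2 := by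
    refine ⟨η / 4 / (1 - Real.log r), div_pos (by linarith) (by linarith), ?_⟩
    rw [div_mul_cancel₀ _ (by linarith)]
    linarith
  obtain ⟨i₀⟩ := ‹Nonempty (Fin n)›
  have hnull : ∀ᵐ s, u s ≠ κ := by
    filter_upwards [ae_sum_mul_ne (hx i₀).ne' (c + κ)] with s hs h
    rcases max_choice (∑ i, x i * s i - suppFun G x) 0 with h' | h'
    · exact hs (by have : ∑ i, x i * s i - c = κ := h'.symm.trans h
                   linarith)
    · exact hκ.ne' (h.symm.trans h')
  have hset : MeasurableSet {s | u s < κ} := measurableSet_lt hum measurable_const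
  have hzero : ∀ᵐ s, {s | u s < κ}.indicator G s = 0 := by
    refine ae_eq_zero_of_fourier ?_ (hGm.indicator hset) fun L => ?_
    · refine ((hG.integrable_exp_supportHeight hx one_pos).const_mul (Real.exp κ)).mono'
        (hGm.indicator hset).aestronglyMeasurable (ae_of_all _ fun s => ?_)
      by_cases h : u s < κ
      · rw [indicator_of_mem (by exact h), ← mul_assoc, ← Real.exp_add]
        refine le_mul_of_one_le_left (norm_nonneg _) (Real.one_le_exp ?_)
        change 0 ≤ κ + -(1 * u s)
        linarith
      · rw [indicator_of_notMem (by exact h), norm_zero]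
        positivity
    · have hgm : Measurable fun s => Complex.exp (L s * Complex.I) * G s := by
        have := L.continuous.measurable
        fun_prop
      have key := integral_indicator_eq_zero_of_small (μ := volume) hum hgm hu
        (fun δ hδ => by
          simpa [Complex.norm_exp_ofReal_mul_I] using hG.integrable_exp_supportHeight hx hδ)
        hr hr1 hκ hκη hnull ?_
      · rw [← key]
        refine integral_congr_ae (ae_of_all _ fun s => ?_)
        by_cases h : s ∈ {s | u s < κ}
        · simp only [indicator_of_mem h]
        · simp only [indicator_of_notMem h, mul_zero]
      · refine (hcon.and_eventually ((eventually_gt_atTop 0).and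
          (eventually_ge_atTop (‖L‖ / (ρ / 2))))).mono ?_
        rintro τ ⟨h1, hτ, hτL⟩ ζ hζ
        push Not at h1
        rw [div_le_iff₀ (half_pos hρ)] at hτL
        have h2 := h1 (fun i => ζ * x i - L (Pi.single i 1) * Complex.I) fun i => by
          have e : ζ * x i - L (Pi.single i 1) * Complex.I - (τ * x i : ℝ) =
              (ζ - τ) * x i - L (Pi.single i 1) * Complex.I := by push_cast; ring
          rw [e]
          refine (norm_sub_le _ _).trans ?_
          rw [norm_mul, norm_mul, Complex.norm_I, mul_one, Complex.norm_real, Complex.norm_real,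
            Real.norm_of_nonneg (hx i).le]
          have h3 : ‖L (Pi.single i 1)‖ ≤ ‖L‖ := by
            refine (L.le_opNorm _).trans ?_
            rw [Pi.norm_single]
            simp
          have h4 : ‖ζ - τ‖ * x i ≤ r * τ * X :=
            mul_le_mul hζ (hxX i) (hx i).le (by positivity)
          nlinarith [mul_le_mul_of_nonneg_right hrX hτ.le]
        rw [hG.expMoment_supportHeight hx, norm_mul, Complex.norm_exp]
        have h5 : (ζ * (suppFun G x : ℂ)).re ≤ (τ + r * τ) * c := by
          rw [Complex.re_mul_ofReal]
          refine mul_le_mul_of_nonneg_right ?_ hc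
          have := (Complex.re_le_norm (ζ - τ)).trans hζ
          rw [Complex.sub_re, Complex.ofReal_re] at this
          linarith
        calc _ ≤ Real.exp ((τ + r * τ) * c) * Real.exp (-((c + η) * τ)) := by gcongr
          _ = Real.exp ((τ + r * τ) * c + -((c + η) * τ)) := (Real.exp_add _ _).symm
          _ ≤ _ := Real.exp_le_exp.2 (by nlinarith [mul_le_mul_of_nonneg_right hrc hτ.le])
  refine hG.not_ae_zero_of_suppFun_lt hne (show suppFun G x < c + κ by linarith) ?_
  filter_upwards [hzero] with s hs hlt
  rwa [indicator_of_mem] at hs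
  exact max_lt (by linarith) hκ

end OrthantBounded

section Damping

variable {n : ℕ} {f : (Fin n → ℝ) → ℂ}

/-- The half-open box with corners `0` and `t`. -/
def cornerBox (t : Fin n → ℝ) : Set (Fin n → ℝ) := Set.pi univ fun i => Ioc 0 (t i)

lemma mem_cornerBox {t s : Fin n → ℝ} : s ∈ cornerBox t ↔ ∀ i, 0 < s i ∧ s i ≤ t i := by
  simp [cornerBox]

lemma measurableSet_cornerBox (t : Fin n → ℝ) : MeasurableSet (cornerBox t) :=
  MeasurableSet.univ_pi fun _ => measurableSet_Ioc

lemma cornerBox_subset_Icc (t : Fin n → ℝ) : cornerBox t ⊆ Icc 0 t := fun _ hs =>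
  ⟨fun i => (mem_cornerBox.1 hs i).1.le, fun i => (mem_cornerBox.1 hs i).2⟩

lemma mLapPartial_eq (f : (Fin n → ℝ) → ℂ) (l : Fin n → ℂ) (t : Fin n → ℝ) :
    mLapPartial n f l t = ∫ s in cornerBox t, Complex.exp (-pairing s l) * f s := by
  simp only [pairing_apply]
  rfl

lemma integrableOn_cornerBox (hf : LocallyIntegrableOn f {t | ∀ i, 0 ≤ t i}) (l : Fin n → ℂ)
    (t : Fin n → ℝ) : IntegrableOn (fun s => Complex.exp (-pairing s l) * f s) (cornerBox t) := by
  have h1 : IntegrableOn f (Icc 0 t) :=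
    hf.integrableOn_compact_subset (fun s hs => hs.1) isCompact_Icc
  refine (h1.continuousOn_mul (Continuous.continuousOn ?_) isCompact_Icc).mono_set
    (cornerBox_subset_Icc t)
  simp only [pairing_apply]
  fun_prop

lemma measurable_mLapPartial (hf : LocallyIntegrableOn f {t | ∀ i, 0 ≤ t i}) (l : Fin n → ℂ) :
    Measurable (mLapPartial n f l) := by
  have hae := hf.aestronglyMeasurable
  set g := hae.mk f with hg
  have hgm : Measurable g := hae.stronglyMeasurable_mk.measurable
  have h1 : mLapPartial n f l = fun t => ∫ s, {p : (Fin n → ℝ) × (Fin n → ℝ) |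
      p.2 ∈ cornerBox p.1}.indicator (fun p => Complex.exp (-pairing p.2 l) * g p.2) (t, s) := by
    funext t
    rw [mLapPartial_eq]
    have h2 : (∫ s in cornerBox t, Complex.exp (-pairing s l) * f s) =
        ∫ s in cornerBox t, Complex.exp (-pairing s l) * g s := by
      refine integral_congr_ae ?_
      have h3 := ae_restrict_of_ae_restrict_of_subset
        ((cornerBox_subset_Icc t).trans fun s hs => hs.1) hae.ae_eq_mk
      filter_upwards [h3] with s hs
      rw [hs]
    rw [h2, ← integral_indicator (measurableSet_cornerBox t)]
    rfl
  rw [h1]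
  refine (StronglyMeasurable.integral_prod_right (ν := volume) ?_).measurable
  refine (Measurable.indicator ?_ ?_).stronglyMeasurable
  · exact (Complex.measurable_exp.comp ((measurable_pairing l).comp measurable_snd).neg).mul
      (hgm.comp measurable_snd)
  · simp only [mem_cornerBox, ofPred_forall]
    have h2 : ∀ i, Measurable fun p : (Fin n → ℝ) × (Fin n → ℝ) => p.2 i := fun i =>
      (measurable_pi_apply i).comp measurable_snd
    have h3 : ∀ i, Measurable fun p : (Fin n → ℝ) × (Fin n → ℝ) => p.1 i := fun i =>
      (measurable_pi_apply i).comp measurable_fst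
    exact MeasurableSet.iInter fun i => (measurableSet_lt measurable_const (h2 i)).inter
      (measurableSet_le (h2 i) (h3 i))

lemma exists_orthantBounded_mLapPartial (hf : LocallyIntegrableOn f {t | ∀ i, 0 ≤ t i})
    {l : Fin n → ℂ} (hl : l ∈ mOmegaB n f) : ∃ M, OrthantBounded (mLapPartial n f l) M := by
  obtain ⟨M, hM⟩ :=
    (show Bornology.IsBounded (mLapPartial n f l '' {t | ∀ i, 0 ≤ t i}) from hl).exists_norm_le
  have h0 : ∀ s, mLapPartial n f l s ≠ 0 → ∀ i, 0 ≤ s i := by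
    intro s hs i
    by_contra hi
    refine hs ?_
    have : cornerBox s = ∅ := eq_empty_of_forall_notMem fun v hv => by
      have := mem_cornerBox.1 hv i
      linarith
    rw [mLapPartial_eq, this, setIntegral_empty]
  refine ⟨M, measurable_mLapPartial hf l, fun s => ?_, h0⟩
  by_cases h : mLapPartial n f l s = 0
  · rw [h, norm_zero]
    exact (norm_nonneg _).trans (hM _ ⟨0, fun i => le_rfl, rfl⟩)
  · exact hM _ ⟨s, h0 s h, rfl⟩

lemma integral_exp_upper_orthant {w : Fin n → ℂ} (hw : ∀ i, 0 < (w i).re) (s : Fin n → ℝ) :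
    ∫ r : Fin n → ℝ, {r | s ≤ r}.indicator (fun r => Complex.exp (-pairing r w)) r =
      Complex.exp (-pairing s w) / ∏ i, w i := by
  have h1 : ∀ r : Fin n → ℝ, {r | s ≤ r}.indicator (fun r => Complex.exp (-pairing r w)) r =
      ∏ i, (Ici (s i)).indicator (fun v : ℝ => Complex.exp (-w i * v)) (r i) := by
    intro r
    by_cases h : s ≤ r
    · rw [indicator_of_mem (by exact h), pairing_apply, ← Finset.sum_neg_distrib, Complex.exp_sum]
      refine Finset.prod_congr rfl fun i _ => ?_
      rw [indicator_of_mem (by exact h i), neg_mul]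
    · rw [indicator_of_notMem (by exact h)]
      rw [Pi.le_def] at h
      push Not at h
      obtain ⟨i, hi⟩ := h
      exact (Finset.prod_eq_zero (Finset.mem_univ i)
        (indicator_of_notMem (fun h => absurd h (not_le.2 hi)) _)).symm
  simp only [h1]
  rw [integral_fintype_prod_volume_eq_prod
    (fun i => (Ici (s i)).indicator (fun v : ℝ => Complex.exp (-w i * v))), pairing_apply,
    ← Finset.sum_neg_distrib, Complex.exp_sum, ← Finset.prod_div_distrib]
  refine Finset.prod_congr rfl fun i _ => ?_
  rw [integral_indicator measurableSet_Ici, integral_Ici_eq_integral_Ioi,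
    integral_exp_mul_complex_Ioi (by simpa using hw i), neg_div_neg_eq, neg_mul]

lemma mLapPartial_eq_integral (hf : LocallyIntegrableOn f {t | ∀ i, 0 ≤ t i})
    {l w : Fin n → ℂ} (hw : ∀ i, 0 < (w i).re) (t : Fin n → ℝ) :
    (∫ r, Complex.exp (-pairing r w) * mLapPartial n f l (r ⊓ t)) =
      mLapPartial n f (l + w) t / ∏ i, w i := by
  set H : (Fin n → ℝ) → ℂ := (cornerBox t).indicator fun s => Complex.exp (-pairing s l) * f s
    with hH
  have hHi : Integrable H :=
    (integrable_indicator_iff (measurableSet_cornerBox t)).2 (integrableOn_cornerBox hf l t)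
  obtain ⟨β, hβ, hwβ⟩ := OrthantBounded.exists_lt_re hw
  let k : (Fin n → ℝ) → (Fin n → ℝ) → ℂ := fun r s =>
    {r | s ≤ r}.indicator (fun r => Complex.exp (-pairing r w)) r * H s
  have hk : Integrable (Function.uncurry k) (volume.prod volume) := by
    refine ((integrable_orthantExp (n := n) hβ).mul_prod hHi.norm).mono' ?_ (ae_of_all _ ?_)
    · refine AEStronglyMeasurable.mul ?_ hHi.aestronglyMeasurable.comp_snd
      refine Measurable.aestronglyMeasurable ?_
      change Measurable ({p : (Fin n → ℝ) × (Fin n → ℝ) | p.2 ≤ p.1}.indicator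
        fun p => Complex.exp (-pairing p.1 w))
      refine Measurable.indicator
        (Complex.measurable_exp.comp ((measurable_pairing w).comp measurable_fst).neg) ?_
      exact (isClosed_le continuous_snd continuous_fst).measurableSet
    · rintro ⟨r, s⟩
      simp only [Function.uncurry, k, norm_mul]
      by_cases hs : s ∈ cornerBox t
      · refine mul_le_mul_of_nonneg_right ?_ (norm_nonneg _)
        by_cases h : s ≤ r
        · have hr : ∀ i, 0 ≤ r i := fun i => (mem_cornerBox.1 hs i).1.le.trans (h i)
          rw [indicator_of_mem (by exact h), Complex.norm_exp, orthantExp_eq β hr, Complex.neg_re,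
            pairing_re, neg_mul, Finset.mul_sum]
          refine Real.exp_le_exp.2 (neg_le_neg (Finset.sum_le_sum fun i _ => ?_))
          exact mul_le_mul_of_nonneg_right (hwβ i) (hr i)
        · rw [indicator_of_notMem (by exact h), norm_zero]
          exact orthantExp_nonneg _ _
      · simp [hH, indicator_of_notMem hs]
  have h1 : ∀ r, Complex.exp (-pairing r w) * mLapPartial n f l (r ⊓ t) = ∫ s, k r s := by
    intro r
    rw [mLapPartial_eq, ← integral_indicator (measurableSet_cornerBox _), ← integral_const_mul]
    refine integral_congr_ae (ae_of_all _ fun s => ?_)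
    by_cases hs : s ∈ cornerBox t
    · by_cases h : s ≤ r
      · have : s ∈ cornerBox (r ⊓ t) := mem_cornerBox.2 fun i =>
          ⟨(mem_cornerBox.1 hs i).1, le_inf (h i) (mem_cornerBox.1 hs i).2⟩
        simp only [k, hH, indicator_of_mem hs, indicator_of_mem this,
          indicator_of_mem (show r ∈ {r | s ≤ r} from h)]
      · have : s ∉ cornerBox (r ⊓ t) := fun h' => h fun i =>
          ((mem_cornerBox.1 h' i).2.trans inf_le_left)
        simp only [k, indicator_of_notMem this,
          indicator_of_notMem (show r ∉ {r | s ≤ r} from h), mul_zero, zero_mul]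
    · have : s ∉ cornerBox (r ⊓ t) := fun h' => hs <| mem_cornerBox.2 fun i =>
        ⟨(mem_cornerBox.1 h' i).1, (mem_cornerBox.1 h' i).2.trans inf_le_right⟩
      simp only [k, hH, indicator_of_notMem hs, indicator_of_notMem this, mul_zero]
  simp only [h1]
  rw [integral_integral_swap hk, mLapPartial_eq, ← integral_indicator (measurableSet_cornerBox _),
    ← integral_div]
  refine integral_congr_ae (ae_of_all _ fun s => ?_)
  simp only [k]
  rw [integral_mul_const, integral_exp_upper_orthant hw]
  by_cases hs : s ∈ cornerBox t
  · simp only [hH, indicator_of_mem hs, map_add, neg_add, Complex.exp_add]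
    ring
  · simp only [hH, indicator_of_notMem hs, mul_zero, zero_div]

lemma laplaceInt_eq_zero_of_hasMLaplace (hf : LocallyIntegrableOn f {t | ∀ i, 0 ≤ t i})
    {l w : Fin n → ℂ} (hl : l ∈ mOmegaB n f) (hw : ∀ i, 0 < (w i).re)
    (h0 : HasMLaplace n f (l + w) 0) : laplaceInt (mLapPartial n f l) w = 0 := by
  obtain ⟨M, hG⟩ := exists_orthantBounded_mLapPartial hf hl
  obtain ⟨β, hβ, hwβ⟩ := OrthantBounded.exists_lt_re hw
  have hT : Tendsto (fun k : ℕ => fun _ : Fin n => (k : ℝ)) atTop atTop :=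
    tendsto_atTop.2 fun b => eventually_all.2 fun i =>
      tendsto_natCast_atTop_atTop.eventually_ge_atTop (b i)
  have h1 : Tendsto (fun k : ℕ => ∫ r, Complex.exp (-pairing r w) *
      mLapPartial n f l (r ⊓ fun _ => (k : ℝ))) atTop (nhds 0) := by
    simp only [mLapPartial_eq_integral hf hw]
    simpa using (h0.comp hT).div_const (∏ i, w i)
  refine tendsto_nhds_unique (f := fun k : ℕ => ∫ r, Complex.exp (-pairing r w) *
    mLapPartial n f l (r ⊓ fun _ => (k : ℝ))) ?_ h1
  refine tendsto_integral_of_dominated_convergence (fun s => M * orthantExp β s) (fun k => ?_)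
    ((integrable_orthantExp hβ).const_mul M) (fun k => ae_of_all _ fun s => ?_)
    (ae_of_all _ fun s => ?_)
  · refine Measurable.aestronglyMeasurable ?_
    refine (Complex.measurable_exp.comp (measurable_pairing w).neg).mul (hG.meas.comp ?_)
    exact measurable_pi_lambda _ fun i => (measurable_pi_apply i).inf measurable_const
  · by_cases h : mLapPartial n f l (s ⊓ fun _ => (k : ℝ)) = 0
    · simpa [h] using mul_nonneg hG.M_nonneg (orthantExp_nonneg β s)
    · have hs : ∀ i, 0 ≤ s i := fun i => (hG.nonneg _ h i).trans inf_le_left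
      rw [norm_mul, Complex.norm_exp, orthantExp_eq β hs, mul_comm, Complex.neg_re, pairing_re]
      refine mul_le_mul (hG.bound _) (Real.exp_le_exp.2 ?_) (Real.exp_pos _).le hG.M_nonneg
      rw [neg_mul, neg_le_neg_iff, Finset.mul_sum]
      exact Finset.sum_le_sum fun i _ => mul_le_mul_of_nonneg_right (hwβ i) (hs i)
  · refine tendsto_const_nhds.congr' ?_
    filter_upwards [hT.eventually_ge_atTop s] with k hk
    rw [inf_eq_left.2 hk]

end Damping

section Recovery

variable {n : ℕ} {f : (Fin n → ℝ) → ℂ}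

lemma mLapPartial_eq_zero_of_ae (hf : LocallyIntegrableOn f {t | ∀ i, 0 ≤ t i}) {l : Fin n → ℂ}
    (h0 : ∀ᵐ t, mLapPartial n f l t = 0) (t : Fin n → ℝ) : mLapPartial n f l t = 0 := by
  have h1 : ∀ k : ℕ, ∃ r : Fin n → ℝ, mLapPartial n f l r = 0 ∧
      ∀ i, t i < r i ∧ r i < t i + 1 / (k + 1) := by
    intro k
    have hopen : IsOpen (Set.pi univ fun i => Ioo (t i) (t i + 1 / ((k : ℝ) + 1))) :=
      isOpen_set_pi finite_univ fun i _ => isOpen_Ioo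
    have hne : (Set.pi univ fun i => Ioo (t i) (t i + 1 / ((k : ℝ) + 1))).Nonempty :=
      univ_pi_nonempty_iff.2 fun i =>
        nonempty_Ioo.2 (by linarith [Nat.one_div_pos_of_nat (α := ℝ) (n := k)])
    have := ((hopen.measure_ne_zero volume hne))
    by_contra hcon
    push Not at hcon
    refine this (measure_mono_null (fun r hr => ?_) h0)
    intro hr0
    obtain ⟨i, hi⟩ := hcon r hr0
    exact absurd (hr i trivial).2 (not_lt.2 (hi (hr i trivial).1))
  choose r hr0 hr using h1
  have h2 : Tendsto (fun k => mLapPartial n f l (r k)) atTop (nhds (mLapPartial n f l t)) := by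
    simp only [mLapPartial_eq, ← integral_indicator (measurableSet_cornerBox _)]
    have hi := (integrable_indicator_iff (measurableSet_cornerBox _)).2
      (integrableOn_cornerBox hf l (fun i => t i + 1))
    have hle : ∀ k i, r k i ≤ t i + 1 := fun k i => by
      have : (1:ℝ) / (k + 1) ≤ 1 := by
        rw [div_le_one (by positivity)]
        linarith [k.cast_nonneg (α := ℝ)]
      linarith [(hr k i).2]
    refine tendsto_integral_of_dominated_convergence _ (fun k => ?_) hi.norm
      (fun k => ae_of_all _ fun s => ?_) (ae_of_all _ fun s => ?_)
    · exact ((integrable_indicator_iff (measurableSet_cornerBox _)).2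
        (integrableOn_cornerBox hf l (r k))).aestronglyMeasurable
    · refine norm_indicator_le_of_subset (fun s hs => ?_) _ s
      exact mem_cornerBox.2 fun i => ⟨(mem_cornerBox.1 hs i).1,
        (mem_cornerBox.1 hs i).2.trans (hle k i)⟩
    · refine tendsto_const_nhds.congr' ?_
      by_cases hs : s ∈ cornerBox t
      · refine Eventually.of_forall fun k => ?_
        have : s ∈ cornerBox (r k) := mem_cornerBox.2 fun i => ⟨(mem_cornerBox.1 hs i).1,
          (mem_cornerBox.1 hs i).2.trans (hr k i).1.le⟩
        simp only [indicator_of_mem hs, indicator_of_mem this]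
      · by_cases hpos : ∀ i, 0 < s i
        · obtain ⟨i, hi⟩ : ∃ i, t i < s i := by
            by_contra hcon
            push Not at hcon
            exact hs (mem_cornerBox.2 fun i => ⟨hpos i, hcon i⟩)
          have hlim : Tendsto (fun k : ℕ => t i + 1 / ((k : ℝ) + 1)) atTop (nhds (t i + 0)) :=
            tendsto_one_div_add_atTop_nhds_zero_nat.const_add _
          rw [add_zero] at hlim
          filter_upwards [hlim.eventually (gt_mem_nhds hi)] with k hk
          have : s ∉ cornerBox (r k) := fun h => by
            linarith [(mem_cornerBox.1 h i).2, (hr k i).2]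
          simp only [indicator_of_notMem hs, indicator_of_notMem this]
        · refine Eventually.of_forall fun k => ?_
          have : s ∉ cornerBox (r k) := fun h => hpos fun i => (mem_cornerBox.1 h i).1
          simp only [indicator_of_notMem hs, indicator_of_notMem this]
  simp only [hr0] at h2
  exact tendsto_nhds_unique h2 tendsto_const_nhds

lemma ae_eq_zero_of_mLapPartial (hf : LocallyIntegrableOn f {t | ∀ i, 0 ≤ t i}) {l : Fin n → ℂ}
    (h0 : ∀ t, mLapPartial n f l t = 0) : ∀ᵐ s, (∀ i, 0 ≤ s i) → f s = 0 := by
  set h : (Fin n → ℝ) → ℂ := fun s => Complex.exp (-pairing s l) * f s with hh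
  have hgen : (inferInstance : MeasurableSpace (Fin n → ℝ)) = MeasurableSpace.generateFrom
      (Set.pi univ '' Set.pi univ fun _ : Fin n => range (Iic : ℝ → Set ℝ)) := by
    refine (generateFrom_eq_pi (fun _ => ?_) fun _ => ?_).symm
    · rw [← borel_eq_generateFrom_Iic, BorelSpace.measurable_eq (α := ℝ)]
    · exact ⟨fun k : ℕ => Iic (k : ℝ), fun k => mem_range_self _,
        iUnion_eq_univ_iff.2 fun x => exists_nat_ge x⟩
  have hbox : ∀ t : Fin n → ℝ, ∀ᵐ s, s ∈ cornerBox t → f s = 0 := by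
    intro t
    have hi : Integrable h (volume.restrict (cornerBox t)) := integrableOn_cornerBox hf l t
    have htot : ∫ s in cornerBox t, h s = 0 := by rw [← mLapPartial_eq, h0]
    have hall : ∀ A : Set (Fin n → ℝ), MeasurableSet A →
        ∫ s in A, h s ∂(volume.restrict (cornerBox t)) = 0 := by
      intro A hA
      induction A, hA using MeasurableSpace.induction_on_inter hgen
        (IsPiSystem.pi fun _ => isPiSystem_Iic) with
      | empty => simp
      | basic A hA =>
        obtain ⟨C, hC, rfl⟩ := hA
        choose a ha using fun i => hC i trivial
        have : Set.pi univ C ∩ cornerBox t = cornerBox (a ⊓ t) := by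
          ext s
          simp only [mem_inter_iff, mem_univ_pi, mem_cornerBox, ← ha, mem_Iic, Pi.inf_apply,
            le_inf_iff]
          exact ⟨fun h i => ⟨(h.2 i).1, h.1 i, (h.2 i).2⟩,
            fun h => ⟨fun i => (h i).2.1, fun i => ⟨(h i).1, (h i).2.2⟩⟩⟩
        rw [Measure.restrict_restrict
          (MeasurableSet.univ_pi fun i => (ha i) ▸ measurableSet_Iic), this, ← mLapPartial_eq, h0]
      | compl A hA ih =>
        have := integral_add_compl hA hi
        rwa [ih, zero_add, htot] at this
      | iUnion F hd hF ih =>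
        rw [integral_iUnion hF hd hi.integrableOn]
        simp [ih]
    have h1 := hi.ae_eq_zero_of_forall_setIntegral_eq_zero fun A hA _ => hall A hA
    rw [EventuallyEq, ae_restrict_iff' (measurableSet_cornerBox t)] at h1
    filter_upwards [h1] with s hs hst
    simpa [hh, Complex.exp_ne_zero] using hs hst
  have hcoord : ∀ᵐ s : Fin n → ℝ, ∀ i, s i ≠ 0 := ae_all_iff.2 fun i => by
    have := ae_sum_mul_ne (x := Pi.single i 1) (i := i) (by simp) 0
    filter_upwards [this] with s hs
    simpa [Pi.single_apply] using hs
  have hboxes : ∀ᵐ s : Fin n → ℝ, ∀ k : ℕ, s ∈ cornerBox (fun _ => (k : ℝ)) → f s = 0 :=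
    ae_all_iff.2 fun k => hbox _
  filter_upwards [hcoord, hboxes] with s hs1 hs2 hs3
  obtain ⟨k, hk⟩ := exists_nat_ge (∑ i, s i)
  refine hs2 k (mem_cornerBox.2 fun i => ⟨lt_of_le_of_ne (hs3 i) (hs1 i).symm, le_trans ?_ hk⟩)
  exact Finset.single_le_sum (f := s) (fun j _ => hs3 j) (Finset.mem_univ i)

end Recovery

namespace OrthantBounded

/-- The support function of `G` is nearly bounded below by an affine function on a box around
`q`, with equality at `q`. -/
def NearlySupported {n : ℕ} (G : (Fin n → ℝ) → ℂ) (q : Fin n → ℝ) (r η : ℝ) : Prop :=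
  ∃ a : Fin n → ℝ, ∀ y : Fin n → ℝ, (∀ i, |y i - q i| ≤ 20 * r) → (∀ i, 0 < y i) ∧
    suppFun G q + ∑ i, a i * (y i - q i) - η * r ≤ suppFun G y

variable {m : ℕ} {G : (Fin (m + 1) → ℝ) → ℂ} {M : ℝ}

lemma exists_forall_card_le_of_nearlySupported (hG : OrthantBounded G M)
    (hne : ¬ ∀ᵐ s, G s = 0) {ε : ℝ} (hε : 0 < ε) : ∃ K : ℝ, 0 < K ∧
      ∀ (v q : Fin (m + 1) → ℝ) (r η : ℝ), 0 < r → 0 < η → NearlySupported G q r η →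
      ∀ᶠ t : ℝ in atTop, ∀ F : Finset (Fin (m + 1) → ℝ),
        (∀ x ∈ F, ∀ y ∈ F, x ≠ y → ∃ i, ε ≤ |x i - y i|) →
        (∀ x ∈ F, ∀ i, t * q i ≤ x i ∧ x i ≤ t * (q i + r)) →
        (∀ x ∈ F, (∀ i, v i < x i) → laplaceInt G (fun i => ((x i - v i : ℝ) : ℂ)) = 0) →
        (F.card : ℝ) ≤ K * η * (r * t) ^ (m + 1) := by
  obtain ⟨K, hK, hcard⟩ := exists_card_zeros_le m
  refine ⟨4 * K * (8 / ε) ^ m, by positivity, fun v q r η hr hη hflat => ?_⟩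
  obtain ⟨a, ha⟩ := hflat
  set c := suppFun G q
  have hq : ∀ i, 0 < q i - 20 * r := fun i => (ha (fun i => q i - 20 * r) fun j => by
    rw [sub_sub_cancel_left, abs_neg, abs_of_pos (by positivity)]).1 i
  obtain ⟨β, hβ, hqβ⟩ : ∃ β, 0 < β ∧ ∀ i, β ≤ q i - 20 * r := by
    obtain ⟨β, hβ, h⟩ := exists_lt_re (z := fun i => ((q i - 20 * r : ℝ) : ℂ))
      (fun i => by rw [Complex.ofReal_re]; exact hq i)
    exact ⟨β, hβ, fun i => by simpa only [Complex.ofReal_re] using h i⟩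
  obtain ⟨B, hB⟩ : ∃ B, ∀ i, q i + 20 * r ≤ B := by
    obtain ⟨B, hB⟩ := (finite_range fun i => q i + 20 * r).bddAbove
    exact ⟨B, fun i => hB ⟨i, rfl⟩⟩
  obtain ⟨C, hC, hbound⟩ := hG.exists_norm_laplaceInt_le hne B hβ
  set A := ∑ i, |a i|
  have hA : 0 ≤ A := Finset.sum_nonneg fun i _ => abs_nonneg _
  obtain ⟨ρ, hρ, hρr, hρA⟩ : ∃ ρ : ℝ, 0 < ρ ∧ ρ ≤ 2 * r ∧ A * ρ ≤ η * r := by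
    refine ⟨min (2 * r) (η * r / (A + 1)), by positivity, min_le_left _ _, ?_⟩
    calc _ ≤ (A + 1) * (η * r / (A + 1)) := by
          gcongr
          · linarith
          · exact min_le_right _ _
      _ = _ := by field_simp
  filter_upwards [hG.eventually_exists_le_norm_laplaceInt hne (x := q)
      (fun i => by linarith [hq i]) (mul_pos hη hr) hρ,
    eventually_ge_atTop 1, eventually_ge_atTop (Real.log C / (η * r)),
    eventually_all.2 fun i => eventually_ge_atTop (|v i| / r),
    eventually_ge_atTop (ε / (4 * r))] with t hz ht htC htv htε
  intro F hsep hbox hzero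
  obtain ⟨z, hz1, hz2⟩ := hz
  have ht0 : 0 < t := zero_lt_one.trans_le ht
  rw [div_le_iff₀ (by positivity)] at htC htε
  set R := 2 * (t * r) with hR
  have hR0 : 0 < R := by positivity
  let w : (Fin (m + 1) → ℂ) → Fin (m + 1) → ℂ := fun ζ i => (t * q i : ℝ) + R * ζ i
  let f : (Fin (m + 1) → ℂ) → ℂ := fun ζ => laplaceInt G (w ζ) *
    Complex.exp (∑ i, a i * (R * ζ i) + (c * t - η * r * t - Real.log C : ℝ))
  have hre : ∀ ζ : Fin (m + 1) → ℂ, ∀ i, (w ζ i).re = t * q i + R * (ζ i).re := fun ζ i => by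
    simp only [w, Complex.add_re, Complex.ofReal_re, Complex.re_ofReal_mul]
  have hζ : ∀ ζ : Fin (m + 1) → ℂ, ‖ζ‖ < 10 → ∀ i, |R * (ζ i).re| ≤ t * (20 * r) := by
    intro ζ h i
    rw [abs_mul, abs_of_pos hR0, hR]
    have := (Complex.abs_re_le_norm (ζ i)).trans ((norm_le_pi_norm ζ i).trans h.le)
    nlinarith [mul_pos ht0 hr]
  have hnormf : ∀ ζ, ‖f ζ‖ = ‖laplaceInt G (w ζ)‖ *
      Real.exp (∑ i, a i * (R * (ζ i).re) + (c * t - η * r * t - Real.log C)) := fun ζ => by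
    simp only [f, norm_mul, Complex.norm_exp, Complex.add_re, Complex.ofReal_re, Complex.re_sum,
      Complex.re_ofReal_mul]
  have hdiff : DifferentiableOn ℂ f (Metric.ball 0 10) := by
    intro ζ h
    rw [mem_ball_zero_iff] at h
    refine DifferentiableAt.differentiableWithinAt ?_
    have hw : DifferentiableAt ℂ w ζ := by
      refine differentiableAt_pi.2 fun i => ?_
      fun_prop
    have hL : DifferentiableAt ℂ (laplaceInt G) (w ζ) := hG.differentiableAt_laplaceInt fun i => by
      rw [hre]
      have h1 := neg_le_of_abs_le (hζ ζ h i)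
      have h2 := mul_pos ht0 (hq i)
      linarith
    have h3 := hL.comp ζ hw
    refine h3.mul ?_
    fun_prop
  have hle : ∀ ζ, ‖ζ‖ < 10 → ‖f ζ‖ ≤ 1 := by
    intro ζ h
    set y : Fin (m + 1) → ℝ := fun i => q i + R * (ζ i).re / t
    have hy : ∀ i, |y i - q i| ≤ 20 * r := fun i => by
      simp only [y, add_sub_cancel_left]
      rw [abs_div, abs_of_pos ht0, div_le_iff₀ ht0, mul_comm (20 * r)]
      exact hζ ζ h i
    have hwy : ∀ i, (w ζ i).re = t * y i := fun i => by
      rw [hre]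
      simp only [y]
      field_simp
    have h1 := hbound t ht (w ζ) fun i => by
      have := abs_le.1 (hζ ζ h i)
      rw [hre]
      constructor
      · nlinarith [mul_le_mul_of_nonneg_left (hqβ i) ht0.le]
      · nlinarith [mul_le_mul_of_nonneg_left (hB i) ht0.le]
    simp only [hwy] at h1
    rw [suppFun_smul t ht0.le] at h1
    have h2 := mul_le_mul_of_nonneg_left (ha y hy).2 ht0.le
    have h3 : t * ∑ i, a i * (y i - q i) = ∑ i, a i * (R * (ζ i).re) := by
      rw [Finset.mul_sum]
      refine Finset.sum_congr rfl fun i _ => ?_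
      simp only [y]
      field_simp
      ring
    rw [hnormf]
    calc _ ≤ C * Real.exp (-(t * suppFun G y)) *
          Real.exp (∑ i, a i * (R * (ζ i).re) + (c * t - η * r * t - Real.log C)) := by gcongr
      _ = Real.exp (Real.log C + (-(t * suppFun G y) +
          (∑ i, a i * (R * (ζ i).re) + (c * t - η * r * t - Real.log C)))) := by
        rw [Real.exp_add (Real.log C), Real.exp_add (-(t * suppFun G y)), Real.exp_log hC,
          mul_assoc]
      _ ≤ 1 := by
        rw [Real.exp_le_one_iff]
        nlinarith
  let b : Fin (m + 1) → ℂ := fun i => (z i - (t * q i : ℝ)) / R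
  have hb : ∀ i, ‖b i‖ ≤ 1 := fun i => by
    simp only [b, norm_div, Complex.norm_real, Real.norm_of_nonneg hR0.le]
    rw [div_le_one hR0, hR]
    nlinarith [hz1 i, mul_le_mul_of_nonneg_right hρr ht0.le]
  have hRC : (R : ℂ) ≠ 0 := Complex.ofReal_ne_zero.2 hR0.ne'
  have hwb : w b = z := funext fun i => by
    simp only [w, b]
    field_simp
    ring
  have hfb : Real.exp (-(4 * η * (r * t))) ≤ ‖f b‖ := by
    rw [hnormf, hwb]
    have h1 : -(η * r * t) ≤ ∑ i, a i * (R * (b i).re) := by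
      have h2 : ∀ i, -(|a i| * (ρ * t)) ≤ a i * (R * (b i).re) := fun i => by
        refine neg_le_of_abs_le ?_
        rw [abs_mul]
        refine mul_le_mul_of_nonneg_left ?_ (abs_nonneg _)
        have h3 : R * (b i).re = (z i - (t * q i : ℝ)).re := by
          rw [← Complex.re_ofReal_mul]
          simp only [b]
          rw [mul_div_cancel₀ _ hRC]
        rw [h3]
        exact (Complex.abs_re_le_norm _).trans (hz1 i)
      have h4 := Finset.sum_le_sum fun i (_ : i ∈ Finset.univ) => h2 i
      rw [Finset.sum_neg_distrib, ← Finset.sum_mul] at h4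
      nlinarith [mul_le_mul_of_nonneg_right hρA ht0.le]
    calc _ ≤ Real.exp (-((c + η * r) * t) +
          (∑ i, a i * (R * (b i).re) + (c * t - η * r * t - Real.log C))) :=
        Real.exp_le_exp.2 (by nlinarith)
      _ = Real.exp (-((c + η * r) * t)) * _ := Real.exp_add _ _
      _ ≤ _ := by gcongr
  have hfb0 : f b ≠ 0 := norm_pos_iff.1 ((Real.exp_pos _).trans_le hfb)
  have hlog : -Real.log ‖f b‖ ≤ 4 * η * (r * t) := by
    rw [neg_le, ← Real.log_exp (-(4 * η * (r * t)))]
    exact Real.log_le_log (Real.exp_pos _) hfb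
  let e : (Fin (m + 1) → ℝ) → Fin (m + 1) → ℝ := fun x i => (x i - v i - t * q i) / R
  have he : Function.Injective e := fun x y hxy => funext fun i => by
    have := congrFun hxy i
    simp only [e] at this
    rw [div_left_inj' hR0.ne'] at this
    linarith
  have hes : ∀ x y i, |e x i - e y i| = |x i - y i| / R := fun x y i => by
    simp only [e]
    rw [← sub_div, abs_div, abs_of_pos hR0]
    congr 2
    ring
  have hvi : ∀ i, |v i| ≤ t * r := fun i => by
    have := htv i
    rwa [div_le_iff₀ hr] at this
  set s := ε / (4 * R) with hs
  have hs0 : 0 < s := by positivity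
  have main := hcard f b s (F.image e) hdiff hle hb hfb0 hs0 (by
      rw [hs, div_le_iff₀ (by positivity), hR]
      linarith) (by
      intro x hx i
      obtain ⟨x, hxF, rfl⟩ := Finset.mem_image.1 hx
      simp only [e]
      rw [abs_div, abs_of_pos hR0, div_le_one hR0, abs_le, hR]
      have := hbox x hxF i
      have := abs_le.1 (hvi i)
      constructor <;> nlinarith [mul_pos ht0 hr]) (by
      intro x hx y hy hxy
      obtain ⟨x, hxF, rfl⟩ := Finset.mem_image.1 hx
      obtain ⟨y, hyF, rfl⟩ := Finset.mem_image.1 hy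
      obtain ⟨i, hi⟩ := hsep x hxF y hyF fun h => hxy (h ▸ rfl)
      refine ⟨i, ?_⟩
      rw [hes, le_div_iff₀ hR0, hs]
      calc _ = ε := by field_simp
        _ ≤ _ := hi) (by
      intro x hx
      obtain ⟨x, hxF, rfl⟩ := Finset.mem_image.1 hx
      have h1 : w (fun i => (e x i : ℂ)) = fun i => ((x i - v i : ℝ) : ℂ) := funext fun i => by
        simp only [w, e]
        push_cast
        field_simp
        ring
      have h2 := hzero x hxF fun i => by
        have := (hbox x hxF i).1
        have := abs_le.1 (hvi i)
        have := mul_pos ht0 (hq i)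
        nlinarith [mul_pos ht0 hr]
      simp only [f]
      rw [h1, h2, zero_mul])
  rw [Finset.card_image_of_injective _ he] at main
  have hsm : s * (8 / ε * (r * t)) = 1 := by
    rw [hs, hR]
    field_simp
    norm_num
  calc (F.card : ℝ) = F.card * s ^ m * (8 / ε * (r * t)) ^ m := by
        rw [mul_assoc, ← mul_pow, hsm, one_pow, mul_one]
    _ ≤ K * (4 * η * (r * t)) * (8 / ε * (r * t)) ^ m := by
        refine mul_le_mul_of_nonneg_right ?_ (by positivity)
        exact main.trans (mul_le_mul_of_nonneg_left hlog hK.le)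
    _ = _ := by ring

end OrthantBounded

lemma card_le_of_separated {n : ℕ} {ε ℓ : ℝ} (hε : 0 < ε) (hℓ : ε ≤ ℓ) (p : Fin n → ℝ)
    (F : Finset (Fin n → ℝ)) (hsep : ∀ x ∈ F, ∀ y ∈ F, x ≠ y → ∃ i, ε ≤ |x i - y i|)
    (hbox : ∀ x ∈ F, ∀ i, p i ≤ x i ∧ x i ≤ p i + ℓ) :
    (F.card : ℝ) ≤ (2 / ε) ^ n * ℓ ^ n := by
  let T : Finset (Fin n → ℕ) := Fintype.piFinset fun _ => Finset.range (⌊ℓ / ε⌋₊ + 1)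
  have hinj : F.card ≤ T.card := by
    refine Finset.card_le_card_of_injOn (fun x i => ⌊(x i - p i) / ε⌋₊) (fun x hx => ?_) ?_
    · refine Fintype.mem_piFinset.2 fun i => Finset.mem_range_succ_iff.2 (Nat.floor_mono ?_)
      have := hbox x hx i
      gcongr
      linarith
    · intro x hx y hy hxy
      by_contra hne
      obtain ⟨i, hi⟩ := hsep x hx y hy hne
      have h1 : ⌊(x i - p i) / ε⌋₊ = ⌊(y i - p i) / ε⌋₊ := congrFun hxy i
      have hx0 : 0 ≤ (x i - p i) / ε := div_nonneg (by linarith [(hbox x hx i).1]) hε.le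
      have hy0 : 0 ≤ (y i - p i) / ε := div_nonneg (by linarith [(hbox y hy i).1]) hε.le
      have h2 : |(x i - p i) / ε - (y i - p i) / ε| < 1 := by
        rw [abs_lt]
        have e1 := Nat.floor_le hx0
        have e2 := Nat.floor_le hy0
        have e3 := Nat.lt_floor_add_one ((x i - p i) / ε)
        have e4 := Nat.lt_floor_add_one ((y i - p i) / ε)
        rw [h1] at e1 e3
        constructor <;> linarith
      rw [← sub_div, sub_sub_sub_cancel_right, abs_div, abs_of_pos hε, div_lt_one hε] at h2
      linarith
  have hT : T.card = (⌊ℓ / ε⌋₊ + 1) ^ n := by simp [T]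
  have h1 : ((⌊ℓ / ε⌋₊ : ℝ) + 1) ≤ 2 / ε * ℓ := by
    have h2 := Nat.floor_le (div_nonneg (hε.le.trans hℓ) hε.le)
    have h3 : 1 ≤ ℓ / ε := (one_le_div hε).2 hℓ
    calc _ ≤ 2 * (ℓ / ε) := by linarith
      _ = _ := by ring
  calc (F.card : ℝ) ≤ (T.card : ℝ) := by exact_mod_cast hinj
    _ = ((⌊ℓ / ε⌋₊ : ℝ) + 1) ^ n := by rw [hT]; push_cast; rfl
    _ ≤ (2 / ε * ℓ) ^ n := by gcongr
    _ = _ := mul_pow _ _ _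

namespace OrthantBounded

variable {n : ℕ} {G : (Fin n → ℝ) → ℂ} {M : ℝ}

lemma eventually_nearlySupported {x : Fin n → ℝ} (hx : ∀ i, 0 < x i)
    (hd : DifferentiableAt ℝ (suppFun G) x) {η : ℝ} (hη : 0 < η) :
    ∀ᶠ N : ℕ in atTop, ∀ q : Fin n → ℝ, (∀ i, |q i - x i| ≤ 1 / (N : ℝ)) →
      NearlySupported G q (1 / (N : ℝ)) η := by
  set A := fderiv ℝ (suppFun G) x
  have h1 := hd.hasFDerivAt.isLittleO.def (show 0 < η / 22 by positivity)
  have hpos : ∀ᶠ y in nhds x, ∀ i, 0 < y i := eventually_all.2 fun i =>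
    (continuous_apply i).continuousAt.eventually (lt_mem_nhds (hx i))
  obtain ⟨δ, hδ, hball⟩ := Metric.eventually_nhds_iff_ball.1 (h1.and hpos)
  have hlim : Tendsto (fun N : ℕ => 21 * (1 / (N : ℝ))) atTop (nhds (21 * 0)) :=
    tendsto_one_div_atTop_nhds_zero_nat.const_mul _
  rw [mul_zero] at hlim
  filter_upwards [hlim.eventually (gt_mem_nhds hδ), eventually_gt_atTop 0] with N hN hN0 q hq
  set r := 1 / (N : ℝ)
  have hr : 0 < r := by positivity
  have hA : ∀ w : Fin n → ℝ, A w = ∑ i, A (Pi.single i 1) * w i := fun w => by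
    conv_lhs => rw [← Finset.univ_sum_single w, map_sum]
    refine Finset.sum_congr rfl fun i _ => ?_
    rw [mul_comm, ← smul_eq_mul, ← map_smul, ← Pi.single_smul, smul_eq_mul, mul_one]
  refine ⟨fun i => A (Pi.single i 1), fun y hy => ?_⟩
  have hqx : ‖q - x‖ ≤ r := (pi_norm_le_iff_of_nonneg hr.le).2 hq
  have hyx : ‖y - x‖ ≤ 21 * r := (pi_norm_le_iff_of_nonneg (by positivity)).2 fun i => by
    rw [Pi.sub_apply, Real.norm_eq_abs]
    have := abs_sub_le (y i) (q i) (x i)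
    linarith [hy i, hq i]
  have hyb := hball y (mem_ball_iff_norm.2 (hyx.trans_lt hN))
  have hqb := hball q (mem_ball_iff_norm.2 (by linarith))
  refine ⟨hyb.2, ?_⟩
  have e1 := (abs_le.1 hyb.1).1
  have e2 := (abs_le.1 hqb.1).2
  have e3 : ∑ i, A (Pi.single i 1) * (y i - q i) = A (y - x) - A (q - x) := by
    rw [← map_sub, sub_sub_sub_cancel_right, hA]
    rfl
  rw [e3]
  nlinarith

/-- The corner of the grid cube of side `1 / N` with index `κ`. -/
def gridCorner {N : ℕ} (κ : Fin n → Fin N) (i : Fin n) : ℝ := (κ i : ℕ) / (N : ℝ)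

lemma exists_grid (hG : OrthantBounded G M) (hne : ¬ ∀ᵐ s, G s = 0) {η δ : ℝ} (hη : 0 < η)
    (hδ : 0 < δ) : ∃ N : ℕ, 0 < N ∧ ({κ : Fin n → Fin N |
      ¬ NearlySupported G (gridCorner κ) (1 / (N : ℝ)) η}.ncard : ℝ) ≤ δ * (N : ℝ) ^ n := by
  let Q : (N : ℕ) → (Fin n → Fin N) → Set (Fin n → ℝ) := fun N κ =>
    Set.pi univ fun i => Ico (gridCorner κ i) (gridCorner κ i + 1 / (N : ℝ))
  have hQm : ∀ N κ, MeasurableSet (Q N κ) := fun N κ =>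
    MeasurableSet.univ_pi fun _ => measurableSet_Ico
  let S : (N : ℕ) → Set (Fin n → Fin N) := fun N =>
    {κ | ¬ NearlySupported G (gridCorner κ) (1 / (N : ℝ)) η}
  let U : ℕ → Set (Fin n → ℝ) := fun N => ⋃ κ ∈ S N, Q N κ
  have hUm : ∀ N, MeasurableSet (U N) := fun N =>
    MeasurableSet.biUnion (to_countable _) fun κ _ => hQm N κ
  have hfloor : ∀ N κ x, x ∈ Q N κ → 0 < N → ∀ i, ⌊(N : ℝ) * x i⌋₊ = κ i := by
    intro N κ x hx hN i
    have h1 := hx i trivial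
    simp only [gridCorner, mem_Ico, ← add_div] at h1
    have hN' : (0:ℝ) < N := by exact_mod_cast hN
    rw [div_le_iff₀ hN', lt_div_iff₀ hN', mul_comm (x i)] at h1
    exact (Nat.floor_eq_iff ((Nat.cast_nonneg _).trans h1.1)).2 h1
  have hsub : ∀ N, 0 < N → U N ⊆ Icc 0 1 := by
    intro N hN x hx
    obtain ⟨κ, -, hx⟩ := mem_iUnion₂.1 hx
    have hN' : (0:ℝ) < N := by exact_mod_cast hN
    refine ⟨fun i => ?_, fun i => ?_⟩
    · exact (div_nonneg (Nat.cast_nonneg _) hN'.le).trans (hx i trivial).1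
    · refine (hx i trivial).2.le.trans ?_
      rw [gridCorner, ← add_div, Pi.one_apply, div_le_one hN']
      exact_mod_cast (κ i).2
  have hcoord : ∀ᵐ s : Fin n → ℝ, ∀ i, s i ≠ 0 := ae_all_iff.2 fun i => by
    have := ae_sum_mul_ne (x := Pi.single i 1) (i := i) (by simp) 0
    filter_upwards [this] with s hs
    simpa [Pi.single_apply] using hs
  have hlim : Tendsto (fun N => volume (U N)) atTop (nhds (volume (∅ : Set (Fin n → ℝ)))) := by
    refine tendsto_measure_of_ae_tendsto_indicator atTop MeasurableSet.empty hUm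
      (measurableSet_Icc (a := (0 : Fin n → ℝ)) (b := 1)) isCompact_Icc.measure_ne_top
      ((eventually_gt_atTop 0).mono hsub) ?_
    filter_upwards [hG.ae_differentiableAt_suppFun hne, hcoord] with x hx hx0
    simp only [mem_empty_iff_false, iff_false]
    by_cases hpos : ∀ i, 0 < x i
    · filter_upwards [eventually_nearlySupported hpos (hx hpos) hη] with N hN hxU
      obtain ⟨κ, hκ, hxκ⟩ := mem_iUnion₂.1 hxU
      refine hκ (hN _ fun i => ?_)
      have := hxκ i trivial
      rw [abs_le]
      constructor <;> linarith [this.1, this.2]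
    · filter_upwards [eventually_gt_atTop 0] with N hN hxU
      exact hpos fun i => lt_of_le_of_ne ((hsub N hN hxU).1 i) (hx0 i).symm
  rw [measure_empty] at hlim
  obtain ⟨N, hN, hN0⟩ := ((hlim.eventually (gt_mem_nhds (ENNReal.ofReal_pos.2 hδ))).and
    (eventually_gt_atTop 0)).exists
  have hN' : (0:ℝ) < N := by exact_mod_cast hN0
  refine ⟨N, hN0, ?_⟩
  have hvol : volume (U N) = (S N).ncard * ENNReal.ofReal ((1 / (N : ℝ)) ^ n) := by
    have hfin : (S N).Finite := toFinite _
    have hU : U N = ⋃ κ ∈ hfin.toFinset, Q N κ := by simp [U]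
    rw [hU, measure_biUnion_finset ?_ fun κ _ => hQm N κ]
    · have : ∀ κ ∈ hfin.toFinset, volume (Q N κ) = ENNReal.ofReal ((1 / (N : ℝ)) ^ n) := by
        intro κ _
        rw [Real.volume_pi_Ico, ENNReal.ofReal_pow (by positivity)]
        simp
      rw [Finset.sum_congr rfl this, Finset.sum_const, nsmul_eq_mul,
        ncard_eq_toFinset_card _ hfin]
    · intro κ _ κ' _ hκ
      refine disjoint_left.2 fun x hx hx' => hκ (funext fun i => Fin.ext ?_)
      rw [← hfloor N κ x hx hN0 i, ← hfloor N κ' x hx' hN0 i]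
  rw [hvol, ← ENNReal.ofReal_natCast, ← ENNReal.ofReal_mul (by positivity)] at hN
  have h2 := ((ENNReal.ofReal_lt_ofReal_iff hδ).1 hN).le
  rw [one_div, inv_pow, ← div_eq_mul_inv, div_le_iff₀ (by positivity)] at h2
  exact h2

end OrthantBounded

namespace OrthantBounded

variable {m : ℕ} {G : (Fin (m + 1) → ℝ) → ℂ} {M : ℝ}

/-- Separated real zeros of the Laplace transform of a nonzero function have density zero. -/
lemma eventually_card_zeros_le (hG : OrthantBounded G M) (hne : ¬ ∀ᵐ s, G s = 0) {ε δ : ℝ}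
    (hε : 0 < ε) (hδ : 0 < δ) (v : Fin (m + 1) → ℝ) :
    ∀ᶠ t : ℝ in atTop, ∀ F : Finset (Fin (m + 1) → ℝ),
      (∀ x ∈ F, ∀ y ∈ F, x ≠ y → ∃ i, ε ≤ |x i - y i|) →
      (∀ x ∈ F, ∀ i, 0 ≤ x i ∧ x i < t) →
      (∀ x ∈ F, (∀ i, v i < x i) → laplaceInt G (fun i => ((x i - v i : ℝ) : ℂ)) = 0) →
      (F.card : ℝ) ≤ δ * t ^ (m + 1) := by
  classical
  obtain ⟨K, hK, hgood⟩ := hG.exists_forall_card_le_of_nearlySupported hne hε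
  set C := (2 / ε) ^ (m + 1)
  have hC : 0 < C := by positivity
  set η := δ / (2 * K) with hη'
  have hη : 0 < η := by positivity
  obtain ⟨N, hN0, hbad⟩ := hG.exists_grid hne hη (show 0 < δ / (2 * C) by positivity)
  have hN : (0:ℝ) < N := by exact_mod_cast hN0
  have hev : ∀ᶠ t : ℝ in atTop, ∀ κ : Fin (m + 1) → Fin N,
      NearlySupported G (gridCorner κ) (1 / (N : ℝ)) η → ∀ F : Finset (Fin (m + 1) → ℝ),
        (∀ x ∈ F, ∀ y ∈ F, x ≠ y → ∃ i, ε ≤ |x i - y i|) →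
        (∀ x ∈ F, ∀ i, t * gridCorner κ i ≤ x i ∧ x i ≤ t * (gridCorner κ i + 1 / (N : ℝ))) →
        (∀ x ∈ F, (∀ i, v i < x i) → laplaceInt G (fun i => ((x i - v i : ℝ) : ℂ)) = 0) →
        (F.card : ℝ) ≤ K * η * (1 / (N : ℝ) * t) ^ (m + 1) := by
    refine eventually_all.2 fun κ => ?_
    by_cases h : NearlySupported G (gridCorner κ) (1 / (N : ℝ)) η
    · exact (hgood v _ _ η (by positivity) hη h).mono fun t ht _ => ht
    · exact Eventually.of_forall fun t h' => absurd h' h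
  filter_upwards [hev, eventually_gt_atTop 0, eventually_ge_atTop (ε * N)] with t ht ht0 htε
  intro F hsep hbox hzero
  let P : (Fin (m + 1) → Fin N) → Finset (Fin (m + 1) → ℝ) := fun κ => F.filter fun x =>
    ∀ i, t * gridCorner κ i ≤ x i ∧ x i ≤ t * (gridCorner κ i + 1 / (N : ℝ))
  have hcover : F ⊆ Finset.univ.biUnion P := by
    intro x hx
    have hlt : ∀ i, ⌊(N : ℝ) * x i / t⌋₊ < N := fun i => by
      have := hbox x hx i
      rw [Nat.floor_lt (by have := this.1; positivity), div_lt_iff₀ ht0]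
      exact mul_lt_mul_of_pos_left this.2 hN
    refine Finset.mem_biUnion.2 ⟨fun i => ⟨_, hlt i⟩, Finset.mem_univ _,
      Finset.mem_filter.2 ⟨hx, fun i => ?_⟩⟩
    have h0 : 0 ≤ (N : ℝ) * x i / t := by have := (hbox x hx i).1; positivity
    have e1 := Nat.floor_le h0
    have e2 := (Nat.lt_floor_add_one ((N : ℝ) * x i / t)).le
    rw [le_div_iff₀ ht0] at e1
    rw [div_le_iff₀ ht0] at e2
    simp only [gridCorner]
    rw [← add_div, ← mul_div_assoc, ← mul_div_assoc, div_le_iff₀ hN, le_div_iff₀ hN]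
    constructor <;> linarith
  set B : ℝ := (1 / (N : ℝ) * t) ^ (m + 1) with hB
  have hB0 : 0 ≤ B := by positivity
  set S : Finset (Fin (m + 1) → Fin N) := Finset.univ.filter fun κ =>
    ¬ NearlySupported G (gridCorner κ) (1 / (N : ℝ)) η with hSdef
  have hScard : (S.card : ℝ) ≤ δ / (2 * C) * (N : ℝ) ^ (m + 1) := by
    rw [← ncard_coe_finset]
    simpa [hSdef] using hbad
  have hP : ∀ κ, ((P κ).card : ℝ) ≤ K * η * B + if κ ∈ S then C * B else 0 := by
    intro κ
    have hsepP : ∀ x ∈ P κ, ∀ y ∈ P κ, x ≠ y → ∃ i, ε ≤ |x i - y i| := fun x hx y hy =>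
      hsep x (Finset.mem_filter.1 hx).1 y (Finset.mem_filter.1 hy).1
    have hboxP := fun x (hx : x ∈ P κ) => (Finset.mem_filter.1 hx).2
    by_cases h : NearlySupported G (gridCorner κ) (1 / (N : ℝ)) η
    · have : κ ∉ S := by simpa [hSdef] using h
      rw [if_neg this, add_zero]
      exact ht κ h (P κ) hsepP hboxP fun x hx => hzero x (Finset.mem_filter.1 hx).1
    · have : κ ∈ S := by simpa [hSdef] using h
      rw [if_pos this]
      have h1 := card_le_of_separated hε (ℓ := 1 / (N : ℝ) * t)
        (by rw [one_div, inv_mul_eq_div, le_div_iff₀ hN]; exact htε)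
        (fun i => t * gridCorner κ i) (P κ) hsepP fun x hx i => by
          have := hboxP x hx i
          rw [mul_add, mul_comm t (1 / (N : ℝ))] at this
          exact this
      exact h1.trans (le_add_of_nonneg_left (by positivity))
  have hNB : (N : ℝ) ^ (m + 1) * B = t ^ (m + 1) := by
    rw [hB, ← mul_pow]
    congr 1
    field_simp
  calc (F.card : ℝ) ≤ (∑ κ, (P κ).card : ℕ) := by
        exact_mod_cast (Finset.card_le_card hcover).trans Finset.card_biUnion_le
    _ ≤ ∑ κ, (K * η * B + if κ ∈ S then C * B else 0) := by
        push_cast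
        exact Finset.sum_le_sum fun κ _ => hP κ
    _ = K * η * ((N : ℝ) ^ (m + 1) * B) + S.card * (C * B) := by
        rw [Finset.sum_add_distrib, Finset.sum_const, Finset.sum_ite_mem, Finset.univ_inter,
          Finset.sum_const, nsmul_eq_mul, nsmul_eq_mul]
        simp
        ring
    _ ≤ K * η * ((N : ℝ) ^ (m + 1) * B) + δ / (2 * C) * (N : ℝ) ^ (m + 1) * (C * B) := by
        gcongr
    _ = (K * η + δ / 2) * ((N : ℝ) ^ (m + 1) * B) := by
        field_simp
    _ = δ * t ^ (m + 1) := by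
        rw [hNB, hη']
        congr 1
        field_simp
        norm_num

end OrthantBounded

theorem stmt14 (n : ℕ) (S : Set (Fin n → ℕ)) (hS : S.Nonempty)
    (lam : Fin n → ℕ → ℂ) (hre : ∀ j k, 1 ≤ (lam j k).re)
    (hsep : ∃ ε > (0:ℝ), ∀ k ∈ S, ∀ k' ∈ S, k ≠ k' →
      ε ≤ ∑ j, |(lam j (k j)).re - (lam j (k' j)).re|)
    (hdens : 0 < Filter.atTop.limsup (fun t : ℝ =>
      (({k : Fin n → ℕ | k ∈ S ∧ ∑ j, |(lam j (k j)).re - 1| ≤ t}.ncard : ℝ) / t ^ n)))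
    (him : ∀ j : Fin n, ∃ c : ℝ, ∀ k ∈ S, (lam j (k j)).im = c) :
    IsMUniquenessFamily n (fun (k : S) j => lam j ((k : Fin n → ℕ) j)) := by
  classical
  rintro f hf ⟨ω, -, hω, hωlam⟩ hzero
  obtain ⟨k₀, hk₀⟩ := hS
  obtain _ | m := n
  · refine ae_eq_zero_of_mLapPartial hf (l := fun j => lam j (k₀ j)) fun t => ?_
    refine tendsto_nhds_unique ?_ (hzero ⟨k₀, hk₀⟩)
    exact tendsto_const_nhds.congr fun t' => by rw [Subsingleton.elim t t']
  set σ : Fin (m + 1) → ℂ := fun j => lam j (k₀ j)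
  have hσ : σ ∈ mOmegaB (m + 1) f := (hω fun j => hωlam ⟨k₀, hk₀⟩ j).1
  refine ae_eq_zero_of_mLapPartial hf (l := σ) (mLapPartial_eq_zero_of_ae hf ?_)
  by_contra hne
  obtain ⟨M, hG⟩ := exists_orthantBounded_mLapPartial hf hσ
  obtain ⟨ε, hε, hsep⟩ := hsep
  let x : (Fin (m + 1) → ℕ) → Fin (m + 1) → ℝ := fun k j => (lam j (k j)).re
  let A : ℝ → Set (Fin (m + 1) → ℕ) := fun t => {k | k ∈ S ∧ ∑ j, |(lam j (k j)).re - 1| ≤ t}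
  have hfreq : ∃ δ > 0, ∃ᶠ t : ℝ in atTop, δ < ((A t).ncard : ℝ) / t ^ (m + 1) := by
    obtain ⟨δ, hδ, hδ'⟩ := exists_between hdens
    refine ⟨δ, hδ, fun hcon => hδ'.not_ge (limsup_le_of_le ?_ (hcon.mono fun t => not_lt.1))⟩
    refine IsBoundedUnder.isCoboundedUnder_le ⟨0, ?_⟩
    rw [eventually_map]
    filter_upwards [eventually_gt_atTop 0] with t ht
    change (0:ℝ) ≤ _
    positivity
  obtain ⟨δ, hδ, hfreq⟩ := hfreq
  have hsep' : ∀ k ∈ S, ∀ k' ∈ S, k ≠ k' → ∃ i, ε / (m + 1) ≤ |x k i - x k' i| := by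
    intro k hk k' hk' hkk
    by_contra hcon
    push Not at hcon
    refine (hsep k hk k' hk' hkk).not_gt ?_
    calc _ < ∑ _j : Fin (m + 1), ε / (m + 1) :=
          Finset.sum_lt_sum_of_nonempty Finset.univ_nonempty fun j _ => hcon j
      _ = ε := by
          rw [Finset.sum_const, Finset.card_univ, Fintype.card_fin, nsmul_eq_mul]
          push_cast
          field_simp
  have hinj : InjOn x S := fun k hk k' hk' hkk => by
    by_contra h
    obtain ⟨i, hi⟩ := hsep' k hk k' hk' h
    rw [hkk, sub_self, abs_zero] at hi
    exact hi.not_gt (by positivity)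
  have hcount := (tendsto_id.const_mul_atTop (two_pos (α := ℝ))).eventually
    (hG.eventually_card_zeros_le hne (show 0 < ε / (m + 1) by positivity)
      (show 0 < δ / 2 ^ (m + 1) by positivity) fun i => (σ i).re)
  obtain ⟨t, hdt, hct, ht1⟩ := (hfreq.and_eventually (hcount.and (eventually_gt_atTop 1))).exists
  have ht0 : 0 < t := one_pos.trans ht1
  have hfin : (A t).Finite := by
    refine finite_of_ncard_ne_zero fun h => ?_
    rw [h, Nat.cast_zero, zero_div] at hdt
    exact hdt.not_gt hδ
  have hcard := hct (hfin.toFinset.image x) (by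
      intro y hy y' hy' hyy
      obtain ⟨k, hk, rfl⟩ := Finset.mem_image.1 hy
      obtain ⟨k', hk', rfl⟩ := Finset.mem_image.1 hy'
      exact hsep' k (hfin.mem_toFinset.1 hk).1 k' (hfin.mem_toFinset.1 hk').1
        fun h => hyy (h ▸ rfl)) (by
      intro y hy i
      obtain ⟨k, hk, rfl⟩ := Finset.mem_image.1 hy
      have h1 := (hfin.mem_toFinset.1 hk).2
      have h2 := (Finset.single_le_sum (f := fun j => |(lam j (k j)).re - 1|)
        (fun j _ => abs_nonneg _) (Finset.mem_univ i)).trans h1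
      have h3 := (abs_le.1 h2).2
      have h4 := hre i (k i)
      simp only [x, id]
      constructor <;> linarith) (by
      intro y hy hpos
      obtain ⟨k, hk, rfl⟩ := Finset.mem_image.1 hy
      have hkS := (hfin.mem_toFinset.1 hk).1
      refine laplaceInt_eq_zero_of_hasMLaplace hf hσ (fun i => ?_) ?_
      · rw [Complex.ofReal_re]
        exact sub_pos.2 (hpos i)
      · convert hzero ⟨k, hkS⟩ using 1
        funext i
        obtain ⟨c, hc⟩ := him i
        refine Complex.ext ?_ ?_
        · simp [x]
        · simp [σ, hc k hkS, hc k₀ hk₀])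
  rw [Finset.card_image_of_injOn fun k hk k' hk' =>
      hinj (hfin.mem_toFinset.1 hk).1 (hfin.mem_toFinset.1 hk').1,
    ← ncard_eq_toFinset_card _ hfin, id, mul_pow, ← mul_assoc,
    div_mul_cancel₀ _ (by positivity)] at hcard
  rw [lt_div_iff₀ (by positivity)] at hdt
  exact hdt.not_ge hcard

end
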